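/- For every ε > 0, the bound ∫_T^{2T} J_1(t,G)^3 dt ≪_ε T^{1+ε} holds uniformly for all G with T^{1/7+ε} ≤ G ≤ T (where T ≥ 2). -/

import Mathlib

open Real MeasureTheory

/-- The smoothed moment `J_k(t,G) = (1/(√π G)) ∫_ℝ |ζ(1/2+it+iu)|^{2k} e^{-(u/G)²} du`. -/
noncomputable def J (k : ℕ) (t G : ℝ) : ℝ :=
  (1 / (Real.sqrt Real.pi * G)) *
    ∫ u : ℝ, ‖riemannZeta (1 / 2 + Complex.I * (t : ℂ) + Complex.I * (u : ℂ))‖ ^ (2 * k) *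
      Real.exp (-(u / G) ^ 2)

namespace TM

lemma cpow_diff_bound (s : ℂ) (hs : 0 < s.re) (x : ℝ) (hx : 1 ≤ x) :
    ‖(x:ℂ)^(-s) - ((x+1:ℝ):ℂ)^(-s)‖ ≤ ‖s‖ * x ^ (-s.re - 1) := by
  have key : ∀ z ∈ Set.Icc x (x+1), HasDerivWithinAt (fun y:ℝ => (y:ℂ)^(-s)) (-s * (z:ℂ)^(-s-1)) (Set.Icc x (x+1)) z := by
    intro z hz
    have hz0 : 0 < z := by linarith [hz.1]
    have h1 := (hasDerivAt_ofReal_cpow_const' (x := z) hz0.ne' (r := -s-1) (by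
      intro h
      have : s = 0 := by linear_combination -h
      rw [this] at hs; simp at hs))
    have h2 := (h1.const_mul (-s))
    refine HasDerivAt.hasDerivWithinAt ?_
    have hs0 : s ≠ 0 := by rintro rfl; simp at hs
    have h3 : (fun y:ℝ => (y:ℂ)^(-s)) = fun y:ℝ => -s * ((y:ℂ)^(-s-1+1)/(-s-1+1)) := by
      funext y
      have : (-s - 1 + 1 : ℂ) = -s := by ring
      rw [this]; field_simp
    rw [h3]; exact h2
  have bound : ∀ z ∈ Set.Icc x (x+1), ‖-s * (z:ℂ)^(-s-1)‖ ≤ ‖s‖ * x ^ (-s.re - 1) := by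
    intro z hz
    have hz0 : 0 < z := by linarith [hz.1]
    rw [norm_mul, norm_neg, Complex.norm_cpow_eq_rpow_re_of_pos hz0]
    simp only [Complex.sub_re, Complex.neg_re, Complex.one_re]
    gcongr ?_ * ?_
    exact Real.rpow_le_rpow_of_nonpos (by linarith) hz.1 (by linarith)
  have := (convex_Icc x (x+1)).norm_image_sub_le_of_norm_hasDerivWithin_le key bound
    (x := x+1) (y := x) (by simp) (by simp)
  simpa using this

noncomputable def ePair (j : ℕ) (s : ℂ) : ℂ := ((2*j+1:ℝ):ℂ)^(-s) - ((2*j+1+1:ℝ):ℂ)^(-s)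

lemma ePair_norm (j : ℕ) (s : ℂ) (hs : 0 < s.re) :
    ‖ePair j s‖ ≤ ‖s‖ * (2*j+1:ℝ) ^ (-s.re - 1) :=
  cpow_diff_bound s hs _ (by have := Nat.cast_nonneg (α:=ℝ) j; linarith)

lemma ePair_norm' (j : ℕ) (s : ℂ) (σ : ℝ) (hσ : 0 < σ) (hs : σ ≤ s.re) :
    ‖ePair j s‖ ≤ ‖s‖ * (j+1:ℝ) ^ (-σ - 1) := by
  refine (ePair_norm j s (by linarith)).trans ?_
  have := Nat.cast_nonneg (α:=ℝ) j
  gcongr ?_ * ?_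
  calc (2*j+1:ℝ) ^ (-s.re - 1) ≤ (j+1:ℝ)^(-s.re-1) :=
        Real.rpow_le_rpow_of_nonpos (by linarith) (by linarith) (by linarith)
    _ ≤ _ := Real.rpow_le_rpow_of_exponent_le (by linarith) (by linarith)

lemma summable_aux (σ : ℝ) (hσ : 0 < σ) : Summable (fun j : ℕ => (j+1:ℝ) ^ (-σ - 1)) := by
  have := (summable_nat_add_iff 1).2 (Real.summable_nat_rpow (p := -σ-1) |>.2 (by linarith))
  simpa using this

noncomputable def eta (s : ℂ) : ℂ := ∑' j, ePair j s

lemma eta_summable (s : ℂ) (hs : 0 < s.re) : Summable (fun j => ePair j s) :=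
  Summable.of_norm_bounded ((summable_aux _ hs).mul_left ‖s‖) (fun j => ePair_norm' j s _ hs le_rfl)

lemma eta_diff : DifferentiableOn ℂ eta {s | 0 < s.re} := by
  intro s hs
  have hs : 0 < s.re := hs
  set U : Set ℂ := {z | s.re/2 < z.re} ∩ Metric.ball 0 (‖s‖+1)
  have hU : IsOpen U := (isOpen_lt continuous_const Complex.continuous_re).inter Metric.isOpen_ball
  have hsU : s ∈ U := ⟨by simp only [Set.mem_ofPred_eq]; linarith, by simp⟩
  have := Complex.differentiableOn_tsum_of_summable_norm (F := ePair) (U := U)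
    ((summable_aux (s.re/2) (by linarith)).mul_left (‖s‖+1)) (by
      intro j z hz
      unfold ePair
      have h1 : ((2*j+1:ℝ):ℂ) ≠ 0 := Complex.ofReal_ne_zero.2 (by positivity)
      have h2 : ((2*j+1+1:ℝ):ℂ) ≠ 0 := Complex.ofReal_ne_zero.2 (by positivity)
      exact ((differentiableAt_id.neg.const_cpow (Or.inl h1)).sub
        (differentiableAt_id.neg.const_cpow (Or.inl h2))).differentiableWithinAt) hU (by
      intro j z hz
      refine (ePair_norm' j z (s.re/2) (by linarith) (le_of_lt hz.1)).trans ?_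
      have : ‖z‖ ≤ ‖s‖+1 := by have := hz.2; simp at this; exact this.le
      gcongr)
  exact (this.differentiableAt (hU.mem_nhds hsU)).differentiableWithinAt

lemma eta_eq_one_lt (s : ℂ) (hs : 1 < s.re) : eta s = (1 - 2^(1-s)) * riemannZeta s := by
  set f : ℕ → ℂ := fun n => 1 / ((n:ℂ)+1)^s
  have hf : Summable f := by
    have := (Complex.summable_one_div_nat_cpow (p := s)).2 hs
    have := (summable_nat_add_iff 1).2 this
    simpa [f] using this
  have hz : riemannZeta s = ∑' n, f n := zeta_eq_tsum_one_div_nat_add_one_cpow hs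
  have he : Summable (fun k => f (2*k)) := hf.comp_injective (fun a b h => by simpa using h)
  have ho : Summable (fun k => f (2*k+1)) := hf.comp_injective (fun a b h => by simpa using h)
  have h1 : ∑' k, f (2*k) + ∑' k, f (2*k+1) = riemannZeta s := by rw [hz]; exact tsum_even_add_odd he ho
  have h2 : ∑' k, f (2*k+1) = 2^(-s) * riemannZeta s := by
    rw [hz, ← tsum_mul_left]
    congr 1; funext k
    simp only [f]
    have : (((2*k+1:ℕ):ℂ)+1) = ((2:ℝ):ℂ) * ((k+1:ℝ):ℂ) := by push_cast; ring
    rw [this, Complex.mul_cpow_ofReal_nonneg (by norm_num) (by positivity), Complex.cpow_neg]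
    push_cast
    rw [one_div, mul_inv, one_div]
  have h3 : eta s = ∑' k, f (2*k) - ∑' k, f (2*k+1) := by
    rw [← he.tsum_sub ho]; unfold eta; congr 1; funext k
    simp only [f, ePair, Complex.cpow_neg, one_div]
    push_cast; rfl
  have h4 : (2:ℂ)^(1-s) = 2 * 2^(-s) := by
    rw [sub_eq_add_neg, Complex.cpow_add _ _ two_ne_zero, Complex.cpow_one]
  rw [h3, h4]
  linear_combination h1 - 2 * h2

lemma eta_eq (s : ℂ) (hs : 0 < s.re) (h1 : s ≠ 1) : eta s = (1 - 2^(1-s)) * riemannZeta s := by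
  set U : Set ℂ := {s | 0 < s.re}
  have hU : IsOpen U := isOpen_lt continuous_const Complex.continuous_re
  have hA : AnalyticOnNhd ℂ (fun s => (s-1) * eta s) U :=
    DifferentiableOn.analyticOnNhd ((differentiableOn_id.sub_const 1).mul eta_diff) hU
  have hB : AnalyticOnNhd ℂ (fun s => (1 - 2^(1-s)) * riemannZeta₁ s) U := by
    refine DifferentiableOn.analyticOnNhd ?_ hU
    refine Differentiable.differentiableOn ?_
    refine Differentiable.mul ?_ differentiable_riemannZeta₁
    intro z
    exact (((differentiableAt_const 1).sub differentiableAt_id).const_cpow (Or.inl two_ne_zero)).const_sub 1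
  have hpre : IsPreconnected U := (convex_halfSpace_re_gt 0).isPreconnected
  have h2U : (2:ℂ) ∈ U := by simp [U]
  have hev : (fun s => (s-1) * eta s) =ᶠ[nhds 2] (fun s => (1 - 2^(1-s)) * riemannZeta₁ s) := by
    have : {z : ℂ | 1 < z.re} ∈ nhds (2:ℂ) :=
      (isOpen_lt continuous_const Complex.continuous_re).mem_nhds (by simp)
    filter_upwards [this] with z hz
    have hz1 : z ≠ 1 := by rintro rfl; simp at hz
    rw [eta_eq_one_lt z hz, riemannZeta_eq_inv_sub_mul hz1]
    have : z - 1 ≠ 0 := sub_ne_zero.2 hz1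
    field_simp
  have := hA.eqOn_of_preconnected_of_eventuallyEq hB hpre h2U hev hs
  simp only at this
  have h3 : s - 1 ≠ 0 := sub_ne_zero.2 h1
  rw [riemannZeta_eq_inv_sub_mul h1]
  apply mul_left_cancel₀ h3
  rw [this]; field_simp

lemma tail_bound (M : ℕ) (hM : 1 ≤ M) (s : ℂ) (hs : s.re = 1/2) :
    ‖eta s - ∑ j ∈ Finset.range M, ePair j s‖ ≤ 2 * ‖s‖ / √M := by
  have hs0 : 0 < s.re := by rw [hs]; norm_num
  have hsum := eta_summable s hs0
  have h1 : eta s - ∑ j ∈ Finset.range M, ePair j s = ∑' j, ePair (j+M) s := by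
    unfold eta; rw [← hsum.sum_add_tsum_nat_add M]; ring
  rw [h1]
  have hs' : Summable (fun j => ePair (j+M) s) := (summable_nat_add_iff M).2 hsum
  have hten := hs'.hasSum.tendsto_sum_nat.norm
  refine le_of_tendsto' hten ?_
  intro n
  have step : ∀ j : ℕ, 1 ≤ j → ‖ePair j s‖ ≤ 2 * ‖s‖ * (1/√(j:ℝ) - 1/√((j+1:ℕ):ℝ)) := by
    intro j hj
    refine (ePair_norm' j s (1/2) (by norm_num) hs.ge).trans ?_
    have hj' : (0:ℝ) < j := by exact_mod_cast hj
    have e1 : (j+1:ℝ)^(-(1/2:ℝ)-1) = 1 / (√(j+1:ℝ))^3 := by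
      rw [show (-(1/2:ℝ)-1) = -((1/2:ℝ)*(3:ℕ)) by norm_num, Real.rpow_neg (by positivity),
        Real.rpow_mul (by positivity), ← Real.sqrt_eq_rpow, Real.rpow_natCast, one_div]
    rw [e1]
    set a := √(j:ℝ) with ha
    have ha0 : 0 < a := Real.sqrt_pos.2 hj'
    push_cast
    set b := √(j+1:ℝ) with hb
    have hab : a ≤ b := Real.sqrt_le_sqrt (by linarith)
    have hb0 : 0 < b := by linarith
    have hsq : b^2 = a^2 + 1 := by
      rw [ha, hb, Real.sq_sqrt (by positivity), Real.sq_sqrt hj'.le]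
    have : 1/b^3 ≤ 2 * (1/a - 1/b) := by
      have e : 1/a - 1/b = 1/(a*b*(a+b)) := by
        field_simp; nlinarith
      rw [e, mul_one_div, div_le_div_iff₀ (by positivity) (by positivity)]
      have : a*b*(a+b) ≤ b*b*(b+b) := by gcongr
      nlinarith
    calc ‖s‖ * (1/b^3) ≤ ‖s‖ * (2 * (1/a - 1/b)) := by gcongr
      _ = _ := by ring
  have hM0 : (0:ℝ) < √M := Real.sqrt_pos.2 (by exact_mod_cast hM)
  have : ∑ i ∈ Finset.range n, ‖ePair (i+M) s‖ ≤ 2 * ‖s‖ * (1/√(M:ℝ) - 1/√((n+M:ℕ):ℝ)) := by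
    induction n with
    | zero => simp
    | succ n ih =>
      rw [Finset.sum_range_succ]
      have := step (n+M) (by omega)
      rw [show n+1+M = n+M+1 by ring]
      calc _ ≤ _ := add_le_add ih this
        _ = _ := by ring
  calc _ ≤ _ := norm_sum_le _ _
    _ ≤ _ := this
    _ ≤ 2 * ‖s‖ * (1/√(M:ℝ)) := by
      gcongr
      have : 0 ≤ 1/√((n+M:ℕ):ℝ) := by positivity
      linarith
    _ = _ := by ring

/-- the Dirichlet polynomial -/
noncomputable def Dp (X : ℕ) (τ : ℝ) : ℂ :=
  ∑ n ∈ Finset.Icc 1 X, (-1:ℂ)^n * (n:ℂ)^(-(1/2 + Complex.I * τ))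

lemma Dp_eq (M : ℕ) (τ : ℝ) : Dp (2*M) τ = - ∑ j ∈ Finset.range M, ePair j (1/2 + Complex.I * τ) := by
  unfold Dp
  induction M with
  | zero => simp
  | succ M ih =>
    rw [show 2*(M+1) = 2*M+1+1 by ring, Finset.sum_Icc_succ_top (by omega),
      Finset.sum_Icc_succ_top (by omega), ih, Finset.sum_range_succ]
    unfold ePair
    have : (-1:ℂ)^(2*M+1) = -1 := by rw [pow_succ, pow_mul]; simp
    have h2 : (-1:ℂ)^(2*M+1+1) = 1 := by rw [pow_succ, this]; simp
    rw [this, h2]; push_cast; ring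

lemma zeta_bound (τ : ℝ) (M : ℕ) (hM : 1 ≤ M) :
    ‖riemannZeta (1/2 + Complex.I * τ)‖^2 ≤ 13 * ‖Dp (2*M) τ‖^2 + 52 * (1/4 + τ^2) / M := by
  set s : ℂ := 1/2 + Complex.I * τ with hsdef
  have hre : s.re = 1/2 := by simp [hsdef]
  have him : s.im = τ := by simp [hsdef]
  have hs1 : s ≠ 1 := by intro h; rw [h] at hre; norm_num at hre
  have he := eta_eq s (by rw [hre]; norm_num) hs1
  have hM0 : (0:ℝ) < M := by exact_mod_cast hM
  have htail := tail_bound M hM s hre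
  have hD : ‖Dp (2*M) τ‖ = ‖∑ j ∈ Finset.range M, ePair j s‖ := by rw [Dp_eq, norm_neg]
  have hsn : ‖s‖^2 = 1/4 + τ^2 := by
    rw [Complex.sq_norm, Complex.normSq_apply, hre, him]; ring
  have h2 : ‖(2:ℂ)^(1-s)‖ = √2 := by
    have := Complex.norm_cpow_eq_rpow_re_of_pos (x := 2) (by norm_num) (1-s)
    push_cast at this
    rw [this, Real.sqrt_eq_rpow]; congr 1; simp [hre]; norm_num
  have h3 : √2 - 1 ≤ ‖(1:ℂ) - 2^(1-s)‖ := by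
    have := norm_sub_norm_le ((2:ℂ)^(1-s)) 1
    rw [h2, norm_one, norm_sub_rev] at this; exact this
  have h4 : (√2-1) * ‖riemannZeta s‖ ≤ ‖eta s‖ := by
    rw [he, norm_mul]; gcongr
  have h5 : ‖eta s‖ ≤ ‖Dp (2*M) τ‖ + 2 * ‖s‖ / √M := by
    rw [hD]
    have := norm_le_insert' (eta s) (∑ j ∈ Finset.range M, ePair j s)
    linarith
  have hq : (2 * ‖s‖ / √M)^2 = 4 * (1/4+τ^2) / M := by
    rw [div_pow, mul_pow, hsn, Real.sq_sqrt hM0.le]; norm_num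
  set A := ‖Dp (2*M) τ‖
  set B := 2 * ‖s‖ / √M
  have hz : 0 ≤ ‖riemannZeta s‖ := norm_nonneg _
  have hr2 : (1.414:ℝ) ≤ √2 := Real.le_sqrt_of_sq_le (by norm_num)
  have h6 : ‖riemannZeta s‖ * 0.414 ≤ A + B := by nlinarith
  have h7 : (‖riemannZeta s‖ * 0.414)^2 ≤ 2 * A^2 + 2 * B^2 := by
    have : (‖riemannZeta s‖ * 0.414)^2 ≤ (A+B)^2 := by gcongr
    nlinarith [sq_nonneg (A-B)]
  have : 52 * (1/4 + τ^2) / M = 13 * B^2 := by rw [hq]; ring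
  rw [this]
  nlinarith [sq_nonneg A, sq_nonneg B]

end TM

namespace TM

noncomputable def psi (y : ℝ) : ℝ := Real.log (y + 1/2) - Real.log (y - 1/2)

noncomputable def a0 (G y : ℝ) : ℝ := Real.exp (-(G^2/4 * psi y ^ 2)) / √(y^2 - 1/4)

noncomputable def ph (t y : ℝ) : ℂ := Complex.exp (-(Complex.I * (t * psi y : ℝ)))

noncomputable def FF (t G y : ℝ) : ℂ := (a0 G y : ℂ) * ph t y

noncomputable def Off (X : ℕ) (t G : ℝ) : ℂ :=
  ∑ h ∈ Finset.Icc 1 X, (-1:ℂ)^h * ∑ n ∈ Finset.Icc 1 (X-h), (1/(h:ℂ)) * FF t G (n/h + 1/2)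

noncomputable def gm (t G : ℝ) (m n : ℕ) : ℂ :=
  (-1:ℂ)^(m+n) * (1/√(m*n:ℝ) : ℝ) * Complex.exp (-(G^2/4 * (Real.log m - Real.log n)^2 : ℝ)) *
    Complex.exp (-(Complex.I * (t * (Real.log m - Real.log n) : ℝ)))

lemma cpow_term (n : ℕ) (hn : 1 ≤ n) (τ : ℝ) :
    (n:ℂ)^(-(1/2 + Complex.I * τ)) = (1/√(n:ℝ) : ℝ) * Complex.exp (-(Complex.I * (τ * Real.log n : ℝ))) := by
  have hn0 : (0:ℝ) < n := by exact_mod_cast hn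
  have hnc : (n:ℂ) ≠ 0 := by exact_mod_cast hn0.ne'
  have h1 : ((1/√(n:ℝ) : ℝ) : ℂ) = Complex.exp (((-(1/2) * Real.log n : ℝ)):ℂ) := by
    rw [← Complex.ofReal_exp]; congr 1
    rw [Real.sqrt_eq_rpow, Real.rpow_def_of_pos hn0, one_div, ← Real.exp_neg]; congr 1; ring
  rw [h1, ← Complex.exp_add, Complex.cpow_def_of_ne_zero hnc, ← Complex.natCast_log]
  congr 1; push_cast; ring

lemma Dp_sq (X : ℕ) (τ : ℝ) : ((‖Dp X τ‖^2 : ℝ) : ℂ) =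
    ∑ m ∈ Finset.Icc 1 X, ∑ n ∈ Finset.Icc 1 X, (-1:ℂ)^(m+n) * (1/√(m*n:ℝ) : ℝ) *
      Complex.exp (-(Complex.I * (τ * (Real.log m - Real.log n) : ℝ))) := by
  have : ((‖Dp X τ‖^2 : ℝ) : ℂ) = Dp X τ * (starRingEnd ℂ) (Dp X τ) := by
    rw [Complex.mul_conj, Complex.normSq_eq_norm_sq]
  rw [this]
  unfold Dp
  rw [map_sum, Finset.sum_mul_sum]
  refine Finset.sum_congr rfl fun m hm => Finset.sum_congr rfl fun n hn => ?_
  have hm1 := (Finset.mem_Icc.1 hm).1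
  have hn1 := (Finset.mem_Icc.1 hn).1
  rw [cpow_term m hm1, cpow_term n hn1]
  simp only [map_mul, map_pow, map_neg, map_one, Complex.conj_ofReal, ← Complex.exp_conj, Complex.conj_I]
  have h1 : ((1/√(m*n:ℝ) : ℝ):ℂ) = (1/√(m:ℝ) : ℝ) * (1/√(n:ℝ) : ℝ) := by
    rw [← Complex.ofReal_mul]; congr 1
    rw [Real.sqrt_mul (by positivity)]; field_simp
  have h2 : Complex.exp (-(Complex.I * (τ * (Real.log m - Real.log n) : ℝ))) =
     Complex.exp (-(Complex.I * (τ * Real.log m : ℝ))) * Complex.exp (-(-Complex.I * (τ * Real.log n : ℝ))) := by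
    rw [← Complex.exp_add]; congr 1; push_cast; ring
  rw [h1, h2, pow_add]; ring

lemma gauss_ft (G : ℝ) (hG : 0 < G) (θ : ℝ) :
    ∫ u : ℝ, Complex.exp (-(Complex.I * (u * θ : ℝ))) * (Real.exp (-(u/G)^2) : ℂ) =
      (√π * G : ℝ) * Complex.exp (-(G^2/4 * θ^2 : ℝ)) := by
  have h := fourierIntegral_gaussian (b := ((1/G^2:ℝ):ℂ)) (by rw [Complex.ofReal_re]; positivity) (-θ)
  have e1 : ∀ u : ℝ, Complex.exp (-(Complex.I * (u * θ : ℝ))) * (Real.exp (-(u/G)^2) : ℂ) =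
     Complex.exp (Complex.I * (-θ) * u) * Complex.exp (-((1/G^2:ℝ):ℂ) * (u:ℂ)^2) := by
    intro u
    rw [Complex.ofReal_exp]; congr 2
    · push_cast; ring
    · push_cast; ring
  simp_rw [e1]
  rw [h]
  have e2 : (π / ((1/G^2:ℝ):ℂ))^(1/2:ℂ) = ((√π * G : ℝ):ℂ) := by
    rw [← Complex.ofReal_div, show (1/2:ℂ) = ((1/2:ℝ):ℂ) by push_cast; rfl,
      ← Complex.ofReal_cpow (by positivity), ← Real.sqrt_eq_rpow]
    congr 1
    rw [show π / (1/G^2) = π * G^2 by field_simp, Real.sqrt_mul (by positivity), Real.sqrt_sq hG.le]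
  rw [e2]; congr 2
  have : (G:ℂ) ≠ 0 := by exact_mod_cast hG.ne'
  push_cast; field_simp

lemma gauss_int (G : ℝ) (hG : 0 < G) : Integrable (fun u : ℝ => Real.exp (-(u/G)^2)) := by
  have := integrable_exp_neg_mul_sq (b := 1/G^2) (by positivity)
  refine this.congr (Filter.Eventually.of_forall fun u => ?_)
  simp only; congr 1; field_simp

lemma gauss_val (G : ℝ) (hG : 0 < G) : ∫ u : ℝ, Real.exp (-(u/G)^2) = √π * G := by
  have := integral_gaussian (1/G^2)
  have e : ∀ u : ℝ, Real.exp (-(u/G)^2) = Real.exp (-(1/G^2) * u^2) := by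
    intro u; congr 1; field_simp
  simp_rw [e, this]
  rw [show π / (1/G^2) = π * G^2 by field_simp, Real.sqrt_mul (by positivity), Real.sqrt_sq hG.le]

lemma gauss_ft_int (G : ℝ) (hG : 0 < G) (θ : ℝ) :
    Integrable (fun u : ℝ => Complex.exp (-(Complex.I * (u * θ : ℝ))) * (Real.exp (-(u/G)^2) : ℂ)) := by
  refine (gauss_int G hG).ofReal.bdd_mul (c := 1) (by fun_prop) ?_
  refine Filter.Eventually.of_forall fun u => ?_
  rw [← neg_mul, mul_comm, Complex.norm_exp]
  simp

lemma Dp_term_eq (t G : ℝ) (u : ℝ) (m n : ℕ) :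
    (-1:ℂ)^(m+n) * (1/√(m*n:ℝ) : ℝ) *
      Complex.exp (-(Complex.I * ((t+u) * (Real.log m - Real.log n) : ℝ))) * (Real.exp (-(u/G)^2) : ℂ)
    = ((-1:ℂ)^(m+n) * (1/√(m*n:ℝ) : ℝ) * Complex.exp (-(Complex.I * (t * (Real.log m - Real.log n) : ℝ)))) *
      (Complex.exp (-(Complex.I * (u * (Real.log m - Real.log n) : ℝ))) * (Real.exp (-(u/G)^2) : ℂ)) := by
  have : Complex.exp (-(Complex.I * ((t+u) * (Real.log m - Real.log n) : ℝ))) =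
    Complex.exp (-(Complex.I * (t * (Real.log m - Real.log n) : ℝ))) *
    Complex.exp (-(Complex.I * (u * (Real.log m - Real.log n) : ℝ))) := by
    rw [← Complex.exp_add]; congr 1; push_cast; ring
  rw [this]; ring

lemma Dp_int_aux (X : ℕ) (t G : ℝ) (u : ℝ) :
   ((‖Dp X (t+u)‖^2 * Real.exp (-(u/G)^2) : ℝ) : ℂ) = 
    ∑ m ∈ Finset.Icc 1 X, ∑ n ∈ Finset.Icc 1 X, 
    ((-1:ℂ)^(m+n) * (1/√(m*n:ℝ) : ℝ) * Complex.exp (-(Complex.I * (t * (Real.log m - Real.log n) : ℝ)))) *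
      (Complex.exp (-(Complex.I * (u * (Real.log m - Real.log n) : ℝ))) * (Real.exp (-(u/G)^2) : ℂ)) := by
  rw [Complex.ofReal_mul, Dp_sq, Finset.sum_mul]
  refine Finset.sum_congr rfl fun m _ => ?_
  rw [Finset.sum_mul]
  refine Finset.sum_congr rfl fun n _ => ?_
  rw [← Dp_term_eq]

lemma Dp_integrable (X : ℕ) (t G : ℝ) (hG : 0 < G) :
    Integrable (fun u : ℝ => ‖Dp X (t+u)‖^2 * Real.exp (-(u/G)^2)) := by
  have : Integrable (fun u : ℝ => ((‖Dp X (t+u)‖^2 * Real.exp (-(u/G)^2) : ℝ) : ℂ)) := by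
    simp_rw [Dp_int_aux]
    refine integrable_finsetSum _ fun m _ => integrable_finsetSum _ fun n _ => ?_
    exact (gauss_ft_int G hG _).const_mul _
  exact this.re

lemma Dp_integral (X : ℕ) (t G : ℝ) (hG : 0 < G) :
    ((∫ u : ℝ, ‖Dp X (t+u)‖^2 * Real.exp (-(u/G)^2) : ℝ) : ℂ) =
      (√π * G : ℝ) * ∑ m ∈ Finset.Icc 1 X, ∑ n ∈ Finset.Icc 1 X, gm t G m n := by
  rw [← integral_complex_ofReal]
  simp_rw [Dp_int_aux]
  rw [integral_finsetSum]
  swap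
  · intro m _; exact integrable_finsetSum _ fun n _ => (gauss_ft_int G hG _).const_mul _
  rw [Finset.mul_sum]
  refine Finset.sum_congr rfl fun m _ => ?_
  rw [integral_finsetSum]
  swap
  · intro n _; exact (gauss_ft_int G hG _).const_mul _
  rw [Finset.mul_sum]
  refine Finset.sum_congr rfl fun n _ => ?_
  rw [integral_const_mul, gauss_ft G hG]
  unfold gm; ring

lemma gm_conj (t G : ℝ) (m n : ℕ) : gm t G n m = (starRingEnd ℂ) (gm t G m n) := by
  unfold gm
  simp only [map_mul, map_pow, map_neg, map_one, Complex.conj_ofReal, ← Complex.exp_conj, Complex.conj_I]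
  rw [add_comm n m, mul_comm (n:ℝ) m]
  congr 2
  · congr 1; push_cast; ring
  · push_cast; ring

lemma gm_diag (t G : ℝ) (n : ℕ) (hn : 1 ≤ n) : gm t G n n = ((1/n : ℝ):ℂ) := by
  unfold gm
  have : (-1:ℂ)^(n+n) = 1 := by rw [← two_mul, pow_mul]; simp
  rw [this]; simp

lemma double_sum_le (X : ℕ) (f : ℕ → ℕ → ℂ) (hf : ∀ m n, f n m = (starRingEnd ℂ) (f m n)) :
    ‖∑ m ∈ Finset.Icc 1 X, ∑ n ∈ Finset.Icc 1 X, f m n‖ ≤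
     ‖∑ n ∈ Finset.Icc 1 X, f n n‖ + 2 * ‖∑ h ∈ Finset.Icc 1 X, ∑ n ∈ Finset.Icc 1 (X-h), f (n+h) n‖ := by
  have key : ∑ m ∈ Finset.Icc 1 X, ∑ n ∈ Finset.Icc 1 X, f m n = ∑ n ∈ Finset.Icc 1 X, f n n +
      ∑ h ∈ Finset.Icc 1 X, ∑ n ∈ Finset.Icc 1 (X-h), f (n+h) n +
      ∑ h ∈ Finset.Icc 1 X, ∑ n ∈ Finset.Icc 1 (X-h), f n (n+h) := by
    have h0 : ∀ m n : ℕ, f m n = (if n = m then f m n else 0) + (if n < m then f m n else 0) + (if m < n then f m n else 0) := by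
      intro m n
      rcases lt_trichotomy m n with h | h | h
      · simp [h, h.ne', h.not_gt]
      · simp [h]
      · simp [h, h.ne, h.not_gt]
    have h1 : ∑ m ∈ Finset.Icc 1 X, ∑ n ∈ Finset.Icc 1 X, (if n < m then f m n else 0) = ∑ h ∈ Finset.Icc 1 X, ∑ n ∈ Finset.Icc 1 (X-h), f (n+h) n := by
      simp_rw [← Finset.sum_filter]
      rw [Finset.sum_sigma', Finset.sum_sigma']
      refine Finset.sum_bij' (fun x _ => ⟨x.1 - x.2, x.2⟩) (fun x _ => ⟨x.2 + x.1, x.2⟩) ?_ ?_ ?_ ?_ ?_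
      · rintro ⟨m,n⟩ h; simp at h ⊢; omega
      · rintro ⟨m,n⟩ h; simp at h ⊢; omega
      · rintro ⟨m,n⟩ h; simp at h ⊢; omega
      · rintro ⟨m,n⟩ h; simp at h ⊢
      · rintro ⟨m,n⟩ h; simp at h ⊢; congr 1; omega
    have h2 : ∑ m ∈ Finset.Icc 1 X, ∑ n ∈ Finset.Icc 1 X, (if m < n then f m n else 0) = ∑ h ∈ Finset.Icc 1 X, ∑ n ∈ Finset.Icc 1 (X-h), f n (n+h) := by
      rw [Finset.sum_comm]
      simp_rw [← Finset.sum_filter]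
      rw [Finset.sum_sigma', Finset.sum_sigma']
      refine Finset.sum_bij' (fun x _ => ⟨x.1 - x.2, x.2⟩) (fun x _ => ⟨x.2 + x.1, x.2⟩) ?_ ?_ ?_ ?_ ?_
      · rintro ⟨m,n⟩ h; simp at h ⊢; omega
      · rintro ⟨m,n⟩ h; simp at h ⊢; omega
      · rintro ⟨m,n⟩ h; simp at h ⊢; omega
      · rintro ⟨m,n⟩ h; simp at h ⊢
      · rintro ⟨m,n⟩ h; simp at h ⊢; congr 1; omega
    rw [← h1, ← h2]
    rw [← Finset.sum_add_distrib, ← Finset.sum_add_distrib]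
    refine Finset.sum_congr rfl fun m hm => ?_
    rw [Finset.sum_congr rfl fun n _ => h0 m n, Finset.sum_add_distrib, Finset.sum_add_distrib,
      Finset.sum_ite_eq' _ m, if_pos hm]
  have h3 : ∑ h ∈ Finset.Icc 1 X, ∑ n ∈ Finset.Icc 1 (X-h), f n (n+h) =
    (starRingEnd ℂ) (∑ h ∈ Finset.Icc 1 X, ∑ n ∈ Finset.Icc 1 (X-h), f (n+h) n) := by
    simp_rw [map_sum]
    refine Finset.sum_congr rfl fun h _ => Finset.sum_congr rfl fun n _ => ?_
    rw [hf]
  rw [key, h3]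
  refine (norm_add₃_le).trans ?_
  rw [RCLike.norm_conj]; linarith

lemma gm_FF (t G : ℝ) (h n : ℕ) (hh : 1 ≤ h) (hn : 1 ≤ n) :
    gm t G (n+h) n = (-1:ℂ)^h * ((1/(h:ℂ)) * FF t G (n/h + 1/2)) := by
  have hh0 : (0:ℝ) < h := by exact_mod_cast hh
  have hn0 : (0:ℝ) < n := by exact_mod_cast hn
  have hpsi : psi ((n:ℝ)/h + 1/2) = Real.log ((n+h:ℕ):ℝ) - Real.log n := by
    unfold psi
    rw [show (n:ℝ)/h + 1/2 + 1/2 = (n+h)/h by field_simp; ring, show (n:ℝ)/h+1/2-1/2 = n/h by ring,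
      Real.log_div (by positivity) hh0.ne', Real.log_div hn0.ne' hh0.ne']
    push_cast; ring
  have hp : √(((n:ℝ)/h+1/2)^2 - 1/4) = √(((n+h:ℕ):ℝ) * n) / h := by
    rw [show ((n:ℝ)/h+1/2)^2 - 1/4 = (((n+h:ℕ):ℝ) * n) / h^2 by push_cast; field_simp; ring,
      Real.sqrt_div (by positivity), Real.sqrt_sq hh0.le]
  have hsg : (-1:ℂ)^(n+h+n) = (-1)^h := by
    rw [show n+h+n = 2*n+h by ring, pow_add, pow_mul]; simp
  unfold gm FF a0 ph
  rw [hpsi, hp, hsg, ← Complex.ofReal_neg, ← Complex.ofReal_exp]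
  have hs : (√(((n+h:ℕ):ℝ) * n) : ℂ) ≠ 0 := by
    rw [Complex.ofReal_ne_zero]; positivity
  have hhc : (h:ℂ) ≠ 0 := by exact_mod_cast hh0.ne'
  push_cast at hs ⊢
  field_simp

lemma J_le (t G : ℝ) (hG : 0 < G) (M : ℕ) (hM : 1 ≤ M) :
    J 1 t G ≤ 13 * (∑ n ∈ Finset.Icc 1 (2*M), (1/n:ℝ) + 2 * ‖Off (2*M) t G‖) + 52 * (1/4 + 2*t^2 + 8*G^2)/M := by
  have hM0 : (0:ℝ) < M := by exact_mod_cast hM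
  set X := 2*M
  have hc : 0 < √π * G := by positivity
  -- the pointwise majorant
  have hmaj : ∀ u : ℝ, ‖riemannZeta (1/2 + Complex.I * (t:ℂ) + Complex.I * (u:ℂ))‖^(2*1) * Real.exp (-(u/G)^2) ≤
     13 * (‖Dp X (t+u)‖^2 * Real.exp (-(u/G)^2)) + (52 * (1/4+2*t^2)/M) * Real.exp (-(u/G)^2)
      + (104 * 2 * G^2/M) * Real.exp (-(u/(√2*G))^2) := by
    intro u
    have h1 := zeta_bound (t+u) M hM
    have e1 : (1/2:ℂ) + Complex.I * ((t+u:ℝ):ℂ) = 1/2 + Complex.I * (t:ℂ) + Complex.I * (u:ℂ) := by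
      push_cast; ring
    rw [e1] at h1
    have hE := Real.exp_pos (-(u/G)^2)
    have h2 : u^2 * Real.exp (-(u/G)^2) ≤ 2*G^2 * Real.exp (-(u/(√2*G))^2) := by
      have e2 : Real.exp (-(u/(√2*G))^2) = Real.exp ((u/G)^2/2) * Real.exp (-(u/G)^2) := by
        rw [← Real.exp_add]; congr 1
        rw [div_pow u (√2*G), mul_pow, Real.sq_sqrt (by norm_num), div_pow]; field_simp; ring
      rw [e2, ← mul_assoc]
      gcongr
      have := Real.add_one_le_exp ((u/G)^2/2)
      have e3 : u^2 = 2*G^2*((u/G)^2/2) := by field_simp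
      calc u^2 = 2*G^2*((u/G)^2/2) := e3
        _ ≤ _ := by gcongr; linarith
    have h3 : 52 * (1/4 + (t+u)^2)/M ≤ 52*(1/4+2*t^2)/M + 104/M * u^2 := by
      have : 52*(1/4+2*t^2)/M + 104/M * u^2 = 52*(1/4+2*t^2+2*u^2)/M := by ring
      rw [this]; apply div_le_div_of_nonneg_right _ hM0.le; nlinarith [sq_nonneg (t-u)]
    rw [mul_one]
    calc _ ≤ (13 * ‖Dp X (t+u)‖^2 + (52*(1/4+2*t^2)/M + 104/M * u^2)) * Real.exp (-(u/G)^2) := by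
          gcongr; linarith
      _ = 13 * (‖Dp X (t+u)‖^2 * Real.exp (-(u/G)^2)) + (52*(1/4+2*t^2)/M) * Real.exp (-(u/G)^2)
          + 104/M * (u^2 * Real.exp (-(u/G)^2)) := by ring
      _ ≤ 13 * (‖Dp X (t+u)‖^2 * Real.exp (-(u/G)^2)) + (52*(1/4+2*t^2)/M) * Real.exp (-(u/G)^2)
          + 104/M * (2*G^2 * Real.exp (-(u/(√2*G))^2)) := by gcongr
      _ = _ := by ring
  have i1 : Integrable fun u => 13 * (‖Dp X (t+u)‖^2 * Real.exp (-(u/G)^2)) := (Dp_integrable X t G hG).const_mul 13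
  have i2 : Integrable fun u => (52 * (1/4+2*t^2)/M) * Real.exp (-(u/G)^2) := (gauss_int G hG).const_mul _
  have i3 : Integrable fun u => (104 * 2 * G^2/M) * Real.exp (-(u/(√2*G))^2) := (gauss_int (√2*G) (by positivity)).const_mul _
  have hint := integral_mono_of_nonneg (μ := volume) (Filter.Eventually.of_forall (fun u => by positivity)) ((i1.add i2).add i3)
    (Filter.Eventually.of_forall hmaj)
  rw [integral_add' (i1.add i2) i3, integral_add' i1 i2, integral_const_mul, integral_const_mul, integral_const_mul,
      gauss_val G hG, gauss_val (√2*G) (by positivity)] at hint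
  have hD : ∫ u, ‖Dp X (t+u)‖^2 * Real.exp (-(u/G)^2) ≤ (√π * G) * (∑ n ∈ Finset.Icc 1 X, (1/n:ℝ) + 2 * ‖Off X t G‖) := by
    have h := Dp_integral X t G hG
    have h1 : ∫ u, ‖Dp X (t+u)‖^2 * Real.exp (-(u/G)^2) ≤ ‖((∫ u : ℝ, ‖Dp X (t+u)‖^2 * Real.exp (-(u/G)^2) : ℝ) : ℂ)‖ := by
      rw [Complex.norm_real]; exact le_abs_self _
    refine h1.trans ?_
    rw [h, norm_mul, Complex.norm_real, Real.norm_of_nonneg hc.le]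
    gcongr
    refine (double_sum_le X _ (fun m n => gm_conj t G m n)).trans ?_
    gcongr ?_ + 2 * ?_
    · rw [Finset.sum_congr rfl fun n hn => gm_diag t G n (Finset.mem_Icc.1 hn).1, ← Complex.ofReal_sum, Complex.norm_real,
        Real.norm_of_nonneg (Finset.sum_nonneg fun n _ => by positivity)]
    · apply le_of_eq; congr 1
      unfold Off
      refine Finset.sum_congr rfl fun h hh => ?_
      rw [Finset.mul_sum]
      refine Finset.sum_congr rfl fun n hn => ?_
      exact gm_FF t G h n (Finset.mem_Icc.1 hh).1 (Finset.mem_Icc.1 hn).1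
  have hs2 : √2 ≤ 2 := by rw [Real.sqrt_le_left (by norm_num)]; norm_num
  unfold J
  rw [one_div, inv_mul_le_iff₀ hc]
  refine hint.trans ?_
  calc _ ≤ 13 * ((√π * G) * (∑ n ∈ Finset.Icc 1 X, (1/n:ℝ) + 2 * ‖Off X t G‖)) + (52 * (1/4+2*t^2)/M) * (√π * G) + (104 * 2 * G^2/M) * (√π * (2*G)) := by gcongr
    _ = _ := by ring

end TM

namespace TM

structure Sym (m : ℕ) (A : ℝ) (f f1 f2 : ℝ → ℝ) : Prop where
  d1 : ∀ y, 1 ≤ y → HasDerivAt f (f1 y) y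
  d2 : ∀ y, 1 ≤ y → HasDerivAt f1 (f2 y) y
  c2 : ∀ y, 1 ≤ y → ContinuousAt f2 y
  b0 : ∀ y, 1 ≤ y → |f y| ≤ A / y^m
  b1 : ∀ y, 1 ≤ y → |f1 y| ≤ A / y^(m+1)
  b2 : ∀ y, 1 ≤ y → |f2 y| ≤ A / y^(m+2)

lemma Sym.nonneg {m A f f1 f2} (h : Sym m A f f1 f2) : 0 ≤ A := by
  have := h.b0 1 le_rfl
  simp at this; exact (abs_nonneg _).trans this

lemma Sym.mono {m A B f f1 f2} (h : Sym m A f f1 f2) (hAB : A ≤ B) : Sym m B f f1 f2 where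
  d1 := h.d1
  d2 := h.d2
  c2 := h.c2
  b0 := fun y hy => (h.b0 y hy).trans (by gcongr)
  b1 := fun y hy => (h.b1 y hy).trans (by gcongr)
  b2 := fun y hy => (h.b2 y hy).trans (by gcongr)

lemma Sym.mul {m A f f1 f2 n B g g1 g2} (h : Sym m A f f1 f2) (k : Sym n B g g1 g2) :
    Sym (m+n) (4*A*B) (fun y => f y * g y) (fun y => f1 y * g y + f y * g1 y)
      (fun y => f2 y * g y + f1 y * g1 y + (f1 y * g1 y + f y * g2 y)) := by
  have hA := h.nonneg
  have hB := k.nonneg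
  have hm : ∀ (y : ℝ), 1 ≤ y → ∀ (a b u v : ℝ) (i j : ℕ), |u| ≤ A / y^i → |v| ≤ B / y^j →
     |u * v| ≤ A*B/y^(i+j) := by
    intro y hy a b u v i j hu hv
    have hy0 : 0 < y := by linarith
    rw [abs_mul, pow_add, ← div_mul_div_comm]
    gcongr
  constructor
  · intro y hy; exact (h.d1 y hy).mul (k.d1 y hy)
  · intro y hy; exact ((h.d2 y hy).mul (k.d1 y hy)).add ((h.d1 y hy).mul (k.d2 y hy))
  · intro y hy
    have c0 := (h.d1 y hy).continuousAt
    have c1 := (h.d2 y hy).continuousAt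
    have c2 := h.c2 y hy
    have e0 := (k.d1 y hy).continuousAt
    have e1 := (k.d2 y hy).continuousAt
    have e2 := k.c2 y hy
    exact ((c2.mul e0).add (c1.mul e1)).add ((c1.mul e1).add (c0.mul e2))
  · intro y hy
    have := hm y hy 0 0 _ _ _ _ (h.b0 y hy) (k.b0 y hy)
    have hy0 : 0 < y := by linarith
    refine this.trans ?_
    gcongr; nlinarith [mul_nonneg hA hB]
  · intro y hy
    have hy0 : 0 < y := by linarith
    have h1 := hm y hy 0 0 _ _ _ _ (h.b1 y hy) (k.b0 y hy)
    have h2 := hm y hy 0 0 _ _ _ _ (h.b0 y hy) (k.b1 y hy)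
    rw [show m+1+n = m+n+1 by ring] at h1
    rw [show m+(n+1) = m+n+1 by ring] at h2
    have hq : 0 ≤ A*B/y^(m+n+1) := by positivity
    have : 4*A*B/y^(m+n+1) = 4*(A*B/y^(m+n+1)) := by ring
    rw [this]
    refine (abs_add_le _ _).trans ?_
    linarith
  · intro y hy
    have hy0 : 0 < y := by linarith
    have h1 := hm y hy 0 0 _ _ _ _ (h.b2 y hy) (k.b0 y hy)
    have h2 := hm y hy 0 0 _ _ _ _ (h.b1 y hy) (k.b1 y hy)
    have h3 := hm y hy 0 0 _ _ _ _ (h.b0 y hy) (k.b2 y hy)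
    rw [show m+2+n = m+n+2 by ring] at h1
    rw [show m+1+(n+1) = m+n+2 by ring] at h2
    rw [show m+(n+2) = m+n+2 by ring] at h3
    have : 4*A*B/y^(m+n+2) = 4*(A*B/y^(m+n+2)) := by ring
    rw [this]
    refine (abs_add_le _ _).trans ?_
    have := abs_add_le (f2 y * g y) (f1 y * g1 y)
    have := abs_add_le (f1 y * g1 y) (f y * g2 y)
    linarith

lemma Sym.sub {m A f f1 f2 B g g1 g2} (h : Sym m A f f1 f2) (k : Sym m B g g1 g2) :
    Sym m (A+B) (fun y => f y - g y) (fun y => f1 y - g1 y) (fun y => f2 y - g2 y) where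
  d1 := fun y hy => (h.d1 y hy).sub (k.d1 y hy)
  d2 := fun y hy => (h.d2 y hy).sub (k.d2 y hy)
  c2 := fun y hy => (h.c2 y hy).sub (k.c2 y hy)
  b0 := fun y hy => by
    rw [add_div]; exact (abs_sub _ _).trans (add_le_add (h.b0 y hy) (k.b0 y hy))
  b1 := fun y hy => by
    rw [add_div]; exact (abs_sub _ _).trans (add_le_add (h.b1 y hy) (k.b1 y hy))
  b2 := fun y hy => by
    rw [add_div]; exact (abs_sub _ _).trans (add_le_add (h.b2 y hy) (k.b2 y hy))

lemma p_lower {y : ℝ} (hy : 1 ≤ y) : 3/4*y^2 ≤ y^2 - 1/4 := by nlinarith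

lemma p_pos {y : ℝ} (hy : 1 ≤ y) : 0 < y^2 - 1/4 := by nlinarith

lemma psi_deriv {y : ℝ} (hy : 1 ≤ y) : HasDerivAt psi (-1/(y^2-1/4)) y := by
  have h1 : y + 1/2 ≠ 0 := by linarith
  have h2 : y - 1/2 ≠ 0 := by linarith
  have := (((hasDerivAt_id y).add_const (1/2:ℝ)).log h1).sub (((hasDerivAt_id y).sub_const (1/2:ℝ)).log h2)
  have e : 1/(y+1/2) - 1/(y-1/2) = -1/(y^2-1/4) := by
    have := (p_pos hy).ne'
    rw [div_sub_div _ _ h1 h2]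
    congr 1 <;> ring
  simp only [id] at this
  rw [e] at this
  exact this

lemma psi_lower {y : ℝ} (hy : 1 ≤ y) : 1/(y+1/2) ≤ psi y := by
  have h1 : 0 < y + 1/2 := by linarith
  have h2 : 0 < y - 1/2 := by linarith
  unfold psi
  rw [← Real.log_div h1.ne' h2.ne']
  have := Real.one_sub_inv_le_log_of_pos (x := (y+1/2)/(y-1/2)) (by positivity)
  have e : 1 - ((y+1/2)/(y-1/2))⁻¹ = 1/(y+1/2) := by rw [inv_div]; field_simp; ring
  rw [e] at this; exact this

lemma psi_upper {y : ℝ} (hy : 1 ≤ y) : psi y ≤ 1/(y-1/2) := by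
  have h1 : 0 < y + 1/2 := by linarith
  have h2 : 0 < y - 1/2 := by linarith
  unfold psi
  rw [← Real.log_div h1.ne' h2.ne']
  have := Real.log_le_sub_one_of_pos (x := (y+1/2)/(y-1/2)) (by positivity)
  have e : ((y+1/2)/(y-1/2)) - 1 = 1/(y-1/2) := by rw [div_sub_one h2.ne']; ring
  rw [e] at this; exact this

lemma sym_r : Sym 1 16 (fun y => 1/√(y^2-1/4)) (fun y => -y/((y^2-1/4)*√(y^2-1/4)))
   (fun y => -1/((y^2-1/4)*√(y^2-1/4)) + 3*y^2/((y^2-1/4)^2*√(y^2-1/4))) := by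
  have hsq : ∀ y : ℝ, 1 ≤ y → y/2 ≤ √(y^2-1/4) := by
    intro y hy
    apply Real.le_sqrt_of_sq_le; nlinarith
  have hds : ∀ y : ℝ, 1 ≤ y → HasDerivAt (fun y:ℝ => √(y^2-1/4)) (y/√(y^2-1/4)) y := by
    intro y hy
    have := ((hasDerivAt_pow 2 y).sub_const (1/4:ℝ)).sqrt (p_pos hy).ne'
    refine this.congr_deriv ?_
    have := (Real.sqrt_pos.2 (p_pos hy)).ne'
    push_cast
    field_simp
  have hdp : ∀ y : ℝ, HasDerivAt (fun y:ℝ => y^2-1/4) (2*y) y := by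
    intro y
    have := (hasDerivAt_pow 2 y).sub_const (1/4:ℝ)
    exact this.congr_deriv (by norm_num)
  constructor
  · intro y hy
    have hp := p_pos hy
    have hs := Real.sqrt_pos.2 hp
    have := (hds y hy).inv hs.ne'
    have e : (fun y:ℝ => 1/√(y^2-1/4)) = (fun y:ℝ => √(y^2-1/4))⁻¹ := by
      funext y; simp
    rw [e]
    refine this.congr_deriv ?_
    have h2 := Real.sq_sqrt hp.le
    rw [h2]; field_simp
  · intro y hy
    have hp := p_pos hy
    have hs := Real.sqrt_pos.2 hp
    have h2 := Real.sq_sqrt hp.le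
    have := (hasDerivAt_id y).neg.div ((hdp y).mul (hds y hy)) (mul_pos hp hs).ne'
    refine this.congr_deriv ?_
    simp only [Pi.mul_apply, Pi.neg_apply, id]
    set q := √(y^2-1/4) with hq
    rw [← h2]
    field_simp
    ring
  · intro y hy
    have hp := p_pos hy
    have hs := Real.sqrt_pos.2 hp
    have c : ContinuousAt (fun y:ℝ => √(y^2-1/4)) y := (hds y hy).continuousAt
    have c' : ContinuousAt (fun y:ℝ => y^2-1/4) y := (hdp y).continuousAt
    refine ContinuousAt.add ?_ ?_
    · exact continuousAt_const.div (c'.mul c) (by positivity)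
    · exact (continuousAt_const.mul (continuousAt_id.pow 2)).div ((c'.pow 2).mul c) (by positivity)
  · intro y hy
    have hs := hsq y hy
    have hy0 : 0 < y := by linarith
    rw [abs_of_nonneg (by positivity), div_le_div_iff₀ (by linarith) (by positivity)]
    nlinarith
  · intro y hy
    have hp := p_pos hy
    have hs := hsq y hy
    have hy0 : 0 < y := by linarith
    have hpl := p_lower hy
    have h1 : 3/4*y^2*(y/2) ≤ (y^2-1/4)*√(y^2-1/4) := by gcongr
    rw [neg_div, abs_neg, abs_of_nonneg (by positivity)]
    calc y/((y^2-1/4)*√(y^2-1/4)) ≤ y/(3/4*y^2*(y/2)) := by gcongr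
      _ = (8/3)/y^(1+1) := by field_simp; ring
      _ ≤ _ := by gcongr; norm_num
  · intro y hy
    have hp := p_pos hy
    have hs := hsq y hy
    have hy0 : 0 < y := by linarith
    have hpl := p_lower hy
    have h1 : 3/4*y^2*(y/2) ≤ (y^2-1/4)*√(y^2-1/4) := by gcongr
    have h2 : (3/4*y^2)^2*(y/2) ≤ (y^2-1/4)^2*√(y^2-1/4) := by gcongr
    refine (abs_add_le _ _).trans ?_
    rw [neg_div, abs_neg, abs_of_nonneg (by positivity), abs_of_nonneg (by positivity)]
    calc _ ≤ 1/(3/4*y^2*(y/2)) + 3*y^2/((3/4*y^2)^2*(y/2)) := by gcongr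
      _ = (40/3)/y^(1+2) := by field_simp; ring
      _ ≤ _ := by gcongr; norm_num

lemma z_exp {z : ℝ} (_hz : 0 ≤ z) : z * Real.exp (-z) ≤ 1 := by
  have := Real.add_one_le_exp z
  rw [Real.exp_neg, ← div_eq_mul_inv, div_le_one (Real.exp_pos z)]; linarith

lemma z2_exp {z : ℝ} (hz : 0 ≤ z) : z^2 * Real.exp (-z) ≤ 2 := by
  have := Real.quadratic_le_exp_of_nonneg hz
  rw [Real.exp_neg, ← div_eq_mul_inv, div_le_iff₀ (Real.exp_pos z)]; nlinarith

lemma sym_E (G : ℝ) : Sym 0 128 (fun y => Real.exp (-(G^2/4 * psi y ^ 2)))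
   (fun y => 2*(G^2/4)*psi y/(y^2-1/4) * Real.exp (-(G^2/4 * psi y ^ 2)))
   (fun y => (-2*(G^2/4)*(1 + 2*y*psi y)/(y^2-1/4)^2 + 4*(G^2/4)^2*psi y^2/(y^2-1/4)^2) * Real.exp (-(G^2/4 * psi y ^ 2))) := by
  set g := G^2/4 with hg
  have hg0 : 0 ≤ g := by positivity
  have hdp : ∀ y : ℝ, HasDerivAt (fun y:ℝ => y^2-1/4) (2*y) y := by
    intro y
    have := (hasDerivAt_pow 2 y).sub_const (1/4:ℝ)
    exact this.congr_deriv (by norm_num)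
  have hE : ∀ y : ℝ, 1 ≤ y → HasDerivAt (fun y => Real.exp (-(g * psi y ^ 2))) (2*g*psi y/(y^2-1/4) * Real.exp (-(g * psi y ^ 2))) y := by
    intro y hy
    have := ((((psi_deriv hy).pow 2).const_mul g).neg).exp
    refine this.congr_deriv ?_
    simp only [Pi.neg_apply, Pi.pow_apply]
    have := (p_pos hy).ne'
    push_cast
    field_simp
  have hpsi0 : ∀ y : ℝ, 1 ≤ y → 0 < psi y := fun y hy => lt_of_lt_of_le (by positivity) (psi_lower hy)
  have hpp : ∀ y : ℝ, 1 ≤ y → y/2 ≤ psi y * (y^2-1/4) := by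
    intro y hy
    have := psi_lower hy
    have hp := p_pos hy
    calc y/2 ≤ y - 1/2 := by linarith
      _ = 1/(y+1/2) * (y^2-1/4) := by field_simp; ring
      _ ≤ _ := by gcongr
  have hE1 : ∀ y : ℝ, 1 ≤ y → g*psi y/(y^2-1/4) ≤ (g * psi y^2)*(2/y) := by
    intro y hy
    have h1 := hpsi0 y hy
    have h2 := hpp y hy
    have hp := p_pos hy
    have hy0 : 0 < y := by linarith
    have e : g*psi y/(y^2-1/4) = g * psi y^2 * (1/(psi y * (y^2-1/4))) := by field_simp
    rw [e]
    have : 1/(psi y * (y^2-1/4)) ≤ 2/y := by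
      rw [div_le_div_iff₀ (by positivity) hy0]; linarith
    gcongr
  have hE2 : ∀ y : ℝ, 1 ≤ y → g/(y^2-1/4)^2 ≤ (g * psi y^2)*(4/y^2) := by
    intro y hy
    have h1 := hpsi0 y hy
    have h2 := hpp y hy
    have hp := p_pos hy
    have hy0 : 0 < y := by linarith
    have e : g/(y^2-1/4)^2 = g * psi y^2 * (1/(psi y * (y^2-1/4))^2) := by field_simp
    rw [e]
    have : 1/(psi y * (y^2-1/4)) ≤ 2/y := by
      rw [div_le_div_iff₀ (by positivity) hy0]; linarith
    have : 1/(psi y * (y^2-1/4))^2 ≤ 4/y^2 := by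
      calc 1/(psi y * (y^2-1/4))^2 = (1/(psi y * (y^2-1/4)))^2 := by rw [div_pow, one_pow]
        _ ≤ (2/y)^2 := by gcongr
        _ = _ := by rw [div_pow]; norm_num
    gcongr
  have hypsi : ∀ y : ℝ, 1 ≤ y → y * psi y ≤ 2 := by
    intro y hy
    have := psi_upper hy
    have hy0 : 0 < y := by linarith
    calc y * psi y ≤ y * (1/(y-1/2)) := by gcongr
      _ ≤ 2 := by rw [mul_one_div, div_le_iff₀ (by linarith)]; linarith
  constructor
  · exact hE
  · intro y hy
    have hp := (p_pos hy).ne'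
    have := ((((psi_deriv hy).const_mul (2*g)).div (hdp y) hp)).mul (hE y hy)
    refine this.congr_deriv ?_
    simp only [Pi.div_apply]
    generalize y^2-1/4 = P at hp
    field_simp
    ring
  · intro y hy
    have hp := (p_pos hy).ne'
    have cE := (hE y hy).continuousAt
    have cp := (hdp y).continuousAt
    have cψ := (psi_deriv hy).continuousAt
    refine ContinuousAt.mul (ContinuousAt.add ?_ ?_) cE
    · exact (continuousAt_const.mul (continuousAt_const.add ((continuousAt_const.mul continuousAt_id).mul cψ))).div (cp.pow 2) (by positivity)
    · exact (continuousAt_const.mul (cψ.pow 2)).div (cp.pow 2) (by positivity)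
  · intro y hy
    rw [abs_of_nonneg (Real.exp_pos _).le, pow_zero, div_one]
    have : Real.exp (-(g * psi y^2)) ≤ 1 := Real.exp_le_one_iff.2 (by have := sq_nonneg (psi y); nlinarith)
    linarith
  · intro y hy
    have h1 := hpsi0 y hy
    have hp := p_pos hy
    have hy0 : 0 < y := by linarith
    rw [abs_of_nonneg (by positivity)]
    have hz : 0 ≤ g * psi y^2 := by positivity
    calc _ = 2 * (g*psi y/(y^2-1/4)) * Real.exp (-(g * psi y ^ 2)) := by ring
      _ ≤ 2 * ((g * psi y^2)*(2/y)) * Real.exp (-(g * psi y ^ 2)) := by gcongr; exact hE1 y hy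
      _ = 4/y * ((g * psi y^2) * Real.exp (-(g * psi y ^ 2))) := by ring
      _ ≤ 4/y * 1 := by gcongr; exact z_exp hz
      _ ≤ _ := by rw [mul_one, zero_add, pow_one]; gcongr; norm_num
  · intro y hy
    have h1 := hpsi0 y hy
    have hp := p_pos hy
    have hy0 : 0 < y := by linarith
    have hz : 0 ≤ g * psi y^2 := by positivity
    set z := g * psi y^2 with hzdef
    have e2 := hE2 y hy
    have hE0 := Real.exp_pos (-z)
    rw [abs_mul, abs_of_nonneg hE0.le]
    have A1 : |-2*g*(1 + 2*y*psi y)/(y^2-1/4)^2| ≤ 40 * z / y^2 := by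
      have : -2*g*(1 + 2*y*psi y)/(y^2-1/4)^2 = -(2*(1+2*(y*psi y)) * (g/(y^2-1/4)^2)) := by ring
      rw [this, abs_neg, abs_of_nonneg (by positivity)]
      have := hypsi y hy
      calc _ ≤ 2*(1+2*2) * (z*(4/y^2)) := by gcongr
        _ = _ := by ring
    have A2 : |4*g^2*psi y^2/(y^2-1/4)^2| ≤ 16 * z^2/y^2 := by
      rw [abs_of_nonneg (by positivity)]
      calc _ = 4 * z * (g/(y^2-1/4)^2) := by rw [hzdef]; ring
        _ ≤ 4 * z * (z*(4/y^2)) := by gcongr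
        _ = _ := by ring
    calc _ ≤ (40 * z / y^2 + 16 * z^2/y^2) * Real.exp (-z) := by
          gcongr; exact (abs_add_le _ _).trans (add_le_add A1 A2)
      _ = 40/y^2 * (z * Real.exp (-z)) + 16/y^2*(z^2*Real.exp (-z)) := by ring
      _ ≤ 40/y^2 * 1 + 16/y^2*2 := by gcongr; exact z_exp hz; exact z2_exp hz
      _ = 72/y^2 := by ring
      _ ≤ _ := by rw [zero_add]; gcongr; norm_num

/-- smooth step: `0` for `x ≤ 1`, `1` for `x ≥ 2` -/
noncomputable def ss (x : ℝ) : ℝ := Real.smoothTransition (x - 1)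

lemma ss_zero {x : ℝ} (hx : x ≤ 1) : ss x = 0 := Real.smoothTransition.zero_of_nonpos (by linarith)
lemma ss_one {x : ℝ} (hx : 2 ≤ x) : ss x = 1 := Real.smoothTransition.one_of_one_le (by linarith)
lemma ss_nonneg (x : ℝ) : 0 ≤ ss x := Real.smoothTransition.nonneg _
lemma ss_le (x : ℝ) : ss x ≤ 1 := Real.smoothTransition.le_one _

lemma ss_smooth : ContDiff ℝ 2 ss := by
  unfold ss
  exact Real.smoothTransition.contDiff.comp (contDiff_id.sub contDiff_const)

lemma sym_ss : ∃ K : ℝ, ∀ Y : ℝ, 0 < Y → ∃ f1 f2, Sym 0 K (fun y => ss (y/Y)) f1 f2 := by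
  have h2 : ContDiff ℝ (1+1) ss := by have := ss_smooth; norm_num; exact this
  rw [contDiff_succ_iff_deriv] at h2
  have hd1 : ContDiff ℝ 1 (deriv ss) := h2.2.2
  have h3 : ContDiff ℝ (0+1) (deriv ss) := by simpa using hd1
  rw [contDiff_succ_iff_deriv] at h3
  have hc2 : Continuous (deriv (deriv ss)) := h3.2.2.continuous
  have hD : ∀ x, HasDerivAt ss (deriv ss x) x := fun x => (h2.1 x).hasDerivAt
  have hD2 : ∀ x, HasDerivAt (deriv ss) (deriv (deriv ss) x) x := fun x => (h3.1 x).hasDerivAt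
  have out1 : ∀ x, x ∉ Set.Icc (1:ℝ) 2 → deriv ss x = 0 ∧ deriv (deriv ss) x = 0 := by
    intro x hx
    have : ∃ c : ℝ, ss =ᶠ[nhds x] fun _ => c := by
      rw [Set.mem_Icc, not_and_or, not_le, not_le] at hx
      rcases hx with hx | hx
      · exact ⟨0, by filter_upwards [Iio_mem_nhds hx] with z hz; exact ss_zero (le_of_lt hz)⟩
      · exact ⟨1, by filter_upwards [Ioi_mem_nhds hx] with z hz; exact ss_one (le_of_lt hz)⟩
    obtain ⟨c, hc⟩ := this
    have h1 : deriv ss =ᶠ[nhds x] fun _ => 0 := by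
      have := hc.deriv
      simpa using this
    exact ⟨h1.eq_of_nhds, by rw [h1.deriv_eq]; simp⟩
  obtain ⟨K1, hK1⟩ := (isCompact_Icc (a := (1:ℝ)) (b := 2)).exists_bound_of_continuousOn (h3.1.continuous.continuousOn)
  obtain ⟨K2, hK2⟩ := (isCompact_Icc (a := (1:ℝ)) (b := 2)).exists_bound_of_continuousOn (hc2.continuousOn)
  have hK10 : 0 ≤ K1 := (norm_nonneg _).trans (hK1 1 (by simp))
  have hK20 : 0 ≤ K2 := (norm_nonneg _).trans (hK2 1 (by simp))
  refine ⟨1 + 2*K1 + 4*K2, fun Y hY => ⟨fun y => deriv ss (y/Y) / Y, fun y => deriv (deriv ss) (y/Y)/Y/Y, ?_⟩⟩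
  have hdiv : ∀ y : ℝ, HasDerivAt (fun y:ℝ => y/Y) (1/Y) y := fun y => (hasDerivAt_id y).div_const Y
  constructor
  · intro y hy
    have := (hD (y/Y)).comp y (hdiv y)
    rw [mul_one_div] at this; exact this
  · intro y hy
    have := ((hD2 (y/Y)).comp y (hdiv y)).div_const Y
    rw [mul_one_div] at this; exact this
  · intro y hy
    have : Continuous fun y => deriv (deriv ss) (y/Y)/Y/Y :=
      ((hc2.comp (continuous_id.div_const Y)).div_const Y).div_const Y
    exact this.continuousAt
  · intro y hy
    rw [abs_of_nonneg (ss_nonneg _), pow_zero, div_one]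
    have := ss_le (y/Y); linarith
  · intro y hy
    have hy0 : 0 < y := by linarith
    by_cases hx : y/Y ∈ Set.Icc (1:ℝ) 2
    · have h1 := hK1 _ hx
      rw [Real.norm_eq_abs] at h1
      have : y ≤ 2*Y := by have := hx.2; rwa [div_le_iff₀ hY] at this
      rw [abs_div, abs_of_pos hY, zero_add, pow_one, div_le_div_iff₀ hY hy0]
      calc _ ≤ K1 * (2*Y) := by gcongr
        _ = (2*K1) * Y := by ring
        _ ≤ _ := by gcongr; linarith
    · rw [(out1 _ hx).1]; simp; positivity
  · intro y hy
    have hy0 : 0 < y := by linarith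
    by_cases hx : y/Y ∈ Set.Icc (1:ℝ) 2
    · have h1 := hK2 _ hx
      rw [Real.norm_eq_abs] at h1
      have : y ≤ 2*Y := by have := hx.2; rwa [div_le_iff₀ hY] at this
      rw [abs_div, abs_div, abs_of_pos hY, zero_add, div_div, div_le_div_iff₀ (by positivity) (by positivity)]
      calc _ ≤ K2 * (2*Y)^2 := by gcongr
        _ = (4*K2) * (Y*Y) := by ring
        _ ≤ _ := by gcongr; linarith
    · rw [(out1 _ hx).2]; simp; positivity

lemma sym_aY : ∃ A : ℝ, 1 ≤ A ∧ ∀ G Y : ℝ, 0 < Y → ∃ f1 f2, Sym 1 A (fun y => ss (y/Y) * a0 G y) f1 f2 := by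
  obtain ⟨K, hK⟩ := sym_ss
  refine ⟨max 1 (4 * K * (4 * 128 * 16)), le_max_left _ _, fun G Y hY => ?_⟩
  obtain ⟨f1, f2, hf⟩ := hK Y hY
  have := hf.mul ((sym_E G).mul sym_r)
  have e : (fun y => ss (y/Y) * (Real.exp (-(G^2/4 * psi y ^ 2)) * (1/√(y^2-1/4)))) = fun y => ss (y/Y) * a0 G y := by
    funext y; unfold a0; ring
  rw [e] at this
  exact ⟨_, _, this.mono (le_max_right _ _)⟩

end TM

namespace TM

structure GSym (A Y : ℝ) (f f1 f2 : ℝ → ℝ) : Prop where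
  d1 : ∀ y, HasDerivAt f (f1 y) y
  d2 : ∀ y, HasDerivAt f1 (f2 y) y
  c2 : Continuous f2
  z0 : ∀ y, y ≤ Y → f y = 0
  z1 : ∀ y, y ≤ Y → f1 y = 0
  z2 : ∀ y, y ≤ Y → f2 y = 0
  b0 : ∀ y, 1 ≤ y → |f y| ≤ A / y
  b1 : ∀ y, 1 ≤ y → |f1 y| ≤ A / y^2
  b2 : ∀ y, 1 ≤ y → |f2 y| ≤ A / y^3

lemma zero_to_left {g : ℝ → ℝ} {Y : ℝ} (hc : ContinuousAt g Y) (h : ∀ y, y < Y → g y = 0) : g Y = 0 := by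
  have h1 : Filter.Tendsto g (nhdsWithin Y (Set.Iio Y)) (nhds (g Y)) := hc.mono_left nhdsWithin_le_nhds
  have h2 : Filter.Tendsto g (nhdsWithin Y (Set.Iio Y)) (nhds 0) := by
    refine tendsto_const_nhds.congr' ?_
    filter_upwards [self_mem_nhdsWithin] with y hy
    exact (h y hy).symm
  exact tendsto_nhds_unique h1 h2

lemma Sym.global {A Y f f1 f2} (hY : 1 < Y) (h : Sym 1 A f f1 f2) (hz : ∀ y, y ≤ Y → f y = 0) :
    ∃ g1 g2, GSym A Y f g1 g2 := by
  have h1 : ∀ y, 1 ≤ y → y < Y → f1 y = 0 := by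
    intro y hy hyY
    have e : f =ᶠ[nhds y] fun _ => 0 := by
      filter_upwards [Iio_mem_nhds hyY] with z hz'; exact hz z (le_of_lt hz')
    have := (hasDerivAt_const y (0:ℝ)).congr_of_eventuallyEq e
    exact (h.d1 y hy).unique this
  set g1 : ℝ → ℝ := fun y => if y < Y then 0 else f1 y with hg1
  set g2 : ℝ → ℝ := fun y => if y < Y then 0 else f2 y with hg2
  have eq1 : ∀ y, 1 ≤ y → g1 y = f1 y := by
    intro y hy; simp only [hg1]; split_ifs with hh
    · exact (h1 y hy hh).symm
    · rfl
  have ev1 : ∀ y, Y ≤ y → g1 =ᶠ[nhds y] f1 := by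
    intro y hy
    filter_upwards [Ioi_mem_nhds (show (1:ℝ) < y by linarith)] with z hz'
    exact eq1 z (le_of_lt hz')
  have h2 : ∀ y, 1 < y → y < Y → f2 y = 0 := by
    intro y hy hyY
    have e : f1 =ᶠ[nhds y] fun _ => 0 := by
      filter_upwards [Ioo_mem_nhds hy hyY] with z hz'; exact h1 z (le_of_lt hz'.1) hz'.2
    have := (hasDerivAt_const y (0:ℝ)).congr_of_eventuallyEq e
    exact (h.d2 y hy.le).unique this
  have eq2 : ∀ y, 1 < y → g2 y = f2 y := by
    intro y hy; simp only [hg2]; split_ifs with hh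
    · exact (h2 y hy hh).symm
    · rfl
  have ev2 : ∀ y, Y ≤ y → g2 =ᶠ[nhds y] f2 := by
    intro y hy
    filter_upwards [Ioi_mem_nhds (show (1:ℝ) < y by linarith)] with z hz'
    exact eq2 z hz'
  have hc2 : Continuous g2 := by
    rw [continuous_iff_continuousAt]; intro y
    rcases lt_or_ge y Y with hy | hy
    · have : g2 =ᶠ[nhds y] fun _ => 0 := by
        filter_upwards [Iio_mem_nhds hy] with z hz'; simp only [hg2, if_pos (show z < Y from hz')]
      exact continuousAt_const.congr this.symm
    · exact (h.c2 y (by linarith)).congr (ev2 y hy).symm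
  have D1 : ∀ y, HasDerivAt f (g1 y) y := by
    intro y
    rcases lt_or_ge y Y with hy | hy
    · have e : f =ᶠ[nhds y] fun _ => 0 := by
        filter_upwards [Iio_mem_nhds hy] with z hz'; exact hz z (le_of_lt hz')
      have := (hasDerivAt_const y (0:ℝ)).congr_of_eventuallyEq e
      simpa [hg1, hy] using this
    · rw [eq1 y (by linarith)]; exact h.d1 y (by linarith)
  have D2 : ∀ y, HasDerivAt g1 (g2 y) y := by
    intro y
    rcases lt_or_ge y Y with hy | hy
    · have e : g1 =ᶠ[nhds y] fun _ => 0 := by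
        filter_upwards [Iio_mem_nhds hy] with z hz'; simp only [hg1, if_pos (show z < Y from hz')]
      have := (hasDerivAt_const y (0:ℝ)).congr_of_eventuallyEq e
      simpa [hg2, hy] using this
    · rw [eq2 y (by linarith)]; exact (h.d2 y (by linarith)).congr_of_eventuallyEq (ev1 y hy)
  refine ⟨g1, g2, D1, D2, hc2, hz, ?_, ?_, ?_, ?_, ?_⟩
  · intro y hy
    rcases lt_or_eq_of_le hy with hy | hy
    · simp [hg1, hy]
    · rw [hy]; exact zero_to_left (D2 Y).continuousAt (fun z hz' => by simp [hg1, hz'])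
  · intro y hy
    rcases lt_or_eq_of_le hy with hy | hy
    · simp [hg2, hy]
    · rw [hy]; exact zero_to_left hc2.continuousAt (fun z hz' => by simp [hg2, hz'])
  · intro y hy; simpa using h.b0 y hy
  · intro y hy; rw [eq1 y hy]; exact h.b1 y hy
  · intro y hy
    have hA := h.nonneg
    have hy0 : 0 < y := by linarith
    rcases lt_or_ge y Y with hyY | hyY
    · simp only [hg2, if_pos hyY, abs_zero]; positivity
    · rw [eq2 y (by linarith)]; exact h.b2 y hy

lemma GSym.nonneg {A Y f f1 f2} (h : GSym A Y f f1 f2) : 0 ≤ A := by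
  have := h.b0 1 le_rfl
  simp at this; exact (abs_nonneg _).trans this

lemma gsym_aY : ∃ A : ℝ, 1 ≤ A ∧ ∀ G Y : ℝ, 1 < Y → ∃ f1 f2, GSym A Y (fun y => ss (y/Y) * a0 G y) f1 f2 := by
  obtain ⟨A, hA, h⟩ := sym_aY
  refine ⟨A, hA, fun G Y hY => ?_⟩
  obtain ⟨f1, f2, hf⟩ := h G Y (by linarith)
  exact hf.global hY (fun y hy => by rw [ss_zero (by rw [div_le_one (by linarith)]; exact hy), zero_mul])

lemma GSym.sub {A Y f f1 f2 B Z g g1 g2} (h : GSym A Y f f1 f2) (k : GSym B Z g g1 g2) (hYZ : Y ≤ Z) :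
    GSym (A+B) Y (fun y => f y - g y) (fun y => f1 y - g1 y) (fun y => f2 y - g2 y) where
  d1 := fun y => (h.d1 y).sub (k.d1 y)
  d2 := fun y => (h.d2 y).sub (k.d2 y)
  c2 := h.c2.sub k.c2
  z0 := fun y hy => by simp [h.z0 y hy, k.z0 y (hy.trans hYZ)]
  z1 := fun y hy => by simp [h.z1 y hy, k.z1 y (hy.trans hYZ)]
  z2 := fun y hy => by simp [h.z2 y hy, k.z2 y (hy.trans hYZ)]
  b0 := fun y hy => by
    rw [add_div]; exact (abs_sub _ _).trans (add_le_add (h.b0 y hy) (k.b0 y hy))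
  b1 := fun y hy => by
    rw [add_div]; exact (abs_sub _ _).trans (add_le_add (h.b1 y hy) (k.b1 y hy))
  b2 := fun y hy => by
    rw [add_div]; exact (abs_sub _ _).trans (add_le_add (h.b2 y hy) (k.b2 y hy))

lemma ph_norm (t y : ℝ) : ‖ph t y‖ = 1 := by
  unfold ph
  rw [← neg_mul, mul_comm, Complex.norm_exp]; simp

lemma ph_deriv (t : ℝ) {y : ℝ} (hy : 1 ≤ y) :
    HasDerivAt (ph t) (Complex.I * (t/(y^2-1/4) : ℝ) * ph t y) y := by
  have h1 := (((psi_deriv hy).const_mul t).ofReal_comp.const_mul Complex.I).neg.cexp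
  refine HasDerivAt.congr_deriv (f := ph t) h1 ?_
  unfold ph
  simp only [Pi.neg_apply]
  push_cast; ring

lemma ip_deriv (t : ℝ) {y : ℝ} (hy : 1 ≤ y) :
    HasDerivAt (fun y : ℝ => t/(y^2-1/4)) (-(t*(2*y))/(y^2-1/4)^2) y := by
  have hp : HasDerivAt (fun y:ℝ => y^2-1/4) (2*y) y :=
    ((hasDerivAt_pow 2 y).sub_const (1/4:ℝ)).congr_deriv (by norm_num)
  have := (hasDerivAt_const y t).div hp (p_pos hy).ne'
  refine this.congr_deriv ?_
  ring

/-- derivative data for `f * ph t` -/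
noncomputable def G1 (t : ℝ) (f f1 : ℝ → ℝ) (y : ℝ) : ℂ :=
  ((f1 y : ℂ) + Complex.I * (f y * (t/(y^2-1/4)) : ℝ)) * ph t y

noncomputable def G2 (t : ℝ) (f f1 f2 : ℝ → ℝ) (y : ℝ) : ℂ :=
  ((f2 y : ℂ) + Complex.I * (f1 y * (t/(y^2-1/4)) + f y * (-(t*(2*y))/(y^2-1/4)^2) : ℝ)) * ph t y
   + ((f1 y : ℂ) + Complex.I * (f y * (t/(y^2-1/4)) : ℝ)) * (Complex.I * (t/(y^2-1/4) : ℝ) * ph t y)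

lemma GSym.F_d1 {A Y f f1 f2} (hY : 1 < Y) (h : GSym A Y f f1 f2) (t y : ℝ) :
    HasDerivAt (fun y => (f y : ℂ) * ph t y) (G1 t f f1 y) y := by
  rcases lt_or_ge y Y with hy | hy
  · have e : (fun y => (f y : ℂ) * ph t y) =ᶠ[nhds y] fun _ => 0 := by
      filter_upwards [Iio_mem_nhds hy] with z hz'; simp [h.z0 z (le_of_lt hz')]
    have := (hasDerivAt_const y (0:ℂ)).congr_of_eventuallyEq e
    simpa [G1, h.z0 y hy.le, h.z1 y hy.le] using this
  · have := (h.d1 y).ofReal_comp.mul (ph_deriv t (y := y) (by linarith))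
    refine this.congr_deriv ?_
    unfold G1; push_cast; ring

lemma GSym.F_d2 {A Y f f1 f2} (hY : 1 < Y) (h : GSym A Y f f1 f2) (t y : ℝ) :
    HasDerivAt (G1 t f f1) (G2 t f f1 f2 y) y := by
  rcases lt_or_ge y Y with hy | hy
  · have e : (G1 t f f1) =ᶠ[nhds y] fun _ => 0 := by
      filter_upwards [Iio_mem_nhds hy] with z hz'; simp [G1, h.z0 z (le_of_lt hz'), h.z1 z (le_of_lt hz')]
    have := (hasDerivAt_const y (0:ℂ)).congr_of_eventuallyEq e
    simpa [G2, h.z0 y hy.le, h.z1 y hy.le, h.z2 y hy.le] using this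
  · have hy1 : 1 ≤ y := by linarith
    have := ((h.d2 y).ofReal_comp.add ((((h.d1 y).mul (ip_deriv t hy1)).ofReal_comp).const_mul Complex.I)).mul (ph_deriv t hy1)
    exact this

lemma GSym.F_c2 {A Y f f1 f2} (hY : 1 < Y) (h : GSym A Y f f1 f2) (t : ℝ) :
    Continuous (G2 t f f1 f2) := by
  rw [continuous_iff_continuousAt]; intro y
  rcases lt_or_ge y Y with hy | hy
  · have e : (G2 t f f1 f2) =ᶠ[nhds y] fun _ => 0 := by
      filter_upwards [Iio_mem_nhds hy] with z hz'
      simp [G2, h.z0 z (le_of_lt hz'), h.z1 z (le_of_lt hz'), h.z2 z (le_of_lt hz')]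
    exact continuousAt_const.congr e.symm
  · have hy1 : 1 ≤ y := by linarith
    have c0 := (h.d1 y).continuousAt
    have c1 := (h.d2 y).continuousAt
    have c2 := h.c2.continuousAt (x := y)
    have cph := (ph_deriv t hy1).continuousAt
    have cip := (ip_deriv t hy1).continuousAt
    have cp : ContinuousAt (fun y:ℝ => (y^2-1/4)^2) y := by fun_prop
    have cip2 : ContinuousAt (fun y:ℝ => -(t*(2*y))/(y^2-1/4)^2) y :=
      ContinuousAt.div (by fun_prop) cp (pow_ne_zero 2 (p_pos hy1).ne')
    have ofr : ∀ {g : ℝ → ℝ}, ContinuousAt g y → ContinuousAt (fun y => (g y : ℂ)) y :=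
      fun hg => Complex.continuous_ofReal.continuousAt.comp hg
    exact (((ofr c2).add (continuousAt_const.mul (ofr ((c1.mul cip).add (c0.mul cip2))))).mul cph).add
      (((ofr c1).add (continuousAt_const.mul (ofr (c0.mul cip)))).mul ((continuousAt_const.mul (ofr cip)).mul cph))

lemma ip_bound {y t : ℝ} (hy : 1 ≤ y) (ht : 0 ≤ t) : |t/(y^2-1/4)| ≤ 4/3*(t/y^2) := by
  have hp := p_pos hy
  have hy0 : 0 < y := by linarith
  rw [abs_of_nonneg (by positivity)]
  calc t/(y^2-1/4) ≤ t/(3/4*y^2) := by gcongr; exact p_lower hy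
    _ = _ := by field_simp

lemma ip2_bound {y t : ℝ} (hy : 1 ≤ y) (ht : 0 ≤ t) : |-(t*(2*y))/(y^2-1/4)^2| ≤ 32/9*(t/y^3) := by
  have hp := p_pos hy
  have hy0 : 0 < y := by linarith
  rw [neg_div, abs_neg, abs_of_nonneg (by positivity)]
  calc t*(2*y)/(y^2-1/4)^2 ≤ t*(2*y)/(3/4*y^2)^2 := by gcongr; exact p_lower hy
    _ = _ := by field_simp; ring

lemma GSym.F_b2 {A Y f f1 f2} (h : GSym A Y f f1 f2) {t y : ℝ} (ht : 0 ≤ t) (hy : 1 ≤ y) :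
    ‖G2 t f f1 f2 y‖ ≤ 5 * A * (1/y^3 + t^2/y^5) := by
  have hA := h.nonneg
  have hy0 : 0 < y := by linarith
  have e0 := h.b0 y hy
  have e1 := h.b1 y hy
  have e2 := h.b2 y hy
  have i1 := ip_bound hy ht
  have i2 := ip2_bound hy ht
  unfold G2
  set P := t/(y^2-1/4)
  set Q := -(t*(2*y))/(y^2-1/4)^2
  have n1 : ‖(f2 y : ℂ) + Complex.I * (f1 y * P + f y * Q : ℝ)‖ ≤ |f2 y| + (|f1 y| * |P| + |f y| * |Q|) := by
    refine (norm_add_le _ _).trans ?_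
    rw [norm_mul, Complex.norm_I, one_mul, Complex.norm_real, Complex.norm_real, Real.norm_eq_abs, Real.norm_eq_abs]
    gcongr
    refine (abs_add_le _ _).trans ?_
    rw [abs_mul, abs_mul]
  have n2 : ‖(f1 y : ℂ) + Complex.I * (f y * P : ℝ)‖ ≤ |f1 y| + |f y| * |P| := by
    refine (norm_add_le _ _).trans ?_
    rw [norm_mul, Complex.norm_I, one_mul, Complex.norm_real, Complex.norm_real, Real.norm_eq_abs, Real.norm_eq_abs, abs_mul]
  refine (norm_add_le _ _).trans ?_
  rw [norm_mul, norm_mul _ (Complex.I * _ * _), norm_mul _ (ph t y), norm_mul Complex.I, Complex.norm_I, one_mul, ph_norm, mul_one, mul_one,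
    Complex.norm_real, Real.norm_eq_abs]
  have hamgm : t/y^4 ≤ (1/y^3 + t^2/y^5)/2 := by
    have : (1/y^3 + t^2/y^5)/2 - t/y^4 = (y-t)^2/(2*y^5) := by field_simp; ring
    have h2 : 0 ≤ (y-t)^2/(2*y^5) := by positivity
    linarith
  calc _ ≤ (A/y^3 + (A/y^2*(4/3*(t/y^2)) + A/y*(32/9*(t/y^3)))) + (A/y^2 + A/y*(4/3*(t/y^2)))*(4/3*(t/y^2)) := by
        gcongr
        · exact n1.trans (by gcongr)
        · exact n2.trans (by gcongr)
    _ = A * (1/y^3 + 56/9*(t/y^4) + 16/9*(t^2/y^5)) := by field_simp; ring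
    _ ≤ A * (1/y^3 + 56/9*((1/y^3 + t^2/y^5)/2) + 16/9*(t^2/y^5)) := by gcongr
    _ = A * (37/9*(1/y^3) + 44/9*(t^2/y^5)) := by ring
    _ ≤ A * (5*(1/y^3) + 5*(t^2/y^5)) := by gcongr <;> norm_num
    _ = _ := by ring

end TM

namespace TM

lemma midpoint {f f1 f2 : ℝ → ℂ} (h1 : ∀ y, HasDerivAt f (f1 y) y) (h2 : ∀ y, HasDerivAt f1 (f2 y) y)
    (hc : Continuous f2) (c δ : ℝ) (hδ : 0 < δ) :
    ‖((2*δ:ℝ):ℂ) * f c - ∫ y in (c-δ)..(c+δ), f y‖ ≤ 2*δ^2 * ∫ y in (c-δ)..(c+δ), ‖f2 y‖ := by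
  set V := ∫ y in (c-δ)..(c+δ), ‖f2 y‖ with hV
  have hle : c - δ ≤ c + δ := by linarith
  have fc : Continuous f := continuous_iff_continuousAt.2 fun y => (h1 y).continuousAt
  have f1c : Continuous f1 := continuous_iff_continuousAt.2 fun y => (h2 y).continuousAt
  have hf1 : ∀ x ∈ Set.Icc (c-δ) (c+δ), ‖f1 x - f1 c‖ ≤ V := by
    intro x hx
    have : ∫ y in c..x, f2 y = f1 x - f1 c :=
      intervalIntegral.integral_eq_sub_of_hasDerivAt (fun y _ => h2 y) (hc.intervalIntegrable _ _)
    rw [← this, hV, intervalIntegral.integral_of_le hle]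
    refine (intervalIntegral.norm_integral_le_integral_norm_uIoc).trans ?_
    refine setIntegral_mono_set ?_ ?_ ?_
    · exact (hc.norm.intervalIntegrable (c-δ) (c+δ)).1
    · exact Filter.Eventually.of_forall fun y => norm_nonneg _
    · refine LE.le.eventuallyLE ?_
      intro z hz
      rw [Set.uIoc, Set.mem_Ioc] at hz
      rcases le_total c x with h | h
      · rw [min_eq_left h, max_eq_right h] at hz
        exact ⟨by linarith, by linarith [hx.2]⟩
      · rw [min_eq_right h, max_eq_left h] at hz
        exact ⟨by linarith [hx.1], by linarith⟩
  have hg : ∀ x ∈ Set.Icc (c-δ) (c+δ), ‖f x - f c - (x-c:ℝ) * f1 c‖ ≤ V * δ := by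
    intro x hx
    have hd : ∀ z ∈ Set.Icc (c-δ) (c+δ), HasDerivWithinAt (fun x : ℝ => f x - ((x-c:ℝ):ℂ) * f1 c) (f1 z - f1 c) (Set.Icc (c-δ) (c+δ)) z := by
      intro z _
      have e : HasDerivAt (fun x : ℝ => ((x-c:ℝ):ℂ)) 1 z := by
        simpa using ((hasDerivAt_id z).sub_const c).ofReal_comp
      have := (h1 z).sub (e.mul_const (f1 c))
      rw [one_mul] at this
      exact this.hasDerivWithinAt
    have := (convex_Icc (c-δ) (c+δ)).norm_image_sub_le_of_norm_hasDerivWithin_le hd hf1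
      (show c ∈ _ from ⟨by linarith, by linarith⟩) hx
    have e : f x - f c - (x-c:ℝ) * f1 c = (f x - ((x-c:ℝ):ℂ) * f1 c) - (f c - ((c-c:ℝ):ℂ) * f1 c) := by
      simp; ring
    rw [e]
    refine this.trans ?_
    have hV0 : 0 ≤ V := (norm_nonneg _).trans (hf1 x hx)
    gcongr
    rw [Real.norm_eq_abs, abs_le]; constructor <;> linarith [hx.1, hx.2]
  have hx0 : ∫ x in (c-δ)..(c+δ), (((x-c:ℝ):ℂ) * f1 c) = 0 := by
    rw [intervalIntegral.integral_mul_const, intervalIntegral.integral_ofReal]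
    have : ∫ x in (c-δ)..(c+δ), (x - c) = 0 := by
      rw [intervalIntegral.integral_sub (f := fun x => x) (continuous_id.intervalIntegrable _ _) (continuous_const.intervalIntegrable _ _), integral_id, intervalIntegral.integral_const]
      simp; ring
    rw [this]; simp
  have e : ((2*δ:ℝ):ℂ) * f c - ∫ y in (c-δ)..(c+δ), f y = - ∫ y in (c-δ)..(c+δ), (f y - f c - (y-c:ℝ) * f1 c) := by
    rw [intervalIntegral.integral_sub, intervalIntegral.integral_sub, hx0, intervalIntegral.integral_const]
    · rw [Complex.real_smul]; push_cast; ring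
    · exact fc.intervalIntegrable _ _
    · simp
    · exact (fc.sub continuous_const).intervalIntegrable _ _
    · apply Continuous.intervalIntegrable; fun_prop
  rw [e, norm_neg]
  refine (intervalIntegral.norm_integral_le_of_norm_le_const (C := V*δ) ?_).trans ?_
  · intro x hx
    rw [Set.uIoc_of_le hle] at hx
    exact hg x ⟨hx.1.le, hx.2⟩
  · rw [abs_of_nonneg (by linarith)]; apply le_of_eq; ring

lemma riemann_em {f f1 f2 : ℝ → ℂ} (h1 : ∀ y, HasDerivAt f (f1 y) y) (h2 : ∀ y, HasDerivAt f1 (f2 y) y)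
    (hc : Continuous f2) (h : ℕ) (hh : 1 ≤ h) (K : ℕ) (a : ℕ → ℝ) (ha : ∀ k, a k = (k+1/2)/h+1/2) :
    ‖∑ n ∈ Finset.Icc 1 K, (1/(h:ℂ)) * f (n/h + 1/2) - ∫ y in (a 0)..(a K), f y‖ ≤
      1/(2*(h:ℝ)^2) * ∫ y in (a 0)..(a K), ‖f2 y‖ := by
  have fc : Continuous f := continuous_iff_continuousAt.2 fun y => (h1 y).continuousAt
  have h0 : (0:ℝ) < h := by exact_mod_cast hh
  rw [← intervalIntegral.sum_integral_adjacent_intervals (fun k _ => fc.intervalIntegrable (a k) (a (k+1))),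
    ← intervalIntegral.sum_integral_adjacent_intervals (fun k _ => hc.norm.intervalIntegrable (a k) (a (k+1))),
    Finset.mul_sum]
  have : ∑ n ∈ Finset.Icc 1 K, (1/(h:ℂ)) * f (n/h + 1/2) = ∑ k ∈ Finset.range K, (1/(h:ℂ)) * f ((k+1:ℕ)/h + 1/2) := by
    rw [Finset.range_eq_Ico, Finset.sum_Ico_add' (fun n : ℕ => (1/(h:ℂ)) * f ((n:ℕ)/h + 1/2)) 0 K 1]
    rfl
  rw [this, ← Finset.sum_sub_distrib]
  refine (norm_sum_le _ _).trans (Finset.sum_le_sum fun k _ => ?_)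
  have := midpoint h1 h2 hc ((k+1:ℕ)/h + 1/2) (1/(2*h)) (by positivity)
  have e1 : ((k+1:ℕ):ℝ)/h + 1/2 - 1/(2*h) = a k := by rw [ha]; push_cast; field_simp; ring
  have e2 : ((k+1:ℕ):ℝ)/h + 1/2 + 1/(2*h) = a (k+1) := by rw [ha]; push_cast; field_simp; ring
  rw [e1, e2] at this
  have e3 : (((2*(1/(2*h)):ℝ)):ℂ) = 1/(h:ℂ) := by
    push_cast; field_simp
  rw [e3] at this
  refine this.trans (le_of_eq ?_)
  congr 1; field_simp

lemma alt_sum (g : ℕ → ℂ) (v : ℕ → ℝ) (h0 : ∀ h, ‖g h‖ ≤ v h) (h1 : ∀ h, ‖g h - g (h+1)‖ ≤ v h - v (h+1))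
    (n : ℕ) : ∀ a, ‖∑ h ∈ Finset.range n, (-1:ℂ)^(a+h) * g (a+h)‖ ≤ v a := by
  induction n using Nat.twoStepInduction with
  | zero => intro a; simpa using (norm_nonneg _).trans (h0 a)
  | one => intro a; simpa using h0 a
  | more n ih _ =>
    intro a
    rw [Finset.sum_range_succ', Finset.sum_range_succ']
    have e : ∀ k ∈ Finset.range n, (-1:ℂ)^(a+(k+1+1)) * g (a+(k+1+1)) = (-1:ℂ)^((a+2)+k) * g ((a+2)+k) := by
      intro k _; rw [show a+(k+1+1) = a+2+k by ring]
    rw [Finset.sum_congr rfl e]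
    have e2 : ∑ k ∈ Finset.range n, (-1:ℂ)^((a+2)+k) * g ((a+2)+k) + (-1:ℂ)^(a+(0+1)) * g (a+(0+1)) + (-1:ℂ)^(a+0) * g (a+0)
       = ∑ k ∈ Finset.range n, (-1:ℂ)^((a+2)+k) * g ((a+2)+k) + (-1:ℂ)^a * (g a - g (a+1)) := by
      simp [pow_succ]; ring
    rw [e2]
    refine (norm_add_le _ _).trans ?_
    have h3 := ih (a+2)
    have h4 : ‖(-1:ℂ)^a * (g a - g (a+1))‖ ≤ v a - v (a+1) := by simpa using h1 a
    have h5 := (norm_nonneg _).trans (h1 (a+1))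
    rw [show a+1+1 = a+2 by ring] at h5
    linarith


lemma tail_int {q : ℝ → ℝ} {Y B D : ℝ} (hY : 1 < Y) (hc : Continuous q) (hz : ∀ y, y ≤ Y → q y = 0)
    (hB : 0 ≤ B) (hD : 0 ≤ D)
    (hq : ∀ y, 1 ≤ y → q y ≤ B*(1/y^3 + D/y^5)) {a b : ℝ} (ha : a ≤ 1) :
    ∫ y in a..b, q y ≤ B*(1/Y^2 + D/Y^4) := by
  have hY0 : 0 < Y := by linarith
  have z : ∀ c d, c ≤ Y → d ≤ Y → ∫ y in c..d, q y = 0 := by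
    intro c d h1 h2
    rw [intervalIntegral.integral_congr (g := fun _ => 0)]
    · simp
    · intro y hy
      exact hz y (hy.2.trans (max_le h1 h2))
  rcases le_total b Y with hb | hb
  · rw [z a b (by linarith) hb]; positivity
  · rw [← intervalIntegral.integral_add_adjacent_intervals (hc.intervalIntegrable a Y) (hc.intervalIntegrable Y b),
      z a Y (by linarith) le_rfl, zero_add]
    have hd : ∀ y ∈ Set.uIcc Y b, HasDerivAt (fun y : ℝ => B*(-(1/(2*y^2)) - D/(4*y^4))) (B*(1/y^3 + D/y^5)) y := by
      intro y hy
      rw [Set.uIcc_of_le hb] at hy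
      have hy0 : 0 < y := by linarith [hy.1]
      have e1 := ((hasDerivAt_pow 2 y).const_mul 2).fun_inv (by positivity)
      have e2 := ((hasDerivAt_pow 4 y).const_mul 4).fun_inv (by positivity)
      have := ((e1.neg).sub (e2.const_mul D)).const_mul B
      refine (this.congr_of_eventuallyEq (Filter.Eventually.of_forall fun z => ?_)).congr_deriv ?_
      · simp [div_eq_mul_inv]
      · field_simp; norm_num; ring
    have hi : IntervalIntegrable (fun y : ℝ => B*(1/y^3 + D/y^5)) volume Y b := by
      apply ContinuousOn.intervalIntegrable
      intro y hy
      rw [Set.uIcc_of_le hb] at hy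
      have hy0 : 0 < y := by linarith [hy.1]
      have h3 : y^3 ≠ 0 := by positivity
      have h5 : y^5 ≠ 0 := by positivity
      apply ContinuousAt.continuousWithinAt
      fun_prop (disch := assumption)
    have := intervalIntegral.integral_eq_sub_of_hasDerivAt hd hi
    refine (intervalIntegral.integral_mono_on hb (hc.intervalIntegrable _ _) hi
      (fun y hy => hq y (by linarith [hy.1]))).trans ?_
    rw [this]
    have hb0 : 0 < b := by linarith
    have p1 : 0 ≤ B * (1/(2*b^2)) := by positivity
    have p2 : 0 ≤ B * (D/(4*b^4)) := by positivity
    have p3 : B * (1/(2*Y^2)) ≤ B*(1/Y^2) := by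
      gcongr; nlinarith [sq_nonneg Y]
    have p4 : B * (D/(4*Y^4)) ≤ B*(D/Y^4) := by
      gcongr; nlinarith [pow_pos hY0 4]
    nlinarith

lemma em_bound {A Y f f1 f2} (hY : 1 < Y) (hf : GSym A Y f f1 f2) {t : ℝ} (ht : 0 ≤ t) (X : ℕ) (hX : 1 ≤ X)
    (H1 H2 : ℕ) (hH : H2 ≤ X) :
    ‖∑ h ∈ Finset.Ioc H1 H2, (-1:ℂ)^h * ∑ n ∈ Finset.Icc 1 (X-h), (1/(h:ℂ)) * ((f (n/h+1/2) : ℂ) * ph t (n/h + 1/2))‖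
     ≤ A * Real.log (2*X) + (∑ h ∈ Finset.Ioc H1 H2, 1/(h:ℝ)^2) * (5*A*(1/Y^2 + t^2/Y^4)) := by
  have hA := hf.nonneg
  set F : ℝ → ℂ := fun y => (f y : ℂ) * ph t y with hF
  have hFc : Continuous F := continuous_iff_continuousAt.2 fun y => (hf.F_d1 hY t y).continuousAt
  have hFz : ∀ y, y ≤ Y → F y = 0 := fun y hy => by simp [hF, hf.z0 y hy]
  set U : ℕ → ℝ := fun h => max 1 (((X:ℝ)+1/2)/h - 1/2) with hU
  have hU1 : ∀ h, 1 ≤ U h := fun h => le_max_left _ _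
  have hUm : ∀ h, 1 ≤ h → U (h+1) ≤ U h := by
    intro h hh
    have : (0:ℝ) < h := by exact_mod_cast hh
    simp only [hU]; push_cast
    gcongr; linarith
  have z : ∀ c d, c ≤ 1 → d ≤ 1 → ∫ y in c..d, F y = 0 := by
    intro c d h1 h2
    rw [intervalIntegral.integral_congr (g := fun _ => 0)]
    · simp
    · intro y hy
      exact hFz y ((hy.2.trans (max_le h1 h2)).trans hY.le)
  have hd : ∀ h ∈ Finset.Ioc H1 H2, ‖∑ n ∈ Finset.Icc 1 (X-h), (1/(h:ℂ)) * F (n/h + 1/2) - ∫ y in (1:ℝ)..(U h), F y‖ ≤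
      1/(h:ℝ)^2 * (5*A*(1/Y^2 + t^2/Y^4)) := by
    intro h hh
    rw [Finset.mem_Ioc] at hh
    have h0 : (1:ℝ) ≤ h := by exact_mod_cast (by omega : 1 ≤ h)
    have := riemann_em (hf.F_d1 hY t) (hf.F_d2 hY t) (hf.F_c2 hY t) h (by omega) (X-h) (fun k => (k+1/2)/h+1/2) (fun k => rfl)
    have ea0 : (((0:ℕ):ℝ)+1/2)/h+1/2 ≤ 1 := by
      have : (1/2:ℝ)/h ≤ 1/2 := div_le_self (by norm_num) h0
      push_cast; rw [zero_add]; linarith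
    set α : ℝ := (((0:ℕ):ℝ)+1/2)/h+1/2
    have eK : (((X-h:ℕ):ℝ)+1/2)/h+1/2 = ((X:ℝ)+1/2)/h - 1/2 := by
      rw [Nat.cast_sub (by omega)]; field_simp; ring
    rw [eK] at this
    set β : ℝ := ((X:ℝ)+1/2)/h - 1/2 with hβ
    have i1 : ∫ y in α..β, F y = ∫ y in (1:ℝ)..(U h), F y := by
      have j1 := intervalIntegral.integral_add_adjacent_intervals (hFc.intervalIntegrable α 1) (hFc.intervalIntegrable (μ := volume) 1 β)
      rw [← j1, z α 1 ea0 le_rfl, zero_add]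
      rcases le_total 1 β with hb | hb
      · simp only [hU]; rw [max_eq_right hb]
      · simp only [hU]; rw [max_eq_left hb, z 1 β le_rfl hb]; simp
    have i2 : ∫ y in α..β, ‖G2 t f f1 f2 y‖ ≤ 5*A*(1/Y^2 + t^2/Y^4) := by
      refine tail_int hY (hf.F_c2 hY t).norm ?_ (by positivity) (by positivity) (fun y hy => hf.F_b2 ht hy) ea0
      intro y hy
      simp [G2, hf.z0 y hy, hf.z1 y hy, hf.z2 y hy]
    rw [← i1]
    refine this.trans ?_
    have : (1:ℝ)/(2*h^2) ≤ 1/h^2 := by gcongr; nlinarith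
    exact (mul_le_mul_of_nonneg_left i2 (by positivity)).trans (mul_le_mul_of_nonneg_right this (by positivity))
  have halt : ‖∑ h ∈ Finset.Ioc H1 H2, (-1:ℂ)^h * ∫ y in (1:ℝ)..(U h), F y‖ ≤ A * Real.log (2*X) := by
    have e : ∑ h ∈ Finset.Ioc H1 H2, (-1:ℂ)^h * ∫ y in (1:ℝ)..(U h), F y =
       - ∑ k ∈ Finset.range (H2-H1), (-1:ℂ)^(H1+k) * ∫ y in (1:ℝ)..(U (H1+k+1)), F y := by
      rw [show Finset.Ioc H1 H2 = Finset.Ico (H1+1) (H2+1) by ext; simp, Finset.sum_Ico_eq_sum_range,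
        ← Finset.sum_neg_distrib, show H2+1-(H1+1) = H2-H1 by omega]
      refine Finset.sum_congr rfl fun k _ => ?_
      rw [show H1+1+k = H1+k+1 by ring, pow_succ, mul_neg_one, neg_mul]
    rw [e, norm_neg]
    refine (alt_sum (fun k => ∫ y in (1:ℝ)..(U (k+1)), F y) (fun k => ∫ y in (1:ℝ)..(U (k+1)), ‖F y‖) ?_ ?_ _ H1).trans ?_
    · intro k
      exact intervalIntegral.norm_integral_le_integral_norm (hU1 _)
    · intro k
      rw [intervalIntegral.integral_interval_sub_left (hFc.intervalIntegrable _ _) (hFc.intervalIntegrable _ _),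
       intervalIntegral.integral_interval_sub_left (hFc.norm.intervalIntegrable _ _) (hFc.norm.intervalIntegrable _ _)]
      exact intervalIntegral.norm_integral_le_integral_norm (hUm _ (by omega))
    · have hi : IntervalIntegrable (fun y : ℝ => A * (1/y)) volume 1 (U (H1+1)) := by
        apply ContinuousOn.intervalIntegrable
        intro y hy
        rw [Set.uIcc_of_le (hU1 _)] at hy
        have hy0 : y ≠ 0 := by linarith [hy.1]
        apply ContinuousAt.continuousWithinAt
        fun_prop (disch := assumption)
      refine (intervalIntegral.integral_mono_on (hU1 _) (hFc.norm.intervalIntegrable _ _) hi (g := fun y => A * (1/y)) ?_).trans ?_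
      · intro y hy
        have := hf.b0 y hy.1
        rw [mul_one_div]
        simpa [hF, ph_norm] using this
      · rw [intervalIntegral.integral_const_mul, integral_one_div_of_pos (by norm_num) (by linarith [hU1 (H1+1)]), div_one]
        have hX' : (1:ℝ) ≤ X := by exact_mod_cast hX
        have : U (H1+1) ≤ 2*X := by
          simp only [hU]
          apply max_le (by linarith)
          have h1 : (1:ℝ) ≤ ((H1+1:ℕ):ℝ) := by exact_mod_cast (by omega : 1 ≤ H1+1)
          have : ((X:ℝ)+1/2)/((H1+1:ℕ):ℝ) ≤ X+1/2 := div_le_self (by linarith) h1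
          linarith
        have := Real.log_le_log (by linarith [hU1 (H1+1)]) this
        gcongr
  have e : ∑ h ∈ Finset.Ioc H1 H2, (-1:ℂ)^h * ∑ n ∈ Finset.Icc 1 (X-h), (1/(h:ℂ)) * F (n/h + 1/2)
     = ∑ h ∈ Finset.Ioc H1 H2, (-1:ℂ)^h * (∫ y in (1:ℝ)..(U h), F y) +
       ∑ h ∈ Finset.Ioc H1 H2, (-1:ℂ)^h * (∑ n ∈ Finset.Icc 1 (X-h), (1/(h:ℂ)) * F (n/h + 1/2) - ∫ y in (1:ℝ)..(U h), F y) := by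
    rw [← Finset.sum_add_distrib]
    refine Finset.sum_congr rfl fun h _ => ?_
    ring
  change ‖∑ h ∈ Finset.Ioc H1 H2, (-1:ℂ)^h * ∑ n ∈ Finset.Icc 1 (X-h), (1/(h:ℂ)) * F (n/h + 1/2)‖ ≤ _
  rw [e]
  refine (norm_add_le _ _).trans (add_le_add halt ?_)
  rw [Finset.sum_mul]
  refine (norm_sum_le _ _).trans (Finset.sum_le_sum fun h hh => ?_)
  simpa using hd h hh

end TM

namespace TM

noncomputable def kc (N : ℝ) (h : ℕ) : ℝ := (N/h)/(Real.exp (N/h) - 1)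
noncomputable def kap (N : ℝ) (h : ℕ) (z : ℝ) : ℝ := kc N h * Real.exp ((N/h) * Int.fract (h*(z-1/2)))

lemma kc_pos {N : ℝ} (hN : 0 < N) {h : ℕ} (hh : 1 ≤ h) : 0 < kc N h := by
  have h0 : (0:ℝ) < h := by exact_mod_cast hh
  unfold kc
  have : 0 < N/h := by positivity
  have := Real.add_one_lt_exp this.ne'
  apply div_pos (by positivity); linarith

lemma kap_meas (N : ℝ) (h : ℕ) : Measurable (kap N h) := by
  unfold kap
  apply Measurable.const_mul
  apply Real.measurable_exp.comp
  apply Measurable.const_mul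
  apply measurable_fract.comp
  fun_prop

lemma kap_bound {N : ℝ} (hN : 0 < N) {h : ℕ} (hh : 1 ≤ h) (z : ℝ) : |kap N h z| ≤ kc N h * Real.exp (N/h) := by
  have h0 : (0:ℝ) < h := by exact_mod_cast hh
  have := kc_pos hN hh
  unfold kap
  rw [abs_of_nonneg (by positivity)]
  gcongr
  have := (Int.fract_lt_one ((h:ℝ)*(z-1/2))).le
  have h2 : 0 ≤ N/h := by positivity
  nlinarith

lemma kap_per (N : ℝ) (h : ℕ) (z : ℝ) (m : ℤ) : kap N h (z + m) = kap N h z := by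
  unfold kap
  rw [show (h:ℝ) * (z + m - 1/2) = h*(z-1/2) + ((h*m:ℤ):ℝ) by push_cast; ring, Int.fract_add_intCast]

lemma kap_piece {N : ℝ} (hN : 0 < N) {h : ℕ} (hh : 1 ≤ h) {F F1 : ℝ → ℂ} (hd : ∀ y, HasDerivAt F (F1 y) y)
    (hc : Continuous F1) (k : ℕ) (x : ℕ → ℝ) (hx : ∀ k, x k = k/h + 1/2) :
    ∫ z in (x k)..(x (k+1)), (F z + F1 z/N) * kap N h z =
      ((kc N h / N : ℝ):ℂ) * ((Real.exp (N/h) : ℝ) * F (x (k+1)) - F (x k)) := by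
  have h0 : (0:ℝ) < h := by exact_mod_cast hh
  have fc : Continuous F := continuous_iff_continuousAt.2 fun y => (hd y).continuousAt
  have hxk : x (k+1) = x k + 1/h := by rw [hx, hx]; push_cast; field_simp; ring
  have hle : x k ≤ x (k+1) := by rw [hxk]; have : 0 < 1/(h:ℝ) := by positivity
                                 linarith
  have e : ∫ z in (x k)..(x (k+1)), (F z + F1 z/N) * kap N h z =
     ∫ z in (x k)..(x (k+1)), ((kc N h / N : ℝ):ℂ) * (F1 z * (Real.exp (N * (z - x k)):ℝ) + F z * (N * Real.exp (N*(z - x k)):ℝ)) := by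
    apply intervalIntegral.integral_congr_ae
    have : ∀ᵐ z : ℝ, z ≠ x (k+1) := by simp [ae_iff]
    filter_upwards [this] with z hz hz2
    rw [Set.uIoc_of_le hle] at hz2
    have hz3 : z < x (k+1) := lt_of_le_of_ne hz2.2 hz
    have hfr : Int.fract ((h:ℝ)*(z-1/2)) = h*(z - x k) := by
      rw [Int.fract_eq_iff]
      refine ⟨?_, ?_, k, ?_⟩
      · have := hz2.1; apply mul_nonneg h0.le; linarith
      · have : h * (z - x k) < h * (1/h) := by gcongr; linarith
        rwa [mul_one_div_cancel h0.ne'] at this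
      · rw [hx]; push_cast; field_simp; ring
    have : kap N h z = kc N h * Real.exp (N * (z - x k)) := by
      unfold kap; rw [hfr]; congr 2; field_simp
    rw [this]
    have hN' : (N:ℂ) ≠ 0 := by exact_mod_cast hN.ne'
    push_cast; field_simp; ring
  rw [e, intervalIntegral.integral_const_mul]
  have hdd : ∀ z ∈ Set.uIcc (x k) (x (k+1)), HasDerivAt (fun z : ℝ => F z * ((Real.exp (N * (z - x k)):ℝ):ℂ))
     (F1 z * (Real.exp (N * (z - x k)):ℝ) + F z * (N * Real.exp (N*(z - x k)):ℝ)) z := by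
    intro z _
    have e1 : HasDerivAt (fun z : ℝ => Real.exp (N * (z - x k))) (N * Real.exp (N*(z - x k))) z := by
      have := (((hasDerivAt_id z).sub_const (x k)).const_mul N).exp
      refine this.congr_deriv ?_
      simp; ring
    exact (hd z).mul e1.ofReal_comp
  rw [intervalIntegral.integral_eq_sub_of_hasDerivAt hdd]
  · rw [hxk]; simp
    left; rw [show (N:ℂ) * ((h:ℂ)⁻¹) = N/h by ring]; ring
  · apply Continuous.intervalIntegrable; fun_prop

lemma kap_ii {N : ℝ} (hN : 0 < N) {h : ℕ} (hh : 1 ≤ h) {g : ℝ → ℂ} (hg : Continuous g) (a b : ℝ) :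
    IntervalIntegrable (fun z => g z * (kap N h z : ℂ)) volume a b := by
  have : IntervalIntegrable (fun z => (kap N h z : ℂ)) volume a b := by
    rw [intervalIntegrable_iff]
    refine Measure.integrableOn_of_bounded (M := kc N h * Real.exp (N/h)) ?_ ?_ ?_
    · simp
    · exact (Complex.measurable_ofReal.comp (kap_meas N h)).aestronglyMeasurable
    · refine Filter.Eventually.of_forall fun z => ?_
      simpa using kap_bound hN hh z
  exact this.continuousOn_mul hg.continuousOn

lemma kap_sum {N : ℝ} (hN : 0 < N) {h : ℕ} (hh : 1 ≤ h) {F F1 : ℝ → ℂ} (hd : ∀ y, HasDerivAt F (F1 y) y)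
    (hc : Continuous F1) (K : ℕ) (hF : F (K/h+1/2) = F (1/2)) :
    ∫ z in (1/2:ℝ)..(K/h+1/2), (F z + F1 z/N) * kap N h z =
      ∑ k ∈ Finset.range K, (1/(h:ℂ)) * F (k/h+1/2) := by
  have h0 : (0:ℝ) < h := by exact_mod_cast hh
  have fc : Continuous F := continuous_iff_continuousAt.2 fun y => (hd y).continuousAt
  set x : ℕ → ℝ := fun k => k/h+1/2 with hx
  have := intervalIntegral.sum_integral_adjacent_intervals (f := fun z => (F z + F1 z/N) * (kap N h z:ℂ)) (μ := volume) (a := x) (n := K)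
    (fun k _ => kap_ii hN hh (g := fun z => F z + F1 z / N) (by fun_prop) (x k) (x (k+1)))
  rw [show x 0 = 1/2 by simp [hx]] at this
  change ∫ z in (1/2:ℝ)..(x K), (F z + F1 z/N) * kap N h z = ∑ k ∈ Finset.range K, (1/(h:ℂ)) * F (x k)
  rw [← this, Finset.sum_congr rfl fun k _ => kap_piece hN hh hd hc k x (fun _ => rfl), ← Finset.mul_sum,
    Finset.sum_sub_distrib, ← Finset.mul_sum, ← Finset.mul_sum]
  have tel : ∑ k ∈ Finset.range K, F (x (k+1)) = ∑ k ∈ Finset.range K, F (x k) := by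
    have h1 := Finset.sum_range_succ (fun k => F (x k)) K
    rw [Finset.sum_range_succ'] at h1
    have : F (x K) = F (x 0) := by simp only [hx]; simpa using hF
    rw [this] at h1
    exact add_right_cancel h1
  rw [tel]
  have hN' : (N:ℂ) ≠ 0 := by exact_mod_cast hN.ne'
  have hh' : (h:ℂ) ≠ 0 := by exact_mod_cast h0.ne'
  have e : Real.exp (N/h) - 1 ≠ 0 := by
    have : 0 < N/h := by positivity
    have := Real.add_one_lt_exp this.ne'
    intro h; linarith
  have key : kc N h / N * (Real.exp (N/h) - 1) = 1/h := by
    unfold kc; field_simp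
  have key' : ((kc N h / N : ℝ):ℂ) * ((Real.exp (N/h):ℝ) - 1) = 1/(h:ℂ) := by
    have := congrArg (fun r : ℝ => (r:ℂ)) key
    push_cast at this ⊢; exact this
  rw [← key']; ring

lemma kap_fourier {N : ℝ} (hN : 0 < N) {h : ℕ} (hh : 1 ≤ h) (n : ℤ) :
    ∫ z in (1/2:ℝ)..(3/2), Complex.exp (-(2*π*Complex.I*n*z)) * kap N h z =
      (-1:ℂ)^n * (if (h:ℤ) ∣ n then 1 else 0)/(1-2*π*Complex.I*n/N) := by
  have h0 : (0:ℝ) < h := by exact_mod_cast hh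
  have hN' : (N:ℂ) ≠ 0 := by exact_mod_cast hN.ne'
  have hh' : (h:ℂ) ≠ 0 := by exact_mod_cast h0.ne'
  set F : ℝ → ℂ := fun z => Complex.exp (-(2*π*Complex.I*n*z)) with hF
  have hd : ∀ y, HasDerivAt F (-(2*π*Complex.I*n) * F y) y := by
    intro y
    have : HasDerivAt (fun z : ℝ => -(2*π*Complex.I*n*(z:ℂ))) (-(2*π*Complex.I*n)) y := by
      have := ((hasDerivAt_id y).ofReal_comp.const_mul (2*π*Complex.I*n)).neg
      refine this.congr_deriv ?_
      simp
    refine this.cexp.congr_deriv ?_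
    simp only [hF]; ring
  have fc : Continuous F := continuous_iff_continuousAt.2 fun y => (hd y).continuousAt
  have per : F (h/h+1/2) = F (1/2) := by
    simp only [hF]
    rw [div_self h0.ne']
    rw [Complex.exp_eq_exp_iff_exists_int]
    refine ⟨-n, ?_⟩
    push_cast; ring
  have := kap_sum hN hh hd (by fun_prop) h per
  rw [div_self h0.ne', show (1:ℝ)+1/2 = 3/2 by norm_num] at this
  have hne : (1-2*π*Complex.I*n/N) ≠ 0 := by
    intro h
    have := congrArg Complex.re h
    have e : (2*π*Complex.I*n/N) = ((2*π*n/N:ℝ):ℂ) * Complex.I := by push_cast; ring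
    rw [e] at this
    simp at this
  have e1 : ∫ z in (1/2:ℝ)..(3/2), (F z + -(2*π*Complex.I*n) * F z / N) * kap N h z =
     (1-2*π*Complex.I*n/N) * ∫ z in (1/2:ℝ)..(3/2), F z * kap N h z := by
    rw [← intervalIntegral.integral_const_mul]
    congr 1; ext z; ring
  rw [e1] at this
  have e2 : ∀ k : ℕ, F (k/h+1/2) = (-1:ℂ)^n * (Complex.exp (-(2*π*Complex.I*n/h)))^k := by
    intro k
    simp only [hF]
    rw [← Complex.exp_nat_mul, show (-1:ℂ)^n = Complex.exp (-(π*Complex.I*n)) by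
      rw [show -(π*Complex.I*n) = ((-n:ℤ):ℂ)*(π*Complex.I) by push_cast; ring, Complex.exp_int_mul, Complex.exp_pi_mul_I, zpow_neg]
      rcases Int.even_or_odd n with hn | hn
      · simp [hn.neg_one_zpow]
      · simp [hn.neg_one_zpow], ← Complex.exp_add]
    congr 1
    push_cast; field_simp; ring
  have e3 : ∑ k ∈ Finset.range h, (1/(h:ℂ)) * F (k/h+1/2) = (-1:ℂ)^n * (if (h:ℤ) ∣ n then 1 else 0) := by
    simp only [e2]
    rw [← Finset.mul_sum, ← Finset.mul_sum]
    split_ifs with hdv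
    · obtain ⟨m, rfl⟩ := hdv
      have : Complex.exp (-(2*π*Complex.I*((h*m:ℤ):ℂ)/h)) = 1 := by
        rw [Complex.exp_eq_one_iff]; refine ⟨-m, ?_⟩; push_cast; field_simp
      rw [this]; simp; field_simp
    · have hne1 : Complex.exp (-(2*π*Complex.I*n/h)) ≠ 1 := by
        intro h1
        rw [Complex.exp_eq_one_iff] at h1
        obtain ⟨m, hm⟩ := h1
        apply hdv
        refine ⟨-m, ?_⟩
        have hp : (2*π*Complex.I) ≠ 0 := Complex.two_pi_I_ne_zero
        have : (2*π*Complex.I) * (n:ℂ) = (2*π*Complex.I) * (h*(-m)) := by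
          have : -(2*π*Complex.I*n/h) * h = m * (2*π*Complex.I) * h := by rw [hm]
          have e : -(2*π*Complex.I*n/h) * h = -(2*π*Complex.I*n) := by field_simp
          rw [e] at this
          linear_combination -this
        have := mul_left_cancel₀ hp this
        exact_mod_cast this
      rw [geom_sum_eq hne1, ← Complex.exp_nat_mul]
      have : Complex.exp (h * -(2*π*Complex.I*n/h)) = 1 := by
        rw [Complex.exp_eq_one_iff]; refine ⟨-n, ?_⟩; push_cast; field_simp
      rw [this]; simp
  rw [e3] at this
  rw [eq_div_iff hne, mul_comm, this]


noncomputable def CC (N : ℝ) (H : ℕ) (z : ℝ) : ℝ := ∑ h ∈ Finset.Icc 1 H, (-1:ℝ)^h * (kap N h z - 1)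

lemma CC_meas (N : ℝ) (H : ℕ) : Measurable (CC N H) := by
  unfold CC
  refine Finset.measurable_sum _ fun h _ => ?_
  exact ((kap_meas N h).sub_const 1).const_mul _

lemma CC_bound {N : ℝ} (hN : 0 < N) (H : ℕ) : ∃ B : ℝ, 0 ≤ B ∧ ∀ z, |CC N H z| ≤ B := by
  refine ⟨∑ h ∈ Finset.Icc 1 H, (kc N h * Real.exp (N/h) + 1), ?_, fun z => ?_⟩
  · refine Finset.sum_nonneg fun h hh => ?_
    have := kc_pos hN (Finset.mem_Icc.1 hh).1
    positivity
  unfold CC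
  refine (Finset.abs_sum_le_sum_abs _ _).trans (Finset.sum_le_sum fun h hh => ?_)
  rw [abs_mul, abs_pow, abs_neg, abs_one, one_pow, one_mul]
  refine (abs_sub _ _).trans ?_
  have := kap_bound hN (Finset.mem_Icc.1 hh).1 z
  simp; exact this

lemma CC_per (N : ℝ) (H : ℕ) (z : ℝ) (m : ℤ) : CC N H (z + m) = CC N H z := by
  unfold CC; simp only [kap_per]

lemma CC_fourier {N : ℝ} (hN : 0 < N) (H : ℕ) (n : ℤ) :
    ‖fourierCoeffOn (show (1/2:ℝ) < 3/2 by norm_num) (fun z => (CC N H z : ℂ)) n‖^2 ≤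
      (if n = 0 then 0 else (∑ h ∈ Finset.Icc 1 H, if (h:ℤ) ∣ n then (1:ℝ) else 0)^2 / (1 + ((n:ℝ)/N)^2)) := by
  rw [fourierCoeffOn_eq_integral]
  have e0 : ∀ z : ℝ, (fourier (-n) (z : AddCircle ((3/2:ℝ)-1/2)) : ℂ) = Complex.exp (-(2*π*Complex.I*n*z)) := by
    intro z
    rw [fourier_coe_apply]; congr 1; push_cast; norm_num
  simp only [e0]
  rw [show (1:ℝ)/(3/2-1/2) = 1 by norm_num, one_smul]
  have hfc : Continuous fun z : ℝ => Complex.exp (-(2*π*Complex.I*n*z)) := by fun_prop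
  have e1 : ∫ z in (1/2:ℝ)..(3/2), Complex.exp (-(2*π*Complex.I*n*z)) • (CC N H z : ℂ) =
      ∑ h ∈ Finset.Icc 1 H, (-1:ℂ)^h * ((∫ z in (1/2:ℝ)..(3/2), Complex.exp (-(2*π*Complex.I*n*z)) * kap N h z) -
         ∫ z in (1/2:ℝ)..(3/2), Complex.exp (-(2*π*Complex.I*n*z))) := by
    have : ∀ h ∈ Finset.Icc 1 H, (-1:ℂ)^h * ((∫ z in (1/2:ℝ)..(3/2), Complex.exp (-(2*π*Complex.I*n*z)) * kap N h z) -
         ∫ z in (1/2:ℝ)..(3/2), Complex.exp (-(2*π*Complex.I*n*z))) =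
         ∫ z in (1/2:ℝ)..(3/2), (-1:ℂ)^h * (Complex.exp (-(2*π*Complex.I*n*z)) * kap N h z - Complex.exp (-(2*π*Complex.I*n*z))) := by
      intro h hh
      rw [intervalIntegral.integral_const_mul, intervalIntegral.integral_sub (kap_ii hN (Finset.mem_Icc.1 hh).1 hfc _ _) (hfc.intervalIntegrable _ _)]
    rw [Finset.sum_congr rfl this, ← intervalIntegral.integral_finsetSum]
    · congr 1; ext z; unfold CC
      push_cast
      rw [smul_eq_mul, Finset.mul_sum]
      refine Finset.sum_congr rfl fun h _ => ?_
      ring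
    · intro h hh
      exact ((kap_ii hN (Finset.mem_Icc.1 hh).1 hfc _ _).sub (hfc.intervalIntegrable _ _)).const_mul _
  rw [e1]
  have e2 : ∫ z in (1/2:ℝ)..(3/2), Complex.exp (-(2*π*Complex.I*n*z)) = if n = 0 then 1 else 0 := by
    split_ifs with hn
    · subst hn; simp; norm_num
    · have hne : (-(2*π*Complex.I*n)) ≠ 0 := by
        simp [hn, Real.pi_ne_zero]
      have := integral_exp_mul_complex (a := 1/2) (b := 3/2) hne
      simp only [neg_mul] at this
      rw [this]
      have : Complex.exp (-(2*π*Complex.I*n*((3/2:ℝ):ℂ))) = Complex.exp (-(2*π*Complex.I*n*((1/2:ℝ):ℂ))) := by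
        rw [Complex.exp_eq_exp_iff_exists_int]
        refine ⟨-n, ?_⟩
        push_cast; ring
      rw [this]; simp
  rw [e2]
  split_ifs with hn
  · subst hn
    have : ∀ h ∈ Finset.Icc 1 H, (-1:ℂ)^h * ((∫ z in (1/2:ℝ)..(3/2), Complex.exp (-(2*π*Complex.I*((0:ℤ):ℂ)*z)) * kap N h z) - 1) = 0 := by
      intro h hh
      rw [kap_fourier hN (Finset.mem_Icc.1 hh).1]; simp
    rw [Finset.sum_congr rfl this]; simp
  · have e3 : ∀ h ∈ Finset.Icc 1 H, (-1:ℂ)^h * ((∫ z in (1/2:ℝ)..(3/2), Complex.exp (-(2*π*Complex.I*n*z)) * kap N h z) - 0) =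
       ((-1:ℂ)^n /(1-2*π*Complex.I*n/N)) * ((-1:ℂ)^h * (if (h:ℤ) ∣ n then 1 else 0)) := by
      intro h hh
      rw [kap_fourier hN (Finset.mem_Icc.1 hh).1]; ring
    rw [Finset.sum_congr rfl e3, ← Finset.mul_sum, norm_mul, mul_pow, mul_comm]
    have n1 : ‖∑ h ∈ Finset.Icc 1 H, (-1:ℂ)^h * (if (h:ℤ) ∣ n then 1 else 0)‖ ≤ ∑ h ∈ Finset.Icc 1 H, if (h:ℤ) ∣ n then (1:ℝ) else 0 := by
      refine (norm_sum_le _ _).trans (Finset.sum_le_sum fun h _ => ?_)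
      split_ifs <;> simp
    have n2 : ‖(-1:ℂ)^n /(1-2*π*Complex.I*n/N)‖^2 ≤ 1/(1 + ((n:ℝ)/N)^2) := by
      rw [norm_div, norm_zpow, norm_neg, norm_one, one_zpow, div_pow, one_pow]
      have : ‖(1-2*π*Complex.I*n/N)‖^2 = 1 + (2*π*n/N)^2 := by
        rw [← Complex.normSq_eq_norm_sq, show (2*π*Complex.I*n/N) = ((2*π*n/N:ℝ):ℂ) * Complex.I by push_cast; ring,
          Complex.normSq_apply]
        simp; ring
      rw [this]
      have hp : 1 ≤ 2*π := by linarith [Real.pi_gt_three]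
      have : (2*π*n/N)^2 = (2*π)^2 * ((n:ℝ)/N)^2 := by ring
      rw [this]
      have : 1 ≤ (2*π)^2 := by nlinarith
      have h3 := sq_nonneg ((n:ℝ)/N)
      gcongr
      nlinarith
    refine (mul_le_mul (pow_le_pow_left₀ (norm_nonneg _) n1 2) n2 (by positivity) (by positivity)).trans (le_of_eq ?_)
    rw [mul_one_div]

lemma harm (H : ℕ) : ∑ m ∈ Finset.Icc 1 H, (1:ℝ)/m ≤ 1 + Real.log H := by
  have := harmonic_le_one_add_log H
  rw [harmonic_eq_sum_Icc] at this
  push_cast at this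
  simpa using this

lemma sum_dvd_harm (H d : ℕ) (hd : 1 ≤ d) :
    ∑ h ∈ Finset.Icc 1 H, (if d ∣ h then (1:ℝ)/h else 0) ≤ (1/d) * (1 + Real.log H) := by
  have h1 : ∑ h ∈ Finset.Icc 1 H, (if d ∣ h then (1:ℝ)/h else 0) ≤ ∑ m ∈ Finset.Icc 1 H, (1:ℝ)/(d*m:ℕ) := by
    rw [← Finset.sum_filter]
    rw [← Finset.sum_image (f := fun h : ℕ => (1:ℝ)/h) (g := fun m => d*m)]
    · refine Finset.sum_le_sum_of_subset_of_nonneg ?_ (fun _ _ _ => by positivity)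
      intro h hh
      rw [Finset.mem_filter, Finset.mem_Icc] at hh
      obtain ⟨⟨h1, h2⟩, m, rfl⟩ := hh
      rw [Finset.mem_image]
      refine ⟨m, Finset.mem_Icc.2 ⟨?_, ?_⟩, rfl⟩
      · rcases Nat.eq_zero_or_pos m with h | h
        · subst h; simp at h1
        · exact h
      · nlinarith
    · intro a _ b _ hab
      exact Nat.eq_of_mul_eq_mul_left (by omega) hab
  refine h1.trans ?_
  have : ∑ m ∈ Finset.Icc 1 H, (1:ℝ)/(d*m:ℕ) = (1/d) * ∑ m ∈ Finset.Icc 1 H, (1:ℝ)/m := by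
    rw [Finset.mul_sum]; refine Finset.sum_congr rfl fun m _ => ?_
    push_cast; rw [div_mul_div_comm, one_mul]
  rw [this]
  have := harm H
  gcongr

lemma gcd_sum (H : ℕ) : ∑ h ∈ Finset.Icc 1 H, ∑ k ∈ Finset.Icc 1 H, (1:ℝ)/(Nat.lcm h k) ≤ (1 + Real.log H)^3 := by
  have L0 : 0 ≤ 1 + Real.log H := by have := Real.log_natCast_nonneg H; linarith
  have h1 : ∀ h ∈ Finset.Icc 1 H, ∀ k ∈ Finset.Icc 1 H, (1:ℝ)/(Nat.lcm h k) ≤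
      ∑ d ∈ Finset.Icc 1 H, (d:ℝ) * ((if d ∣ h then (1:ℝ)/h else 0) * (if d ∣ k then (1:ℝ)/k else 0)) := by
    intro h hh k hk
    rw [Finset.mem_Icc] at hh hk
    have hg : Nat.gcd h k ∈ Finset.Icc 1 H := Finset.mem_Icc.2
      ⟨Nat.gcd_pos_of_pos_left _ hh.1, (Nat.gcd_le_left k hh.1).trans hh.2⟩
    refine le_trans ?_ (Finset.single_le_sum (f := fun d : ℕ => (d:ℝ) * ((if d ∣ h then (1:ℝ)/h else 0) * (if d ∣ k then (1:ℝ)/k else 0))) (fun d _ => ?_) hg)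
    · simp only [Nat.gcd_dvd_left, Nat.gcd_dvd_right, if_true]
      apply le_of_eq
      have : (Nat.gcd h k : ℝ) * (Nat.lcm h k) = h * k := by exact_mod_cast Nat.gcd_mul_lcm h k
      have a1 : (0:ℝ) < h := by exact_mod_cast hh.1
      have a2 : (0:ℝ) < k := by exact_mod_cast hk.1
      have a3 : (0:ℝ) < Nat.lcm h k := by exact_mod_cast Nat.lcm_pos hh.1 hk.1
      field_simp; linarith
    · positivity
  calc _ ≤ ∑ h ∈ Finset.Icc 1 H, ∑ k ∈ Finset.Icc 1 H, ∑ d ∈ Finset.Icc 1 H, (d:ℝ) * ((if d ∣ h then (1:ℝ)/h else 0) * (if d ∣ k then (1:ℝ)/k else 0)) :=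
        Finset.sum_le_sum fun h hh => Finset.sum_le_sum fun k hk => h1 h hh k hk
    _ = ∑ d ∈ Finset.Icc 1 H, (d:ℝ) * ((∑ h ∈ Finset.Icc 1 H, (if d ∣ h then (1:ℝ)/h else 0)) * (∑ k ∈ Finset.Icc 1 H, (if d ∣ k then (1:ℝ)/k else 0))) := by
        rw [Finset.sum_congr rfl fun h _ => Finset.sum_comm, Finset.sum_comm]
        refine Finset.sum_congr rfl fun d _ => ?_
        rw [Finset.sum_mul_sum, Finset.mul_sum]
        refine Finset.sum_congr rfl fun h _ => ?_
        rw [Finset.mul_sum]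
    _ ≤ ∑ d ∈ Finset.Icc 1 H, (1/(d:ℝ)) * (1 + Real.log H)^2 := by
        refine Finset.sum_le_sum fun d hd => ?_
        have hd1 := (Finset.mem_Icc.1 hd).1
        have hd0 : (0:ℝ) < d := by exact_mod_cast hd1
        have s0 : 0 ≤ ∑ h ∈ Finset.Icc 1 H, (if d ∣ h then (1:ℝ)/h else 0) := Finset.sum_nonneg fun h _ => by positivity
        have := sum_dvd_harm H d hd1
        calc _ ≤ (d:ℝ) * (((1/d) * (1 + Real.log H)) * ((1/d) * (1 + Real.log H))) := by gcongr
          _ = _ := by field_simp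
    _ ≤ _ := by
        rw [← Finset.sum_mul]
        have := harm H
        calc _ ≤ (1 + Real.log H) * (1 + Real.log H)^2 := by gcongr
          _ = _ := by ring

end TM

namespace TM

lemma cauchy_sum {c : ℝ} (hc : 0 < c) (K : ℕ) : ∑ m ∈ Finset.Icc 1 K, 1/(1 + (c*m)^2) ≤ 2/c := by
  have step : ∀ m : ℕ, c * (1/(1 + (c*((m+1:ℕ):ℝ))^2)) ≤ Real.arctan (c*((m+1:ℕ):ℝ)) - Real.arctan (c*m) := by
    intro m
    have hlt : c*(m:ℝ) < c*((m+1:ℕ):ℝ) := by push_cast; nlinarith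
    obtain ⟨ξ, hξ, he⟩ := exists_hasDerivAt_eq_slope Real.arctan (fun x => 1/(1+x^2)) hlt
      Real.continuous_arctan.continuousOn (fun x _ => Real.hasDerivAt_arctan x)
    have hd : c*((m+1:ℕ):ℝ) - c*(m:ℝ) = c := by push_cast; ring
    rw [hd] at he
    rw [eq_div_iff hc.ne'] at he
    rw [← he, mul_comm]
    have h0 : 0 ≤ c*(m:ℝ) := by positivity
    have : 0 < ξ := by linarith [hξ.1]
    have := hξ.2
    gcongr
  have : ∀ K : ℕ, c * ∑ m ∈ Finset.Icc 1 K, 1/(1 + (c*m)^2) ≤ Real.arctan (c*K) := by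
    intro K
    induction K with
    | zero => simp
    | succ n ih =>
      rw [Finset.sum_Icc_succ_top (by omega), mul_add]
      have := step n
      linarith
  have h2 := (this K).trans (Real.arctan_lt_pi_div_two _).le
  rw [le_div_iff₀ hc]
  have := Real.pi_lt_four
  linarith

lemma div_sum_half {N : ℝ} (hN : 0 < N) (L : ℕ) (hL : 1 ≤ L) (S : Finset ℕ) :
    ∑ n ∈ S, (if n ≠ 0 ∧ L ∣ n then 1/(1+((n:ℝ)/N)^2) else 0) ≤ 2*N/L := by
  have hL0 : (0:ℝ) < L := by exact_mod_cast hL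
  set K := S.sup id
  rw [← Finset.sum_filter]
  have h1 : ∑ n ∈ S with (n ≠ 0 ∧ L ∣ n), 1/(1+((n:ℝ)/N)^2) ≤ ∑ m ∈ Finset.Icc 1 K, 1/(1+(((L*m:ℕ):ℝ)/N)^2) := by
    rw [← Finset.sum_image (f := fun n : ℕ => 1/(1+((n:ℝ)/N)^2)) (g := fun m => L*m)]
    · refine Finset.sum_le_sum_of_subset_of_nonneg ?_ (fun _ _ _ => by positivity)
      intro h hh
      rw [Finset.mem_filter] at hh
      obtain ⟨hS, h1, m, rfl⟩ := hh
      have hle : L*m ≤ K := Finset.le_sup (f := id) hS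
      rw [Finset.mem_image]
      refine ⟨m, Finset.mem_Icc.2 ⟨?_, ?_⟩, rfl⟩
      · rcases Nat.eq_zero_or_pos m with h | h
        · subst h; simp at h1
        · exact h
      · nlinarith
    · intro a _ b _ hab
      exact Nat.eq_of_mul_eq_mul_left (by omega) hab
  refine h1.trans ?_
  have := cauchy_sum (c := L/N) (by positivity) K
  calc _ = ∑ m ∈ Finset.Icc 1 K, 1/(1 + (L/N*m)^2) := by
        refine Finset.sum_congr rfl fun m _ => ?_
        push_cast; congr 3; ring
    _ ≤ 2/(L/N) := this
    _ = _ := by field_simp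

lemma div_sum {N : ℝ} (hN : 0 < N) (L : ℕ) (hL : 1 ≤ L) (S : Finset ℤ) :
    ∑ n ∈ S, (if n ≠ 0 ∧ (L:ℤ) ∣ n then 1/(1+((n:ℝ)/N)^2) else 0) ≤ 4*N/L := by
  have h1 : ∀ n : ℤ, (if n ≠ 0 ∧ (L:ℤ) ∣ n then 1/(1+((n:ℝ)/N)^2) else 0) =
     (fun m : ℕ => (if m ≠ 0 ∧ L ∣ m then 1/(1+((m:ℝ)/N)^2) else 0)) n.natAbs := by
    intro n
    have e1 : (L:ℤ) ∣ n ↔ L ∣ n.natAbs := Int.natCast_dvd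
    have e2 : n ≠ 0 ↔ n.natAbs ≠ 0 := by simp
    have e3 : ((n:ℝ)/N)^2 = ((n.natAbs:ℝ)/N)^2 := by
      rw [div_pow, div_pow, Nat.cast_natAbs]; push_cast; rw [sq_abs]
    simp only [e1, e2, e3]
  rw [Finset.sum_congr rfl fun n _ => h1 n]
  set g := (fun m : ℕ => (if m ≠ 0 ∧ L ∣ m then 1/(1+((m:ℝ)/N)^2) else 0)) with hg
  have g0 : ∀ m, 0 ≤ g m := fun m => by simp only [hg]; positivity
  rw [← Finset.sum_filter_add_sum_filter_not S (fun n => 0 ≤ n)]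
  have p1 : ∑ n ∈ S with 0 ≤ n, g n.natAbs ≤ 2*N/L := by
    rw [← Finset.sum_image (f := g) (g := Int.natAbs)]
    · exact div_sum_half hN L hL _
    · intro a ha b hb hab
      simp at ha hb; omega
  have p2 : ∑ n ∈ S with ¬ 0 ≤ n, g n.natAbs ≤ 2*N/L := by
    rw [← Finset.sum_image (f := g) (g := Int.natAbs)]
    · exact div_sum_half hN L hL _
    · intro a ha b hb hab
      simp at ha hb; omega
  calc _ ≤ 2*N/L + 2*N/L := add_le_add p1 p2
    _ = _ := by ring

lemma CC_L2 {N : ℝ} (hN : 0 < N) (H : ℕ) :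
    ∫ z in (1/2:ℝ)..(3/2), (CC N H z)^2 ≤ 4*N*(1 + Real.log H)^3 := by
  obtain ⟨B, hB0, hB⟩ := CC_bound hN H
  have hmem : MemLp (fun z => (CC N H z : ℂ)) 2 (volume.restrict (Set.Ioc (1/2:ℝ) (3/2))) := by
    refine MemLp.of_bound (Complex.measurable_ofReal.comp (CC_meas N H)).aestronglyMeasurable B ?_
    exact Filter.Eventually.of_forall fun z => by simpa using hB z
  have hs := hasSum_sq_fourierCoeffOn (show (1/2:ℝ) < 3/2 by norm_num) hmem
  have e : ((3/2:ℝ)-1/2)⁻¹ • ∫ x in (1/2:ℝ)..(3/2), ‖(CC N H x:ℂ)‖^2 = ∫ z in (1/2:ℝ)..(3/2), (CC N H z)^2 := by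
    rw [show ((3/2:ℝ)-1/2)⁻¹ = 1 by norm_num, one_smul]
    congr 1; ext z; simp
  rw [e] at hs
  refine hasSum_le_of_sum_le hs fun S => ?_
  refine (Finset.sum_le_sum fun n _ => CC_fourier hN H n).trans ?_
  have h1 : ∀ n : ℤ, (if n = 0 then 0 else (∑ h ∈ Finset.Icc 1 H, if (h:ℤ) ∣ n then (1:ℝ) else 0)^2 / (1 + ((n:ℝ)/N)^2))
     = ∑ h ∈ Finset.Icc 1 H, ∑ k ∈ Finset.Icc 1 H, (if n ≠ 0 ∧ ((Nat.lcm h k:ℕ):ℤ) ∣ n then 1/(1+((n:ℝ)/N)^2) else 0) := by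
    intro n
    by_cases hn : n = 0
    · simp [hn]
    · rw [if_neg hn, pow_two, Finset.sum_mul_sum, Finset.sum_div]
      refine Finset.sum_congr rfl fun h _ => ?_
      rw [Finset.sum_div]
      refine Finset.sum_congr rfl fun k _ => ?_
      have : ((Nat.lcm h k:ℕ):ℤ) ∣ n ↔ (h:ℤ) ∣ n ∧ (k:ℤ) ∣ n := by
        rw [Int.natCast_dvd, Int.natCast_dvd, Int.natCast_dvd, Nat.lcm_dvd_iff]
      simp only [this]
      by_cases a : (h:ℤ) ∣ n <;> by_cases b : (k:ℤ) ∣ n <;> simp [a, b, hn]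
  rw [Finset.sum_congr rfl fun n _ => h1 n, Finset.sum_comm]
  calc _ = ∑ h ∈ Finset.Icc 1 H, ∑ k ∈ Finset.Icc 1 H, ∑ n ∈ S, (if n ≠ 0 ∧ ((Nat.lcm h k:ℕ):ℤ) ∣ n then 1/(1+((n:ℝ)/N)^2) else 0) :=
        Finset.sum_congr rfl fun h _ => Finset.sum_comm
    _ ≤ ∑ h ∈ Finset.Icc 1 H, ∑ k ∈ Finset.Icc 1 H, 4*N*((1:ℝ)/(Nat.lcm h k)) := by
        refine Finset.sum_le_sum fun h hh => Finset.sum_le_sum fun k hk => ?_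
        refine (div_sum hN _ (Nat.lcm_pos (Finset.mem_Icc.1 hh).1 (Finset.mem_Icc.1 hk).1) S).trans (le_of_eq ?_)
        ring
    _ = 4*N*∑ h ∈ Finset.Icc 1 H, ∑ k ∈ Finset.Icc 1 H, ((1:ℝ)/(Nat.lcm h k)) := by
        simp only [Finset.mul_sum]
    _ ≤ _ := by
        have := gcd_sum H
        gcongr

end TM

namespace TM

structure Blk (A Y : ℝ) (a a1 a2 : ℝ → ℝ) : Prop extends GSym A Y a a1 a2 where
  hY : 1 < Y
  r0 : ∀ y, 4*Y ≤ y → a y = 0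
  r1 : ∀ y, 4*Y ≤ y → a1 y = 0
  r2 : ∀ y, 4*Y ≤ y → a2 y = 0

lemma zero_to_right {g : ℝ → ℝ} {Y : ℝ} (hc : ContinuousAt g Y) (h : ∀ y, Y < y → g y = 0) : g Y = 0 := by
  have h1 : Filter.Tendsto g (nhdsWithin Y (Set.Ioi Y)) (nhds (g Y)) := hc.mono_left nhdsWithin_le_nhds
  have h2 : Filter.Tendsto g (nhdsWithin Y (Set.Ioi Y)) (nhds 0) := by
    refine tendsto_const_nhds.congr' ?_
    filter_upwards [self_mem_nhdsWithin] with y hy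
    exact (h y hy).symm
  exact tendsto_nhds_unique h1 h2

lemma deriv_zero_right {g g1 : ℝ → ℝ} {Y : ℝ} (hd : ∀ y, HasDerivAt g (g1 y) y) (hc : Continuous g1)
    (h : ∀ y, Y ≤ y → g y = 0) : ∀ y, Y ≤ y → g1 y = 0 := by
  have h1 : ∀ y, Y < y → g1 y = 0 := by
    intro y hy
    have e : g =ᶠ[nhds y] fun _ => 0 := by
      filter_upwards [Ioi_mem_nhds hy] with z hz'; exact h z (le_of_lt hz')
    exact (hd y).unique ((hasDerivAt_const y (0:ℝ)).congr_of_eventuallyEq e)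
  intro y hy
  rcases hy.eq_or_lt with rfl | hy
  · exact zero_to_right hc.continuousAt h1
  · exact h1 y hy

lemma blk_exists : ∃ A : ℝ, 1 ≤ A ∧ (∀ G Y : ℝ, 1 < Y → ∃ f1 f2, GSym A Y (fun y => ss (y/Y) * a0 G y) f1 f2) ∧
    ∀ G Y : ℝ, 1 < Y → ∃ a1 a2, Blk A Y (fun y => ss (y/Y) * a0 G y - ss (y/(2*Y)) * a0 G y) a1 a2 := by
  obtain ⟨A, hA, h⟩ := gsym_aY
  have hmono : ∀ {Y f f1 f2}, GSym A Y f f1 f2 → GSym (A+A) Y f f1 f2 := by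
    intro Y f f1 f2 g
    exact { d1 := g.d1, d2 := g.d2, c2 := g.c2, z0 := g.z0, z1 := g.z1, z2 := g.z2
            b0 := fun y hy => (g.b0 y hy).trans (by have : 0 < y := by linarith
                                                    gcongr; linarith)
            b1 := fun y hy => (g.b1 y hy).trans (by have : 0 < y := by linarith
                                                    gcongr; linarith)
            b2 := fun y hy => (g.b2 y hy).trans (by have : 0 < y := by linarith
                                                    gcongr; linarith) }
  refine ⟨A+A, by linarith, ?_, ?_⟩
  · intro G Y hY
    obtain ⟨f1, f2, hf⟩ := h G Y hY
    exact ⟨f1, f2, hmono hf⟩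
  · intro G Y hY
    obtain ⟨f1, f2, hf⟩ := h G Y hY
    obtain ⟨g1, g2, hg⟩ := h G (2*Y) (by linarith)
    have hs := hf.sub hg (by linarith)
    have z : ∀ y, 4*Y ≤ y → ss (y/Y) * a0 G y - ss (y/(2*Y)) * a0 G y = 0 := by
      intro y hy
      rw [ss_one, ss_one]
      · ring
      · rw [le_div_iff₀ (by linarith)]; linarith
      · rw [le_div_iff₀ (by linarith)]; linarith
    have c1 := continuous_iff_continuousAt.2 fun y => (hs.d2 y).continuousAt
    have r1 := deriv_zero_right hs.d1 c1 z
    have r2 := deriv_zero_right hs.d2 hs.c2 r1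
    exact ⟨_, _, ⟨hs, hY, z, r1, r2⟩⟩

noncomputable def bb (N t : ℝ) (a a1 : ℝ → ℝ) (y : ℝ) : ℂ :=
  ((a y + a1 y / N : ℝ) : ℂ) + Complex.I * (t * (a y /((y^2-1/4)*N)) : ℝ)

noncomputable def GG (N t : ℝ) (a a1 : ℝ → ℝ) (y : ℝ) : ℂ := bb N t a a1 y * ph t y

noncomputable def Sb (N : ℝ) (H : ℕ) (a a1 : ℝ → ℝ) (t : ℝ) : ℂ := ∫ y, GG N t a a1 y * (CC N H y : ℂ)

lemma GG_eq (N t : ℝ) (a a1 : ℝ → ℝ) (y : ℝ) : GG N t a a1 y = (a y : ℂ) * ph t y + G1 t a a1 y / N := by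
  unfold GG bb G1; push_cast
  simp only [div_eq_mul_inv, mul_inv]; ring

lemma Blk.GG_cont {A Y a a1 a2} (h : Blk A Y a a1 a2) (N t : ℝ) : Continuous (GG N t a a1) := by
  have c0 : Continuous fun y => (a y : ℂ) * ph t y := continuous_iff_continuousAt.2 fun y => (h.F_d1 h.hY t y).continuousAt
  have c1 : Continuous (G1 t a a1) := continuous_iff_continuousAt.2 fun y => (h.F_d2 h.hY t y).continuousAt
  have : GG N t a a1 = fun y => (a y : ℂ) * ph t y + G1 t a a1 y / N := by ext y; exact GG_eq N t a a1 y
  rw [this]; fun_prop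

lemma Blk.GG_zl {A Y a a1 a2} (h : Blk A Y a a1 a2) (N t : ℝ) {y : ℝ} (hy : y ≤ Y) : GG N t a a1 y = 0 := by
  simp [GG, bb, h.z0 y hy, h.z1 y hy]

lemma Blk.GG_zr {A Y a a1 a2} (h : Blk A Y a a1 a2) (N t : ℝ) {y : ℝ} (hy : 4*Y ≤ y) : GG N t a a1 y = 0 := by
  simp [GG, bb, h.r0 y hy, h.r1 y hy]

lemma int_full {g : ℝ → ℂ} {a b : ℝ} (hab : a ≤ b) (hl : ∀ y, y ≤ a → g y = 0) (hr : ∀ y, b ≤ y → g y = 0) :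
    ∫ y, g y = ∫ y in a..b, g y := by
  rw [intervalIntegral.integral_of_le hab]
  symm
  apply setIntegral_eq_integral_of_forall_compl_eq_zero
  intro y hy
  rw [Set.mem_Ioc, not_and_or, not_lt, not_le] at hy
  rcases hy with hy | hy
  · exact hl y hy
  · exact hr y hy.le

lemma alt_one (H : ℕ) : ‖∑ h ∈ Finset.Icc 1 H, (-1:ℂ)^h‖ ≤ 1 := by
  have : ∑ h ∈ Finset.Icc 1 H, (-1:ℂ)^h = 0 ∨ ∑ h ∈ Finset.Icc 1 H, (-1:ℂ)^h = -1 := by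
    induction H with
    | zero => simp
    | succ n ih =>
      have h2 : ∑ h ∈ Finset.Icc 1 n, (-1:ℂ)^h = ((-1:ℂ)^n - 1)/2 := by
        clear ih
        induction n with
        | zero => simp
        | succ n ih => rw [Finset.sum_Icc_succ_top (by omega), ih, pow_succ]; ring
      rw [Finset.sum_Icc_succ_top (by omega), h2, pow_succ]
      rcases neg_one_pow_eq_or ℂ n with h | h <;> rw [h] <;> norm_num
  rcases this with h | h <;> rw [h] <;> simp

lemma Blk.sum_eq {A Y a a1 a2} (hb : Blk A Y a a1 a2) {N : ℝ} (hN : 0 < N) (X H : ℕ) (hHX : H ≤ X)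
    (hX : 4*Y*H ≤ X - H) (t : ℝ) :
    ‖∑ h ∈ Finset.Icc 1 H, (-1:ℂ)^h * ∑ n ∈ Finset.Icc 1 (X-h), (1/(h:ℂ)) * ((a (n/h+1/2) : ℂ) * ph t (n/h + 1/2))‖
     ≤ ‖Sb N H a a1 t‖ + 3*A := by
  have hY := hb.hY
  set F : ℝ → ℂ := fun y => (a y : ℂ) * ph t y with hF
  have hd := hb.F_d1 hY t
  have c1 : Continuous (G1 t a a1) := continuous_iff_continuousAt.2 fun y => (hb.F_d2 hY t y).continuousAt
  have fc : Continuous F := continuous_iff_continuousAt.2 fun y => (hd y).continuousAt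
  have hGc := hb.GG_cont N t
  have hle : Y ≤ 4*Y := by linarith
  have key : ∀ h ∈ Finset.Icc 1 H, ∑ n ∈ Finset.Icc 1 (X-h), (1/(h:ℂ)) * F (n/h+1/2) = ∫ y in Y..(4*Y), GG N t a a1 y * kap N h y := by
    intro h hh
    rw [Finset.mem_Icc] at hh
    have h0 : (0:ℝ) < h := by exact_mod_cast hh.1
    have h1 : (1:ℝ) ≤ h := by exact_mod_cast hh.1
    have hhH : (h:ℝ) ≤ H := by exact_mod_cast hh.2
    have hbig : 4*Y ≤ ((X-h+1:ℕ):ℝ)/h+1/2 := by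
      have : 4*Y ≤ ((X-h+1:ℕ):ℝ)/h := by
        rw [le_div_iff₀ h0]
        have e : ((X-h+1:ℕ):ℝ) = X - h + 1 := by push_cast [Nat.cast_sub (show h ≤ X by omega)]; ring
        rw [e]
        nlinarith
      linarith
    have z0 : F (1/2) = 0 := by simp only [hF]; rw [hb.z0 (1/2) (by linarith)]; simp
    have zK : F (((X-h+1:ℕ):ℝ)/h+1/2) = 0 := by simp only [hF]; rw [hb.r0 _ hbig]; simp
    have := kap_sum hN hh.1 hd c1 (X-h+1) (by rw [show (a (((X-h+1:ℕ):ℝ)/h+1/2) : ℂ) * ph t (((X-h+1:ℕ):ℝ)/h+1/2) = 0 from zK]; exact z0.symm)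
    rw [Finset.sum_range_succ'] at this
    have e0 : ∑ n ∈ Finset.Icc 1 (X-h), (1/(h:ℂ)) * F (n/h+1/2) = ∑ k ∈ Finset.range (X-h), (1/(h:ℂ)) * F ((k+1:ℕ)/h + 1/2) := by
      rw [Finset.range_eq_Ico, Finset.sum_Ico_add' (fun n : ℕ => (1/(h:ℂ)) * F ((n:ℕ)/h + 1/2)) 0 _ 1]
      rfl
    rw [e0]
    have e1 : (1/(h:ℂ)) * ((a (((0:ℕ):ℝ)/h+1/2):ℂ) * ph t (((0:ℕ):ℝ)/h+1/2)) = 0 := by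
      have : ((0:ℕ):ℝ)/h+1/2 = 1/2 := by simp
      rw [this]; change _ * F (1/2) = 0; rw [z0, mul_zero]
    rw [e1, add_zero] at this
    rw [← this]
    have e2 : ∀ z, ((a z : ℂ) * ph t z + G1 t a a1 z / N) * (kap N h z:ℂ) = GG N t a a1 z * kap N h z := by
      intro z; rw [GG_eq]
    simp only [e2]
    rw [← int_full (a := 1/2), ← int_full (a := Y)]
    · linarith
    · intro y hy; rw [hb.GG_zl N t hy]; simp
    · intro y hy; rw [hb.GG_zr N t hy]; simp
    · have : 0 ≤ ((X-h+1:ℕ):ℝ)/h := by positivity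
      linarith
    · intro y hy; rw [hb.GG_zl N t (by linarith)]; simp
    · intro y hy; rw [hb.GG_zr N t (by linarith)]; simp
  have hF1 : ∫ y in Y..(4*Y), GG N t a a1 y = ∫ y in Y..(4*Y), F y := by
    have : ∫ y in Y..(4*Y), G1 t a a1 y = 0 := by
      rw [intervalIntegral.integral_eq_sub_of_hasDerivAt (fun y _ => hd y) (c1.intervalIntegrable _ _)]
      rw [hb.r0 (4*Y) le_rfl, hb.z0 Y le_rfl]; simp
    simp only [GG_eq]
    rw [intervalIntegral.integral_add (fc.intervalIntegrable _ _) ((c1.div_const _).intervalIntegrable _ _),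
      intervalIntegral.integral_div, this]; simp
  have hS : Sb N H a a1 t = ∑ h ∈ Finset.Icc 1 H, (-1:ℂ)^h * ((∫ y in Y..(4*Y), GG N t a a1 y * kap N h y) - ∫ y in Y..(4*Y), F y) := by
    unfold Sb
    rw [int_full (a := Y) (b := 4*Y) hle]
    · rw [← hF1]
      have : ∀ h ∈ Finset.Icc 1 H, (-1:ℂ)^h * ((∫ y in Y..(4*Y), GG N t a a1 y * kap N h y) - ∫ y in Y..(4*Y), GG N t a a1 y) =
          ∫ y in Y..(4*Y), (-1:ℂ)^h * (GG N t a a1 y * kap N h y - GG N t a a1 y) := by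
        intro h hh
        rw [intervalIntegral.integral_const_mul, intervalIntegral.integral_sub (kap_ii hN (Finset.mem_Icc.1 hh).1 hGc _ _) (hGc.intervalIntegrable _ _)]
      rw [Finset.sum_congr rfl this, ← intervalIntegral.integral_finsetSum]
      · congr 1; ext z; unfold CC
        push_cast
        rw [Finset.mul_sum]
        refine Finset.sum_congr rfl fun h _ => ?_
        ring
      · intro h hh
        exact ((kap_ii hN (Finset.mem_Icc.1 hh).1 hGc _ _).sub (hGc.intervalIntegrable _ _)).const_mul _
    · intro y hy; rw [hb.GG_zl N t hy]; simp
    · intro y hy; rw [hb.GG_zr N t hy]; simp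
  change ‖∑ h ∈ Finset.Icc 1 H, (-1:ℂ)^h * ∑ n ∈ Finset.Icc 1 (X-h), (1/(h:ℂ)) * F (n/h+1/2)‖ ≤ _
  have e : ∑ h ∈ Finset.Icc 1 H, (-1:ℂ)^h * ∑ n ∈ Finset.Icc 1 (X-h), (1/(h:ℂ)) * F (n/h+1/2) =
     Sb N H a a1 t + (∑ h ∈ Finset.Icc 1 H, (-1:ℂ)^h) * ∫ y in Y..(4*Y), F y := by
    rw [hS, Finset.sum_mul, ← Finset.sum_add_distrib]
    refine Finset.sum_congr rfl fun h hh => ?_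
    rw [key h hh]; ring
  rw [e]
  refine (norm_add_le _ _).trans ?_
  gcongr
  rw [norm_mul]
  have hA := hb.nonneg
  have i1 : ‖∫ y in Y..(4*Y), F y‖ ≤ (A/Y) * |4*Y - Y| := by
    apply intervalIntegral.norm_integral_le_of_norm_le_const
    intro y hy
    rw [Set.uIoc_of_le hle] at hy
    have := hb.b0 y (by linarith [hy.1])
    have h2 : A/y ≤ A/Y := by
      have := hy.1
      gcongr
    simp only [hF, norm_mul, ph_norm, mul_one, Complex.norm_real, Real.norm_eq_abs]
    linarith
  rw [abs_of_nonneg (by linarith)] at i1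
  have e3 : A/Y * (4*Y-Y) = 3*A := by field_simp; ring
  rw [e3] at i1
  have := alt_one H
  nlinarith [norm_nonneg (∫ y in Y..(4*Y), F y)]

end TM

namespace TM

lemma abs_div_q {x ν : ℝ} (hν : 0 < ν) : |x|/(x^2+ν^2) ≤ 1/(2*ν) := by
  rw [div_le_div_iff₀ (by positivity) (by positivity)]
  have : |x|^2 = x^2 := sq_abs x
  nlinarith [sq_nonneg (|x| - ν)]

lemma vdc {α β σ ν K B0 B1 : ℝ} {φ φ1 φ2 : ℝ → ℝ} {B B' : ℝ → ℂ} (hαβ : α ≤ β) (hσ : σ = 1 ∨ σ = -1) (hν : 0 < ν)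
    (hK : 0 ≤ K)
    (d1 : ∀ y ∈ Set.Icc α β, HasDerivAt φ (φ1 y) y) (d2 : ∀ y ∈ Set.Icc α β, HasDerivAt φ1 (φ2 y) y)
    (c2 : ContinuousOn φ2 (Set.Icc α β))
    (hl : ∀ y ∈ Set.Icc α β, ν^2 ≤ σ * φ2 y + K * |φ1 y|)
    (dB : ∀ y ∈ Set.Icc α β, HasDerivAt B (B' y) y) (cB : ContinuousOn B' (Set.Icc α β))
    (zα : B α = 0) (zβ : B β = 0)
    (hB0 : ∀ y ∈ Set.Icc α β, ‖B y‖ ≤ B0) (hB1 : ∀ y ∈ Set.Icc α β, ‖B' y‖ ≤ B1) :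
    ‖∫ y in α..β, B y * Complex.exp (Complex.I * (φ y : ℝ))‖ ≤
      (1/ν) * (B1*(β-α)/2 + B0*(2*π + 3/2*K*(β-α))) := by
  have hI : Set.uIcc α β = Set.Icc α β := Set.uIcc_of_le hαβ
  have hB0' : 0 ≤ B0 := (norm_nonneg _).trans (hB0 α ⟨le_rfl, hαβ⟩)
  have cφ : ContinuousOn φ (Set.Icc α β) := fun y hy => (d1 y hy).continuousAt.continuousWithinAt
  have cφ1 : ContinuousOn φ1 (Set.Icc α β) := fun y hy => (d2 y hy).continuousAt.continuousWithinAt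
  have cBB : ContinuousOn B (Set.Icc α β) := fun y hy => (dB y hy).continuousAt.continuousWithinAt
  set q : ℝ → ℝ := fun y => φ1 y^2 + ν^2 with hq
  have q0 : ∀ y, 0 < q y := fun y => by simp only [hq]; positivity
  set E : ℝ → ℂ := fun y => Complex.exp (Complex.I * (φ y : ℝ)) with hE
  have En : ∀ y, ‖E y‖ = 1 := by
    intro y; simp only [hE]; rw [mul_comm]; exact Complex.norm_exp_ofReal_mul_I _
  have cE : ContinuousOn E (Set.Icc α β) := by
    simp only [hE]; fun_prop
  set R : ℝ → ℂ := fun y => B' y * (φ1 y/q y : ℝ) + B y * (φ2 y * (ν^2 - φ1 y^2)/q y^2 : ℝ) with hR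
  set W' : ℝ → ℂ := fun y => (-Complex.I) * (R y * E y) + B y * (φ1 y^2/q y:ℝ) * E y with hW'
  have dW : ∀ y ∈ Set.uIcc α β, HasDerivAt (fun y => (-Complex.I) * ((B y * (φ1 y / q y : ℝ)) * E y)) (W' y) y := by
    intro y hy
    rw [hI] at hy
    have e1 : HasDerivAt (fun y => φ1 y / q y) (φ2 y * (ν^2 - φ1 y^2)/q y^2) y := by
      have := (d2 y hy).fun_div (((d2 y hy).fun_pow 2).add_const (ν^2)) (q0 y).ne'
      refine this.congr_deriv ?_
      congr 1
      simp; ring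
    have e2 : HasDerivAt E (E y * (Complex.I * (φ1 y:ℝ))) y :=
      ((d1 y hy).ofReal_comp.const_mul Complex.I).cexp
    have := (((dB y hy).fun_mul e1.ofReal_comp).fun_mul e2).const_mul (-Complex.I)
    refine this.congr_deriv ?_
    simp only [hW', hR]
    have : Complex.I^2 = -1 := Complex.I_sq
    have hqy := (q0 y).ne'
    push_cast
    linear_combination (-(B y * (φ1 y)^2 / q y * E y)) * this
  have cq : ContinuousOn q (Set.Icc α β) := by simp only [hq]; fun_prop
  have cR : ContinuousOn R (Set.Icc α β) := by
    simp only [hR]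
    refine (cB.mul ?_).add (cBB.mul ?_)
    · exact Complex.continuous_ofReal.comp_continuousOn (cφ1.div cq fun y _ => (q0 y).ne')
    · refine Complex.continuous_ofReal.comp_continuousOn (ContinuousOn.div ?_ (cq.pow 2) fun y _ => pow_ne_zero 2 (q0 y).ne')
      fun_prop
  have cW' : ContinuousOn W' (Set.Icc α β) := by
    simp only [hW']
    refine (continuousOn_const.mul (cR.mul cE)).add ((cBB.mul ?_).mul cE)
    exact Complex.continuous_ofReal.comp_continuousOn ((cφ1.pow 2).div cq fun y _ => (q0 y).ne')
  have iW : IntervalIntegrable W' volume α β := by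
    apply ContinuousOn.intervalIntegrable; rwa [hI]
  have zW : ∫ y in α..β, W' y = 0 := by
    rw [intervalIntegral.integral_eq_sub_of_hasDerivAt dW iW, zα, zβ]; simp
  have iBE : IntervalIntegrable (fun y => B y * E y) volume α β := by
    apply ContinuousOn.intervalIntegrable; rw [hI]; exact cBB.mul cE
  have e : ∫ y in α..β, B y * E y = ∫ y in α..β, (B y * E y - W' y) := by
    rw [intervalIntegral.integral_sub iBE iW, zW, sub_zero]
  change ‖∫ y in α..β, B y * E y‖ ≤ _
  rw [e]
  have iA : IntervalIntegrable (fun y => (B1/(2*ν) + B0*(3/2*K/ν)) + 2*B0*σ*(φ2 y/q y)) volume α β := by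
    apply ContinuousOn.intervalIntegrable; rw [hI]
    exact continuousOn_const.add (continuousOn_const.mul (c2.div cq fun y _ => (q0 y).ne'))
  have pw : ∀ y ∈ Set.Icc α β, ‖B y * E y - W' y‖ ≤ (B1/(2*ν) + B0*(3/2*K/ν)) + 2*B0*σ*(φ2 y/q y) := by
    intro y hy
    have hqy := q0 y
    have e1 : B y * E y - W' y = (B y * (ν^2/q y : ℝ) + Complex.I * R y) * E y := by
      have : (1:ℂ) = ((φ1 y^2/q y:ℝ):ℂ) + ((ν^2/q y:ℝ):ℂ) := by
        rw [← Complex.ofReal_add, ← add_div, div_self hqy.ne', Complex.ofReal_one]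
      simp only [hW']
      linear_combination (B y * E y) * this
    rw [e1, norm_mul, En, mul_one]
    have n1 : ‖B y * (ν^2/q y : ℝ)‖ ≤ B0 * (ν^2/q y) := by
      rw [norm_mul, Complex.norm_real, Real.norm_eq_abs, abs_of_nonneg (by positivity)]
      exact mul_le_mul_of_nonneg_right (hB0 y hy) (by positivity)
    have hx := abs_div_q (x := φ1 y) hν
    have n2 : ‖B' y * (φ1 y/q y : ℝ)‖ ≤ B1 * (1/(2*ν)) := by
      rw [norm_mul, Complex.norm_real, Real.norm_eq_abs, abs_div, abs_of_pos hqy]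
      exact mul_le_mul (hB1 y hy) hx (by positivity) ((norm_nonneg _).trans (hB1 y hy))
    have n3 : ‖B y * (φ2 y * (ν^2 - φ1 y^2)/q y^2 : ℝ)‖ ≤ B0 * (|φ2 y|/q y) := by
      rw [norm_mul, Complex.norm_real, Real.norm_eq_abs, abs_div, abs_mul, abs_of_pos (pow_pos hqy 2)]
      refine mul_le_mul (hB0 y hy) ?_ (by positivity) hB0'
      rw [div_le_div_iff₀ (by positivity) hqy]
      have : |ν^2 - φ1 y^2| ≤ q y := by
        simp only [hq]; rw [abs_le]; constructor <;> nlinarith [sq_nonneg ν, sq_nonneg (φ1 y)]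
      calc |φ2 y| * |ν^2 - φ1 y^2| * q y ≤ |φ2 y| * q y * q y := by gcongr
        _ = _ := by ring
    have n4 : ‖B y * (ν^2/q y : ℝ) + Complex.I * R y‖ ≤ B0 * (ν^2/q y) + (B1 * (1/(2*ν)) + B0 * (|φ2 y|/q y)) := by
      refine (norm_add_le _ _).trans (add_le_add n1 ?_)
      rw [norm_mul, Complex.norm_I, one_mul]
      exact (norm_add_le _ _).trans (add_le_add n2 n3)
    refine n4.trans ?_
    have m1 : ν^2 + |φ2 y| ≤ 2*σ*φ2 y + 3*K*|φ1 y| := by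
      have := hl y hy
      have hn : 0 ≤ ν^2 := by positivity
      have hn2 : 0 ≤ K*|φ1 y| := by positivity
      rcases hσ with rfl | rfl
      · rcases abs_cases (φ2 y) with ⟨h, _⟩ | ⟨h, _⟩ <;> rw [h] <;> linarith
      · rcases abs_cases (φ2 y) with ⟨h, _⟩ | ⟨h, _⟩ <;> rw [h] <;> linarith
    have m2 : ν^2/q y + |φ2 y|/q y ≤ 2*σ*(φ2 y/q y) + 3*K*(1/(2*ν)) := by
      calc ν^2/q y + |φ2 y|/q y = (ν^2 + |φ2 y|)/q y := by ring
        _ ≤ (2*σ*φ2 y + 3*K*|φ1 y|)/q y := by gcongr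
        _ = 2*σ*(φ2 y/q y) + 3*K*(|φ1 y|/q y) := by ring
        _ ≤ _ := by gcongr
    have := mul_le_mul_of_nonneg_left m2 hB0'
    have e3 : B0 * (2*σ*(φ2 y/q y) + 3*K*(1/(2*ν))) = 2*B0*σ*(φ2 y/q y) + B0*(3/2*K/ν) := by
      field_simp
    rw [e3] at this
    have e4 : B1 * (1/(2*ν)) = B1/(2*ν) := by ring
    rw [e4]
    linarith
  have h1 := intervalIntegral.norm_integral_le_of_norm_le hαβ (μ := volume) (f := fun y => B y * E y - W' y) (Filter.Eventually.of_forall fun y hy => pw y ⟨hy.1.le, hy.2⟩) iA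
  refine h1.trans ?_
  have darc : ∀ y ∈ Set.uIcc α β, HasDerivAt (fun y => (1/ν) * Real.arctan (φ1 y/ν)) (φ2 y/q y) y := by
    intro y hy
    rw [hI] at hy
    have := (((d2 y hy).div_const ν).arctan).const_mul (1/ν)
    refine this.congr_deriv ?_
    simp only [hq]
    have : ν^2 + φ1 y^2 ≠ 0 := by positivity
    have : φ1 y^2 + ν^2 ≠ 0 := by positivity
    field_simp
    ring
  have iq : IntervalIntegrable (fun y => φ2 y/q y) volume α β := by
    apply ContinuousOn.intervalIntegrable; rw [hI]; exact c2.div cq fun y _ => (q0 y).ne'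
  rw [intervalIntegral.integral_add (by simp) (iq.const_mul _), intervalIntegral.integral_const, intervalIntegral.integral_const_mul,
    intervalIntegral.integral_eq_sub_of_hasDerivAt darc iq]
  have a1 := Real.arctan_lt_pi_div_two (φ1 β/ν)
  have a2 := Real.neg_pi_div_two_lt_arctan (φ1 β/ν)
  have a3 := Real.arctan_lt_pi_div_two (φ1 α/ν)
  have a4 := Real.neg_pi_div_two_lt_arctan (φ1 α/ν)
  have a5 : σ * (Real.arctan (φ1 β/ν) - Real.arctan (φ1 α/ν)) ≤ π := by
    rcases hσ with rfl | rfl <;> linarith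
  have a6 : 2*B0*σ*(1/ν * Real.arctan (φ1 β/ν) - 1/ν * Real.arctan (φ1 α/ν)) ≤ 2*B0*(1/ν)*π := by
    calc _ = 2*B0*(1/ν) * (σ * (Real.arctan (φ1 β/ν) - Real.arctan (φ1 α/ν))) := by ring
      _ ≤ _ := by gcongr
  rw [smul_eq_mul]
  calc _ ≤ (β - α) * (B1 / (2 * ν) + B0 * (3 / 2 * K / ν)) + 2*B0*(1/ν)*π := by linarith
    _ = _ := by field_simp; ring

lemma ibp0 {α β τ B0 B1 P0 P1 : ℝ} {φ p p1 : ℝ → ℝ} {B B' : ℝ → ℂ} (hαβ : α ≤ β) (hτ : τ ≠ 0)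
    (hp : ∀ y ∈ Set.Icc α β, 0 < p y)
    (d1 : ∀ y ∈ Set.Icc α β, HasDerivAt φ (τ/p y) y) (dp : ∀ y ∈ Set.Icc α β, HasDerivAt p (p1 y) y)
    (cp : ContinuousOn p1 (Set.Icc α β))
    (dB : ∀ y ∈ Set.Icc α β, HasDerivAt B (B' y) y) (cB : ContinuousOn B' (Set.Icc α β))
    (zα : B α = 0) (zβ : B β = 0)
    (hB0 : ∀ y ∈ Set.Icc α β, ‖B y‖ ≤ B0) (hB1 : ∀ y ∈ Set.Icc α β, ‖B' y‖ ≤ B1)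
    (hP0 : ∀ y ∈ Set.Icc α β, |p y| ≤ P0) (hP1 : ∀ y ∈ Set.Icc α β, |p1 y| ≤ P1) :
    ‖∫ y in α..β, B y * Complex.exp (Complex.I * (φ y : ℝ))‖ ≤ (B1*P0 + B0*P1)*(β-α)/|τ| := by
  have hI : Set.uIcc α β = Set.Icc α β := Set.uIcc_of_le hαβ
  have hB0' : 0 ≤ B0 := (norm_nonneg _).trans (hB0 α ⟨le_rfl, hαβ⟩)
  have hB1' : 0 ≤ B1 := (norm_nonneg _).trans (hB1 α ⟨le_rfl, hαβ⟩)
  have cφ : ContinuousOn φ (Set.Icc α β) := fun y hy => (d1 y hy).continuousAt.continuousWithinAt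
  have cpp : ContinuousOn p (Set.Icc α β) := fun y hy => (dp y hy).continuousAt.continuousWithinAt
  have cBB : ContinuousOn B (Set.Icc α β) := fun y hy => (dB y hy).continuousAt.continuousWithinAt
  have hτc : (τ:ℂ) ≠ 0 := by exact_mod_cast hτ
  set E : ℝ → ℂ := fun y => Complex.exp (Complex.I * (φ y : ℝ)) with hE
  have En : ∀ y, ‖E y‖ = 1 := by
    intro y; simp only [hE]; rw [mul_comm]; exact Complex.norm_exp_ofReal_mul_I _
  have cE : ContinuousOn E (Set.Icc α β) := by
    simp only [hE]; fun_prop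
  set R : ℝ → ℂ := fun y => B' y * (p y : ℝ) + B y * (p1 y : ℝ) with hR
  have cR : ContinuousOn R (Set.Icc α β) := by
    simp only [hR]
    exact (cB.mul (Complex.continuous_ofReal.comp_continuousOn cpp)).add (cBB.mul (Complex.continuous_ofReal.comp_continuousOn cp))
  have dW : ∀ y ∈ Set.uIcc α β, HasDerivAt (fun y => (-Complex.I/τ) * ((B y * (p y : ℝ)) * E y)) ((-Complex.I/τ) * (R y * E y) + B y * E y) y := by
    intro y hy
    rw [hI] at hy
    have e2 : HasDerivAt E (E y * (Complex.I * (τ/p y:ℝ))) y :=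
      ((d1 y hy).ofReal_comp.const_mul Complex.I).cexp
    have := (((dB y hy).fun_mul (dp y hy).ofReal_comp).fun_mul e2).const_mul (-Complex.I/τ)
    refine this.congr_deriv ?_
    simp only [hR]
    have h2 : Complex.I^2 = -1 := Complex.I_sq
    have hpc : (p y:ℂ) ≠ 0 := by exact_mod_cast (hp y hy).ne'
    push_cast
    have e5 : (-Complex.I/τ) * (B y * p y * (E y * (Complex.I * (τ/p y)))) = -(Complex.I^2) * (B y * E y) := by
      field_simp
    linear_combination e5 - (B y * E y) * h2
  have iR : IntervalIntegrable (fun y => (-Complex.I/τ) * (R y * E y)) volume α β := by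
    apply ContinuousOn.intervalIntegrable; rw [hI]; exact continuousOn_const.mul (cR.mul cE)
  have iBE : IntervalIntegrable (fun y => B y * E y) volume α β := by
    apply ContinuousOn.intervalIntegrable; rw [hI]; exact cBB.mul cE
  have key := intervalIntegral.integral_eq_sub_of_hasDerivAt dW (iR.add iBE)
  rw [intervalIntegral.integral_add iR iBE, zα, zβ] at key
  have e : ∫ y in α..β, B y * E y = - ∫ y in α..β, (-Complex.I/τ) * (R y * E y) := by
    have k2 : (∫ y in α..β, (-Complex.I/τ) * (R y * E y)) + ∫ y in α..β, B y * E y = 0 := by rw [key]; simp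
    linear_combination k2
  change ‖∫ y in α..β, B y * E y‖ ≤ _
  rw [e, norm_neg]
  have h1 := intervalIntegral.norm_integral_le_of_norm_le_const (a := α) (b := β) (f := fun y => (-Complex.I/τ) * (R y * E y)) (C := (B1*P0 + B0*P1)/|τ|) (by
    intro y hy
    rw [Set.uIoc_of_le hαβ] at hy
    have hy' : y ∈ Set.Icc α β := ⟨hy.1.le, hy.2⟩
    rw [norm_mul, norm_mul, En, mul_one, norm_div, norm_neg, Complex.norm_I, Complex.norm_real, Real.norm_eq_abs, div_mul_eq_mul_div, one_mul]
    gcongr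
    refine (norm_add_le _ _).trans ?_
    rw [norm_mul, norm_mul, Complex.norm_real, Complex.norm_real, Real.norm_eq_abs, Real.norm_eq_abs]
    exact add_le_add (mul_le_mul (hB1 y hy') (hP0 y hy') (abs_nonneg _) hB1') (mul_le_mul (hB0 y hy') (hP1 y hy') (abs_nonneg _) hB0'))
  refine h1.trans (le_of_eq ?_)
  rw [abs_of_nonneg (by linarith : 0 ≤ β - α)]; ring

end TM

namespace TM

noncomputable def bb1 (N t : ℝ) (a a1 a2 : ℝ → ℝ) (y : ℝ) : ℂ :=
  ((a1 y + a2 y/N : ℝ) : ℂ) + Complex.I * (t * ((a1 y * ((y^2-1/4)*N) - a y * (2*y*N))/((y^2-1/4)*N)^2) : ℝ)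

lemma Blk.bb_d {A Y a a1 a2} (h : Blk A Y a a1 a2) {N : ℝ} (hN : 0 < N) (t : ℝ) {y : ℝ} (hy : 1 ≤ y) :
    HasDerivAt (bb N t a a1) (bb1 N t a a1 a2 y) y := by
  have e1 := ((h.d1 y).fun_add ((h.d2 y).div_const N)).ofReal_comp
  have hp : (y^2-1/4)*N ≠ 0 := (mul_pos (p_pos hy) hN).ne'
  have d0 : HasDerivAt (fun y : ℝ => (y^2-1/4)*N) (2*y*N) y := by
    have := (((hasDerivAt_id y).fun_pow 2).sub_const (1/4)).mul_const N
    refine this.congr_deriv ?_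
    simp
  have e2 := ((((h.d1 y).fun_div d0 hp).const_mul t).ofReal_comp).const_mul Complex.I
  exact e1.fun_add e2

lemma Blk.bb1_c {A Y a a1 a2} (h : Blk A Y a a1 a2) {N : ℝ} (hN : 0 < N) (t : ℝ) :
    ContinuousOn (bb1 N t a a1 a2) (Set.Ici 1) := by
  have c0 : Continuous a := continuous_iff_continuousAt.2 fun y => (h.d1 y).continuousAt
  have c1 : Continuous a1 := continuous_iff_continuousAt.2 fun y => (h.d2 y).continuousAt
  have c2 : Continuous a2 := h.c2
  unfold bb1
  refine ContinuousOn.add (by fun_prop) (continuousOn_const.mul (Complex.continuous_ofReal.comp_continuousOn (continuousOn_const.mul (ContinuousOn.div (by fun_prop) (by fun_prop) ?_))))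
  intro y hy
  exact pow_ne_zero 2 (mul_pos (p_pos hy) hN).ne'

lemma Blk.bb_b {A Y a a1 a2} (h : Blk A Y a a1 a2) {T t : ℝ} (hT : Y^2 ≤ T) (ht : t ∈ Set.Icc T (2*T)) {y : ℝ} (hy : Y ≤ y) :
    ‖bb (T/Y^2) t a a1 y‖ ≤ 5*A/Y := by
  have hY := h.hY
  have hY0 : 0 < Y := by linarith
  have hT0 : 0 < T := by nlinarith
  have hA := h.toGSym.nonneg
  have hy1 : 1 ≤ y := by linarith
  have hy0 : 0 < y := by linarith
  have b0 : |a y| ≤ A/Y := (h.b0 y hy1).trans (by gcongr)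
  have b1 : |a1 y| ≤ A/Y^2 := (h.b1 y hy1).trans (by gcongr)
  have hp := p_lower hy1
  have hpp : 3/4*Y^2 ≤ y^2-1/4 := le_trans (by gcongr) hp
  unfold bb
  refine (norm_add_le _ _).trans ?_
  rw [norm_mul, Complex.norm_I, one_mul, Complex.norm_real, Complex.norm_real, Real.norm_eq_abs, Real.norm_eq_abs]
  have n1 : |a y + a1 y/(T/Y^2)| ≤ 2*(A/Y) := by
    refine (abs_add_le _ _).trans ?_
    have : |a1 y/(T/Y^2)| ≤ A/Y := by
      rw [abs_div, abs_of_pos (by positivity : 0 < T/Y^2), div_le_iff₀ (by positivity)]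
      refine b1.trans ?_
      have h1 : 1 ≤ T/Y^2 := by rw [le_div_iff₀ (by positivity)]; linarith
      calc A/Y^2 ≤ A/Y := by
            gcongr; nlinarith
        _ = A/Y*1 := by ring
        _ ≤ _ := by gcongr
    linarith
  have n2 : |t*(a y/((y^2-1/4)*(T/Y^2)))| ≤ 8/3*(A/Y) := by
    have hq : 3/4*T ≤ (y^2-1/4)*(T/Y^2) := by
      calc 3/4*T = 3/4*Y^2*(T/Y^2) := by field_simp
        _ ≤ _ := by gcongr
    rw [abs_mul, abs_div, abs_of_nonneg (by linarith [ht.1] : 0 ≤ t), abs_of_pos (by linarith : 0 < (y^2-1/4)*(T/Y^2))]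
    calc t * (|a y|/((y^2-1/4)*(T/Y^2))) ≤ (2*T) * ((A/Y)/(3/4*T)) := by
          have ht0 : 0 ≤ t := by linarith [ht.1]
          have ht2 := ht.2
          refine mul_le_mul ht2 (div_le_div₀ (by positivity) b0 (by positivity) hq) (div_nonneg (abs_nonneg _) (by linarith)) (by positivity)
      _ = _ := by (field_simp; ring)
  have : 5*A/Y = 5*(A/Y) := by ring
  rw [this]
  have : 0 ≤ A/Y := by positivity
  linarith

lemma Blk.bb1_b {A Y a a1 a2} (h : Blk A Y a a1 a2) {T t : ℝ} (hT : Y^2 ≤ T) (ht : t ∈ Set.Icc T (2*T)) {y : ℝ} (hy : Y ≤ y) :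
    ‖bb1 (T/Y^2) t a a1 a2 y‖ ≤ 12*A/Y^2 := by
  have hY := h.hY
  have hY0 : 0 < Y := by linarith
  have hT0 : 0 < T := by nlinarith
  have hA := h.toGSym.nonneg
  have hy1 : 1 ≤ y := by linarith
  have hy0 : 0 < y := by linarith
  have b0 : |a y| ≤ A/y := (h.b0 y hy1)
  have b1 : |a1 y| ≤ A/Y^2 := (h.b1 y hy1).trans (by gcongr)
  have b2 : |a2 y| ≤ A/Y^3 := (h.b2 y hy1).trans (by gcongr)
  have hp := p_lower hy1
  have hp0 := p_pos hy1
  have hpp : 3/4*Y^2 ≤ y^2-1/4 := le_trans (by gcongr) hp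
  unfold bb1
  refine (norm_add_le _ _).trans ?_
  rw [norm_mul, Complex.norm_I, one_mul, Complex.norm_real, Complex.norm_real, Real.norm_eq_abs, Real.norm_eq_abs]
  have n1 : |a1 y + a2 y/(T/Y^2)| ≤ 2*(A/Y^2) := by
    refine (abs_add_le _ _).trans ?_
    have : |a2 y/(T/Y^2)| ≤ A/Y^2 := by
      rw [abs_div, abs_of_pos (by positivity : 0 < T/Y^2), div_le_iff₀ (by positivity)]
      refine b2.trans ?_
      have h1 : 1 ≤ T/Y^2 := by rw [le_div_iff₀ (by positivity)]; linarith
      calc A/Y^3 ≤ A/Y^2 := by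
            gcongr; nlinarith; norm_num
        _ = A/Y^2*1 := by ring
        _ ≤ _ := by gcongr
    linarith
  have e : t*((a1 y*((y^2-1/4)*(T/Y^2)) - a y*(2*y*(T/Y^2)))/((y^2-1/4)*(T/Y^2))^2) =
      (t/T*Y^2) * (a1 y/(y^2-1/4) - 2*(y*a y)/(y^2-1/4)^2) := by
    field_simp
  have n2 : |t*((a1 y*((y^2-1/4)*(T/Y^2)) - a y*(2*y*(T/Y^2)))/((y^2-1/4)*(T/Y^2))^2)| ≤ 10*(A/Y^2) := by
    have ht0 : 0 ≤ t := hT0.le.trans ht.1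
    rw [e, abs_mul, abs_of_nonneg (by positivity : 0 ≤ t/T*Y^2)]
    have q1 : t/T*Y^2 ≤ 2*Y^2 := by
      have : t/T ≤ 2 := by rw [div_le_iff₀ hT0]; exact ht.2
      gcongr
    have q2 : |a1 y/(y^2-1/4)| ≤ (A/Y^2)/(3/4*Y^2) := by
      rw [abs_div, abs_of_pos hp0]; gcongr
    have q3 : |2*(y*a y)/(y^2-1/4)^2| ≤ 2*A/(3/4*Y^2)^2 := by
      rw [abs_div, abs_of_pos (pow_pos hp0 2), abs_mul, abs_mul, abs_of_pos hy0, abs_of_pos (by norm_num : (0:ℝ) < 2)]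
      gcongr
      rw [le_div_iff₀ hy0] at b0; linarith
    calc _ ≤ (2*Y^2) * ((A/Y^2)/(3/4*Y^2) + 2*A/(3/4*Y^2)^2) := by
          refine mul_le_mul q1 ((abs_sub _ _).trans (add_le_add q2 q3)) (abs_nonneg _) (by positivity)
      _ = (8/3+64/9)*(A/Y^2) := by (field_simp; ring)
      _ ≤ _ := by gcongr; norm_num
  have : 12*A/Y^2 = 12*(A/Y^2) := by ring
  rw [this]
  linarith

open ComplexConjugate in
lemma ker_eq {N t s : ℝ} {a a1 : ℝ → ℝ} (r y : ℝ) :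
    GG N t a a1 y * conj (GG N s a a1 (y+r)) = (bb N t a a1 y * conj (bb N s a a1 (y+r))) *
      Complex.exp (Complex.I * ((-(t*psi y) + s*psi (y+r) : ℝ):ℂ)) := by
  unfold GG ph
  rw [map_mul, ← Complex.exp_conj]
  simp only [map_neg, map_mul, Complex.conj_I, Complex.conj_ofReal]
  have : Complex.exp (Complex.I * ((-(t*psi y) + s*psi (y+r) : ℝ):ℂ)) =
     Complex.exp (-(Complex.I * ((t*psi y : ℝ):ℂ))) * Complex.exp (-(-Complex.I * ((s*psi (y+r) : ℝ):ℂ))) := by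
    rw [← Complex.exp_add]; congr 1; push_cast; ring
  rw [this]; ring

lemma Blk.bb_zl {A Y a a1 a2} (h : Blk A Y a a1 a2) (N t : ℝ) {y : ℝ} (hy : y ≤ Y) : bb N t a a1 y = 0 := by
  simp [bb, h.z0 y hy, h.z1 y hy]
lemma Blk.bb_zr {A Y a a1 a2} (h : Blk A Y a a1 a2) (N t : ℝ) {y : ℝ} (hy : 4*Y ≤ y) : bb N t a a1 y = 0 := by
  simp [bb, h.r0 y hy, h.r1 y hy]

open ComplexConjugate in
lemma Blk.B_facts {A Y a a1 a2} (h : Blk A Y a a1 a2) {T t s : ℝ} (hT : Y^2 ≤ T) (ht : t ∈ Set.Icc T (2*T))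
    (hs : s ∈ Set.Icc T (2*T)) {r α β : ℝ} (h1 : Y ≤ α) (h2 : Y ≤ α + r) :
    (∀ y ∈ Set.Icc α β, HasDerivAt (fun y => bb (T/Y^2) t a a1 y * conj (bb (T/Y^2) s a a1 (y+r)))
      (bb1 (T/Y^2) t a a1 a2 y * conj (bb (T/Y^2) s a a1 (y+r)) + bb (T/Y^2) t a a1 y * conj (bb1 (T/Y^2) s a a1 a2 (y+r))) y) ∧
    ContinuousOn (fun y => bb1 (T/Y^2) t a a1 a2 y * conj (bb (T/Y^2) s a a1 (y+r)) + bb (T/Y^2) t a a1 y * conj (bb1 (T/Y^2) s a a1 a2 (y+r))) (Set.Icc α β) ∧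
    (∀ y ∈ Set.Icc α β, ‖bb (T/Y^2) t a a1 y * conj (bb (T/Y^2) s a a1 (y+r))‖ ≤ 25*A^2/Y^2) ∧
    (∀ y ∈ Set.Icc α β, ‖bb1 (T/Y^2) t a a1 a2 y * conj (bb (T/Y^2) s a a1 (y+r)) + bb (T/Y^2) t a a1 y * conj (bb1 (T/Y^2) s a a1 a2 (y+r))‖ ≤ 120*A^2/Y^3) := by
  have hY := h.hY
  have hY0 : 0 < Y := by linarith
  have hT0 : 0 < T := by nlinarith
  have hA := h.toGSym.nonneg
  have hN : 0 < T/Y^2 := by positivity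
  have dB : ∀ t', ∀ y ∈ Set.Icc α β, HasDerivAt (bb (T/Y^2) t' a a1) (bb1 (T/Y^2) t' a a1 a2 y) y := fun t' y hy =>
    h.bb_d hN t' (by linarith [hy.1])
  have dB2 : ∀ y ∈ Set.Icc α β, HasDerivAt (fun y => conj (bb (T/Y^2) s a a1 (y+r))) (conj (bb1 (T/Y^2) s a a1 a2 (y+r))) y := by
    intro y hy
    have := (h.bb_d hN s (by linarith [hy.1] : 1 ≤ y+r))
    have h3 := HasDerivAt.comp_add_const y r this
    exact h3.star
  refine ⟨fun y hy => (dB t y hy).fun_mul (dB2 y hy), ?_, ?_, ?_⟩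
  · have c1 : ContinuousOn (bb (T/Y^2) t a a1) (Set.Icc α β) := fun y hy => (dB t y hy).continuousAt.continuousWithinAt
    have c2 : ContinuousOn (fun y => conj (bb (T/Y^2) s a a1 (y+r))) (Set.Icc α β) := fun y hy => (dB2 y hy).continuousAt.continuousWithinAt
    have c3 : ContinuousOn (bb1 (T/Y^2) t a a1 a2) (Set.Icc α β) := (h.bb1_c hN t).mono fun y hy => by
      simp only [Set.mem_Ici]; linarith [hy.1]
    have c4 : ContinuousOn (fun y => conj (bb1 (T/Y^2) s a a1 a2 (y+r))) (Set.Icc α β) := by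
      refine Complex.continuous_conj.comp_continuousOn ((h.bb1_c hN s).comp (by fun_prop) fun y hy => ?_)
      simp only [Set.mem_Ici]; linarith [hy.1]
    exact (c3.mul c2).add (c1.mul c4)
  · intro y hy
    rw [norm_mul, RCLike.norm_conj]
    calc _ ≤ (5*A/Y)*(5*A/Y) := mul_le_mul (h.bb_b hT ht (by linarith [hy.1])) (h.bb_b hT hs (by linarith [hy.1])) (norm_nonneg _) (by positivity)
      _ = _ := by (field_simp; ring)
  · intro y hy
    refine (norm_add_le _ _).trans ?_
    rw [norm_mul, norm_mul, RCLike.norm_conj, RCLike.norm_conj]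
    calc _ ≤ (12*A/Y^2)*(5*A/Y) + (5*A/Y)*(12*A/Y^2) := by
          refine add_le_add (mul_le_mul (h.bb1_b hT ht (by linarith [hy.1])) (h.bb_b hT hs (by linarith [hy.1])) (norm_nonneg _) (by positivity)) 
            (mul_le_mul (h.bb_b hT ht (by linarith [hy.1])) (h.bb1_b hT hs (by linarith [hy.1])) (norm_nonneg _) (by positivity))
      _ = _ := by (field_simp; ring)

open ComplexConjugate in
lemma Blk.ker_0 {A Y a a1 a2} (h : Blk A Y a a1 a2) {T t s : ℝ} (hT : Y^2 ≤ T) (ht : t ∈ Set.Icc T (2*T))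
    (hs : s ∈ Set.Icc T (2*T)) :
    ‖∫ y, GG (T/Y^2) t a a1 y * conj (GG (T/Y^2) s a a1 y)‖ ≤ 6500*A^2/(1+|t-s|) := by
  have hY := h.hY
  have hY0 : 0 < Y := by linarith
  have hA := h.toGSym.nonneg
  have e0 : ∀ y, GG (T/Y^2) t a a1 y * conj (GG (T/Y^2) s a a1 y) = (bb (T/Y^2) t a a1 y * conj (bb (T/Y^2) s a a1 (y+0))) *
      Complex.exp (Complex.I * ((-(t*psi y) + s*psi y : ℝ):ℂ)) := fun y => by
    have := ker_eq (N := T/Y^2) (t := t) (s := s) (a := a) (a1 := a1) 0 y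
    simpa only [add_zero] using this
  rw [int_full (a := Y) (b := 4*Y) (by linarith) (fun y hy => by rw [h.GG_zl _ _ hy, zero_mul]) (fun y hy => by rw [h.GG_zr _ _ hy, zero_mul])]
  simp only [e0]
  obtain ⟨f1, f2, f3, f4⟩ := h.B_facts hT ht hs (r := 0) (α := Y) (β := 4*Y) le_rfl (by linarith)
  have hk1 : |t-s| * ‖∫ y in Y..4*Y, (bb (T/Y^2) t a a1 y * conj (bb (T/Y^2) s a a1 (y+0))) *
      Complex.exp (Complex.I * ((-(t*psi y) + s*psi y : ℝ):ℂ))‖ ≤ 6360*A^2 := by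
    by_cases hts : t - s = 0
    · rw [hts]; simp; positivity
    have := ibp0 (α := Y) (β := 4*Y) (τ := t-s) (p := fun y => y^2-1/4) (p1 := fun y => 2*y) (φ := fun y => -(t*psi y) + s*psi y) 
      (P0 := 16*Y^2) (P1 := 8*Y) (by linarith) hts (fun y hy => p_pos (by linarith [hy.1])) (by
        intro y hy
        have := ((psi_deriv (by linarith [hy.1] : 1 ≤ y)).const_mul t).fun_neg.fun_add ((psi_deriv (by linarith [hy.1] : 1 ≤ y)).const_mul s)
        refine this.congr_deriv ?_
        ring) (by
        intro y hy
        have := ((hasDerivAt_id y).fun_pow 2).sub_const (1/4)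
        refine this.congr_deriv ?_
        simp) (by fun_prop) f1 f2 (by rw [h.bb_zl _ _ le_rfl, zero_mul]) (by rw [h.bb_zr _ _ le_rfl, zero_mul]) f3 f4 (by
        intro y hy
        have := p_pos (by linarith [hy.1] : 1 ≤ y)
        rw [abs_of_pos this]
        nlinarith [hy.1, hy.2]) (by
        intro y hy
        rw [abs_of_pos (by linarith [hy.1])]
        linarith [hy.2])
    rw [le_div_iff₀ (abs_pos.2 hts)] at this
    rw [mul_comm]
    refine this.trans (le_of_eq ?_)
    field_simp
    ring
  have hk2 : ‖∫ y in Y..4*Y, (bb (T/Y^2) t a a1 y * conj (bb (T/Y^2) s a a1 (y+0))) *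
      Complex.exp (Complex.I * ((-(t*psi y) + s*psi y : ℝ):ℂ))‖ ≤ 75*A^2 := by
    have := intervalIntegral.norm_integral_le_of_norm_le_const (a := Y) (b := 4*Y) (f := fun y => (bb (T/Y^2) t a a1 y * conj (bb (T/Y^2) s a a1 (y+0))) *
      Complex.exp (Complex.I * ((-(t*psi y) + s*psi y : ℝ):ℂ))) (C := 25*A^2/Y^2) (by
        intro y hy
        rw [Set.uIoc_of_le (by linarith)] at hy
        rw [norm_mul, mul_comm Complex.I, Complex.norm_exp_ofReal_mul_I, mul_one]
        exact f3 y ⟨hy.1.le, hy.2⟩)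
    refine this.trans ?_
    rw [abs_of_pos (by linarith)]
    calc 25*A^2/Y^2*(4*Y-Y) = 75*A^2/Y := by (field_simp; ring)
      _ ≤ 75*A^2/1 := by gcongr
      _ = _ := by ring
  rw [le_div_iff₀ (by positivity), mul_add, mul_one, mul_comm _ |t-s|]
  nlinarith [sq_nonneg A]

open ComplexConjugate in
lemma Blk.ker_r {A Y a a1 a2} (h : Blk A Y a a1 a2) {T t s : ℝ} (hT : Y^2 ≤ T) (ht : t ∈ Set.Icc T (2*T))
    (hs : s ∈ Set.Icc T (2*T)) {r : ℝ} (hr : r ≠ 0) :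
    ‖∫ y, GG (T/Y^2) t a a1 y * conj (GG (T/Y^2) s a a1 (y+r))‖ ≤ 8000*A^2/√(T*|r|) := by
  have hY := h.hY
  have hY0 : 0 < Y := by linarith
  have hT0 : 0 < T := by nlinarith
  have hA := h.toGSym.nonneg
  have hr0 : 0 < |r| := abs_pos.2 hr
  set α := max Y (Y-r) with hα
  set β := min (4*Y) (4*Y-r) with hβ
  have hα1 : Y ≤ α := le_max_left _ _
  have hα2 : Y - r ≤ α := le_max_right _ _
  have hβ1 : β ≤ 4*Y := min_le_left _ _
  have hβ2 : β ≤ 4*Y-r := min_le_right _ _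
  have zl : ∀ y, y ≤ α → GG (T/Y^2) t a a1 y * conj (GG (T/Y^2) s a a1 (y+r)) = 0 := by
    intro y hy
    rcases le_max_iff.1 hy with hy | hy
    · rw [h.GG_zl _ _ hy, zero_mul]
    · rw [h.GG_zl _ s (by linarith : y + r ≤ Y), map_zero, mul_zero]
  have zr : ∀ y, β ≤ y → GG (T/Y^2) t a a1 y * conj (GG (T/Y^2) s a a1 (y+r)) = 0 := by
    intro y hy
    rcases min_le_iff.1 hy with hy | hy
    · rw [h.GG_zr _ _ hy, zero_mul]
    · rw [h.GG_zr _ s (by linarith : 4*Y ≤ y+r), map_zero, mul_zero]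
  by_cases hαβ : α ≤ β
  swap
  · have : ∀ y, GG (T/Y^2) t a a1 y * conj (GG (T/Y^2) s a a1 (y+r)) = 0 := by
      intro y
      rcases le_total y α with hy | hy
      · exact zl y hy
      · exact zr y (by linarith)
    simp only [this, integral_zero, norm_zero]; positivity
  rw [int_full hαβ zl zr]
  simp only [ker_eq]
  obtain ⟨f1, f2, f3, f4⟩ := h.B_facts hT ht hs (r := r) (α := α) (β := β) hα1 (by linarith)
  have zα : bb (T/Y^2) t a a1 α * conj (bb (T/Y^2) s a a1 (α+r)) = 0 := by
    rcases le_max_iff.1 (le_refl α) with hy | hy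
    · rw [h.bb_zl _ _ hy, zero_mul]
    · rw [h.bb_zl _ s (by linarith : α + r ≤ Y), map_zero, mul_zero]
  have zβ : bb (T/Y^2) t a a1 β * conj (bb (T/Y^2) s a a1 (β+r)) = 0 := by
    rcases min_le_iff.1 (le_refl β) with hy | hy
    · rw [h.bb_zr _ _ hy, zero_mul]
    · rw [h.bb_zr _ s (by linarith : 4*Y ≤ β+r), map_zero, mul_zero]
  set ν := √(T*|r|/128)/Y^2 with hν
  have hν0 : 0 < ν := by positivity
  have hν2 : ν^2 = T*|r|/(128*Y^4) := by
    rw [hν, div_pow, Real.sq_sqrt (by positivity)]; field_simp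
  have hσ : ∃ σ : ℝ, (σ = 1 ∨ σ = -1) ∧ σ * r = -|r| := by
    rcases abs_cases r with ⟨h1, _⟩ | ⟨h1, _⟩
    · exact ⟨-1, Or.inr rfl, by rw [h1]; ring⟩
    · exact ⟨1, Or.inl rfl, by rw [h1]; ring⟩
  obtain ⟨σ, hσ, hσr⟩ := hσ
  have hσa : |σ| = 1 := by rcases hσ with rfl | rfl <;> simp
  have m1 : ∀ y ∈ Set.Icc α β, 1 ≤ y := fun y hy => by linarith [hy.1]
  have m2 : ∀ y ∈ Set.Icc α β, 1 ≤ y + r := fun y hy => by linarith [hy.1]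
  have key := vdc (α := α) (β := β) (σ := σ) (ν := ν) (K := 8/(3*Y)) (φ := fun y => -(t*psi y) + s*psi (y+r))
    (φ1 := fun y => t/(y^2-1/4) - s/((y+r)^2-1/4)) (φ2 := fun y => -(t*(2*y))/(y^2-1/4)^2 + (s*(2*(y+r)))/((y+r)^2-1/4)^2)
    hαβ hσ hν0 (by positivity) (by
      intro y hy
      have := ((psi_deriv (m1 y hy)).const_mul t).fun_neg.fun_add ((HasDerivAt.comp_add_const y r (psi_deriv (m2 y hy))).const_mul s)
      refine this.congr_deriv ?_
      ring) (by
      intro y hy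
      have := (ip_deriv t (m1 y hy)).fun_sub (HasDerivAt.comp_add_const y r (ip_deriv s (m2 y hy)))
      refine this.congr_deriv ?_
      ring) (by
      refine ContinuousOn.add (ContinuousOn.div (by fun_prop) (by fun_prop) ?_) (ContinuousOn.div (by fun_prop) (by fun_prop) ?_)
      · intro y hy; exact pow_ne_zero 2 (p_pos (m1 y hy)).ne'
      · intro y hy; exact pow_ne_zero 2 (p_pos (m2 y hy)).ne') (by
      intro y hy
      have y1 := m1 y hy
      have y2 := m2 y hy
      have p1 := p_pos y1
      have p2 := p_pos y2
      have y4 : y ≤ 4*Y := by linarith [hy.2]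
      have y5 : y + r ≤ 4*Y := by linarith [hy.2]
      have e : σ * (-(t*(2*y))/(y^2-1/4)^2 + (s*(2*(y+r)))/((y+r)^2-1/4)^2) = 
        -(σ * (2*y/(y^2-1/4) * (t/(y^2-1/4) - s/((y+r)^2-1/4)))) - (σ*r) * (2*(y*(y+r)+1/4)*s/((y^2-1/4)*((y+r)^2-1/4)^2)) := by
        have := p1.ne'
        have := p2.ne'
        generalize hq : y^2-1/4 = q at *
        generalize hq' : (y+r)^2-1/4 = q' at *
        field_simp
        rw [← hq, ← hq']
        ring
      rw [e, hσr]
      have g1 : 2*y/(y^2-1/4) ≤ 8/(3*Y) := by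
        rw [div_le_div_iff₀ p1 (by positivity)]
        have := p_lower y1
        nlinarith [hy.1]
      have a1 : σ * (2*y/(y^2-1/4) * (t/(y^2-1/4) - s/((y+r)^2-1/4))) ≤ 8/(3*Y) * |t/(y^2-1/4) - s/((y+r)^2-1/4)| := by
        refine (le_abs_self _).trans ?_
        rw [abs_mul, abs_mul, hσa, one_mul, abs_of_nonneg (by positivity : 0 ≤ 2*y/(y^2-1/4))]
        gcongr
      have a2 : T/(128*Y^4) ≤ 2*(y*(y+r)+1/4)*s/((y^2-1/4)*((y+r)^2-1/4)^2) := by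
        have y0 : 0 < y := by linarith
        have y0' : 0 < y+r := by linarith
        have hs1 := hs.1
        calc T/(128*Y^4) = 2*T/((4*Y)*(4*Y)^3) := by (field_simp; ring)
          _ ≤ 2*T/(y*(y+r)^3) := by gcongr
          _ = 2*(y*(y+r))*T/(y^2*((y+r)^2)^2) := by field_simp
          _ ≤ _ := by
            refine div_le_div₀ ?_ ?_ ?_ ?_
            · have : 0 ≤ s := by linarith
              positivity
            · refine mul_le_mul (by linarith) hs1 hT0.le (by positivity)
            · positivity
            · refine mul_le_mul (by linarith) (pow_le_pow_left₀ p2.le (by linarith) 2) (by positivity) (by positivity)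
      have a3 : |r| * (T/(128*Y^4)) = T*|r|/(128*Y^4) := by ring
      have a4 := mul_le_mul_of_nonneg_left a2 hr0.le
      rw [hν2]
      linarith) f1 f2 zα zβ f3 f4
  refine key.trans ?_
  have hlen : β - α ≤ 3*Y := by linarith
  have hlen0 : 0 ≤ β - α := by linarith
  have hpi := Real.pi_lt_d2
  have s1 : √(T*|r|/128) = √(T*|r|)/√128 := Real.sqrt_div (by positivity) _
  have s2 : √(128:ℝ) ≤ 12 := by
    rw [Real.sqrt_le_left (by norm_num)]; norm_num
  calc _ ≤ (1/ν) * (120*A^2/Y^3*(3*Y)/2 + 25*A^2/Y^2*(2*3.15 + 3/2*(8/(3*Y))*(3*Y))) := by gcongr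
    _ = (1/ν) * (1275/2*(A^2/Y^2)) := by (field_simp; ring)
    _ = √128 * (1275/2*A^2) / √(T*|r|) := by
        rw [hν, s1]; field_simp
    _ ≤ 12 * (1275/2*A^2) / √(T*|r|) := by gcongr
    _ ≤ _ := by
      refine div_le_div_of_nonneg_right ?_ (by positivity)
      nlinarith [sq_nonneg A]

end TM

namespace TM

lemma cs {α : Type*} [MeasurableSpace α] {μ : Measure α} {f g : α → ℝ} (hf : Integrable (fun x => f x^2) μ)
    (hg : Integrable (fun x => g x^2) μ) (hfg : Integrable (fun x => f x * g x) μ) :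
    (∫ x, f x * g x ∂μ)^2 ≤ (∫ x, f x^2 ∂μ) * ∫ x, g x^2 ∂μ := by
  have h : ∀ c : ℝ, 0 ≤ (∫ x, f x^2 ∂μ) * (c*c) + (2 * ∫ x, f x * g x ∂μ) * c + ∫ x, g x^2 ∂μ := by
    intro c
    have e : ∫ x, (c * f x + g x)^2 ∂μ = (∫ x, f x^2 ∂μ) * (c*c) + (2 * ∫ x, f x * g x ∂μ) * c + ∫ x, g x^2 ∂μ := by
      have : ∀ x, (c * f x + g x)^2 = (c*c) * f x^2 + (2*c) * (f x * g x) + g x^2 := fun x => by ring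
      simp only [this]
      rw [integral_add (f := fun x => (c*c) * f x^2 + (2*c) * (f x * g x)) ((hf.const_mul _).add (hfg.const_mul _)) hg, integral_add (hf.const_mul _) (hfg.const_mul _),
        integral_const_mul, integral_const_mul]
      ring
    rw [← e]
    exact integral_nonneg fun x => sq_nonneg _
  have := discrim_le_zero h
  unfold discrim at this
  nlinarith

lemma cs_norm {α : Type*} [MeasurableSpace α] {μ : Measure α} {f g : α → ℂ} (hf : Integrable (fun x => ‖f x‖^2) μ)
    (hg : Integrable (fun x => ‖g x‖^2) μ) (hfg : Integrable (fun x => f x * g x) μ) :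
    ‖∫ x, f x * g x ∂μ‖^2 ≤ (∫ x, ‖f x‖^2 ∂μ) * ∫ x, ‖g x‖^2 ∂μ := by
  have h1 : ‖∫ x, f x * g x ∂μ‖ ≤ ∫ x, ‖f x‖ * ‖g x‖ ∂μ := by
    refine (norm_integral_le_integral_norm _).trans (le_of_eq ?_)
    simp only [norm_mul]
  have := cs (f := fun x => ‖f x‖) (g := fun x => ‖g x‖) hf hg (by simpa only [norm_mul] using hfg.norm)
  exact (pow_le_pow_left₀ (norm_nonneg _) h1 2).trans this

lemma unit_split {F : ℝ → ℂ} (L : ℕ) (hF : ∀ a b, IntervalIntegrable F volume a b)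
    (hl : ∀ y, y ≤ 1/2 → F y = 0) (hr : ∀ y, 1/2 + (L:ℝ) ≤ y → F y = 0) :
    ∫ y, F y = ∑ l ∈ Finset.range L, ∫ y in (1/2:ℝ)..(3/2), F (y + l) := by
  rw [int_full (a := 1/2) (b := 1/2+L) (by linarith [Nat.cast_nonneg (α := ℝ) L]) hl hr]
  have := intervalIntegral.sum_integral_adjacent_intervals (f := F) (μ := volume) (a := fun k : ℕ => (1/2:ℝ) + k) (n := L) (fun k _ => hF _ _)
  simp only [Nat.cast_zero, add_zero] at this
  rw [← this]
  refine Finset.sum_congr rfl fun l _ => ?_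
  rw [intervalIntegral.integral_comp_add_right]
  congr 1; push_cast; ring

open ComplexConjugate in
lemma periodize {N : ℝ} (hN : 0 < N) (M : ℕ) {H : ℝ → ℂ} (hH : Continuous H) (L : ℕ)
    (hl : ∀ y, y ≤ 1/2 → H y = 0) (hr : ∀ y, 1/2 + (L:ℝ) ≤ y → H y = 0) :
    ‖∫ y, H y * (CC N M y : ℂ)‖^2 ≤ (4*N*(1+Real.log M)^3) * ∑ r ∈ Finset.Ioo (-(L:ℤ)) L, ‖∫ y, H y * conj (H (y + r))‖ := by
  obtain ⟨B, hB0, hB⟩ := CC_bound hN M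
  have cm : AEStronglyMeasurable (fun y => (CC N M y : ℂ)) := (Complex.measurable_ofReal.comp (CC_meas N M)).aestronglyMeasurable
  have hII : ∀ (F : ℝ → ℂ), Continuous F → ∀ a b, IntervalIntegrable (fun y => F y * (CC N M y : ℂ)) volume a b := by
    intro F hF a b
    rw [intervalIntegrable_iff]
    refine Integrable.mul_bdd (c := B) ?_ cm.restrict (Filter.Eventually.of_forall fun y => ?_)
    · exact intervalIntegrable_iff.1 (hF.intervalIntegrable a b)
    · rw [Complex.norm_real]; exact hB y
  set P : ℝ → ℂ := fun y => ∑ l ∈ Finset.range L, H (y + l) with hP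
  have cP : Continuous P := by simp only [hP]; fun_prop
  have e1 : ∫ y, H y * (CC N M y : ℂ) = ∫ y in (1/2:ℝ)..(3/2), P y * (CC N M y : ℂ) := by
    rw [unit_split L (hII H hH) (fun y hy => by rw [hl y hy, zero_mul]) (fun y hy => by rw [hr y hy, zero_mul])]
    simp only [hP, Finset.sum_mul]
    rw [intervalIntegral.integral_finsetSum]
    · refine Finset.sum_congr rfl fun l _ => ?_
      congr 1; ext y
      have := CC_per N M y l
      push_cast at this
      rw [this]
    · intro l _
      exact hII _ (by fun_prop) _ _
  have e2 : ((∫ y in (1/2:ℝ)..(3/2), ‖P y‖^2 : ℝ):ℂ) = ∑ r ∈ Finset.Ioo (-(L:ℤ)) L, ∫ y, H y * conj (H (y + r)) := by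
    have : ∀ r ∈ Finset.Ioo (-(L:ℤ)) L, ∫ y, H y * conj (H (y + r)) =
        ∑ l ∈ Finset.range L, ∫ y in (1/2:ℝ)..(3/2), H (y + l) * conj (H (y + l + r)) := by
      intro r _
      refine unit_split (F := fun y => H y * conj (H (y + r))) L ?_ (fun y hy => by rw [hl y hy, zero_mul]) (fun y hy => by rw [hr y hy, zero_mul])
      intro a b
      apply Continuous.intervalIntegrable
      exact hH.mul (Complex.continuous_conj.comp (by fun_prop))
    rw [Finset.sum_congr rfl this, Finset.sum_comm, ← intervalIntegral.integral_ofReal]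
    have e3 : ∀ y ∈ Set.uIcc (1/2:ℝ) (3/2), ((‖P y‖^2:ℝ):ℂ) = ∑ l ∈ Finset.range L, ∑ r ∈ Finset.Ioo (-(L:ℤ)) L, H (y + l) * conj (H (y + l + r)) := by
      intro y hy
      rw [Set.uIcc_of_le (by norm_num)] at hy
      have : ((‖P y‖^2:ℝ):ℂ) = P y * conj (P y) := by
        rw [Complex.mul_conj, Complex.normSq_eq_norm_sq]
      rw [this]
      nth_rewrite 1 [hP]
      simp only
      rw [Finset.sum_mul]
      refine Finset.sum_congr rfl fun l hlL => ?_
      rw [← Finset.mul_sum, ← map_sum]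
      congr 2
      have hlL' := Finset.mem_range.1 hlL
      have inj : Set.InjOn (fun m : ℕ => (m:ℤ) - l) (Finset.range L) := by
        intro m _ m' _ h; simp only at h; omega
      have e4 : P y = ∑ r ∈ (Finset.range L).image (fun m : ℕ => (m:ℤ) - l), H (y + l + r) := by
        rw [Finset.sum_image inj]
        refine Finset.sum_congr rfl fun m _ => ?_
        congr 1; push_cast; ring
      rw [e4]
      refine Finset.sum_subset ?_ ?_
      · intro r hr'
        obtain ⟨m, hm, rfl⟩ := Finset.mem_image.1 hr'
        have := Finset.mem_range.1 hm
        rw [Finset.mem_Ioo]; omega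
      · intro r _ hn
        by_cases h0 : (l:ℤ) + r < 0
        · apply hl
          have : ((l:ℤ) + r : ℤ) ≤ -1 := by omega
          have : (((l:ℤ) + r : ℤ):ℝ) ≤ ((-1:ℤ):ℝ) := by exact_mod_cast this
          push_cast at this
          linarith [hy.2]
        · by_cases h1 : (L:ℤ) ≤ l + r
          · apply hr
            have : (((L:ℤ)):ℝ) ≤ ((l + r : ℤ):ℝ) := by exact_mod_cast h1
            push_cast at this
            linarith [hy.1]
          · exfalso; apply hn
            rw [Finset.mem_image]
            refine ⟨(l + r).toNat, ?_, ?_⟩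
            · rw [Finset.mem_range]; omega
            · omega
    rw [intervalIntegral.integral_congr e3, intervalIntegral.integral_finsetSum]
    · refine Finset.sum_congr rfl fun l _ => ?_
      rw [intervalIntegral.integral_finsetSum]
      intro r _
      apply Continuous.intervalIntegrable
      exact (by fun_prop : Continuous fun y => H (y + l)).mul (Complex.continuous_conj.comp (by fun_prop))
    · intro l _
      apply Continuous.intervalIntegrable
      refine continuous_finsetSum _ fun r _ => ?_
      exact (by fun_prop : Continuous fun y => H (y + l)).mul (Complex.continuous_conj.comp (by fun_prop))
  have e5 : ∫ y in (1/2:ℝ)..(3/2), ‖P y‖^2 ≤ ∑ r ∈ Finset.Ioo (-(L:ℤ)) L, ‖∫ y, H y * conj (H (y + r))‖ := by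
    refine le_trans ?_ (norm_sum_le _ _)
    rw [← e2, Complex.norm_real]
    exact le_abs_self _
  rw [e1]
  have hle : (1/2:ℝ) ≤ 3/2 := by norm_num
  have i1 : IntervalIntegrable (fun y => ‖P y‖^2) volume (1/2) (3/2) := by
    apply Continuous.intervalIntegrable; fun_prop
  have i2 : IntegrableOn (fun y => ‖(CC N M y:ℂ)‖^2) (Set.Ioc (1/2:ℝ) (3/2)) := by
    refine Measure.integrableOn_of_bounded (M := B^2) (by simp) ?_ ?_
    · exact ((CC_meas N M).complex_ofReal.norm.pow_const 2).aestronglyMeasurable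
    · refine Filter.Eventually.of_forall fun y => ?_
      rw [Real.norm_eq_abs, abs_of_nonneg (by positivity), Complex.norm_real]
      exact pow_le_pow_left₀ (abs_nonneg _) (hB y) 2
  have := cs_norm (μ := volume.restrict (Set.Ioc (1/2:ℝ) (3/2))) (f := P) (g := fun y => (CC N M y:ℂ))
    ((intervalIntegrable_iff_integrableOn_Ioc_of_le hle).1 i1) i2 ((intervalIntegrable_iff_integrableOn_Ioc_of_le hle).1 (hII P cP _ _))
  rw [intervalIntegral.integral_of_le hle]
  refine this.trans ?_
  rw [mul_comm]
  refine mul_le_mul ?_ ?_ (by positivity) ?_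
  · have h2 := CC_L2 hN M
    rw [intervalIntegral.integral_of_le hle] at h2
    refine le_trans (le_of_eq ?_) h2
    simp only [Complex.norm_real, Real.norm_eq_abs, sq_abs]
  · rw [intervalIntegral.integral_of_le hle] at e5
    exact e5
  · have : 0 ≤ Real.log M := Real.log_natCast_nonneg M
    positivity

end TM

namespace TM

open ComplexConjugate in
lemma tf {μ ν : Measure ℝ} [IsFiniteMeasure μ] [IsFiniteMeasure ν] {f : ℝ → ℂ} {g1 g2 : ℝ → ℝ → ℂ} {Bf Bg : ℝ}
    (hf : Measurable f) (hfB : ∀ a, ‖f a‖ ≤ Bf)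
    (h1 : Measurable (fun z : ℝ × ℝ => g1 z.1 z.2)) (h2 : Measurable (fun z : ℝ × ℝ => g2 z.1 z.2))
    (b1 : ∀ᵐ a ∂μ, ∀ b, ‖g1 a b‖ ≤ Bg) (b2 : ∀ᵐ a ∂μ, ∀ b, ‖g2 a b‖ ≤ Bg)
    {K : ℝ → ℝ → ℝ} (mK : Measurable (fun z : ℝ × ℝ => K z.1 z.2)) {BK : ℝ} (hKB : ∀ a a', |K a a'| ≤ BK)
    (hK : ∀ᵐ z ∂(μ.prod μ), ‖∫ b, g1 z.1 b * conj (g2 z.2 b) ∂ν‖ ≤ K z.1 z.2) :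
    ‖∫ b, (∫ a, f a * g1 a b ∂μ) * conj (∫ a, f a * g2 a b ∂μ) ∂ν‖ ≤
      ∫ z, ‖f z.1‖ * ‖f z.2‖ * K z.1 z.2 ∂(μ.prod μ) := by
  have hBf : 0 ≤ Bf := (norm_nonneg _).trans (hfB 0)
  have e1 : ∀ b, (∫ a, f a * g1 a b ∂μ) * conj (∫ a, f a * g2 a b ∂μ) =
      ∫ z, (f z.1 * g1 z.1 b) * conj (f z.2 * g2 z.2 b) ∂(μ.prod μ) := by
    intro b
    rw [← integral_conj]
    exact (integral_prod_mul (fun a => f a * g1 a b) (fun a => conj (f a * g2 a b))).symm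
  simp only [e1]
  rw [integral_integral_swap]
  swap
  · have hm : Measurable (Function.uncurry fun (b : ℝ) (z : ℝ × ℝ) => (f z.1 * g1 z.1 b) * conj (f z.2 * g2 z.2 b)) := by
      have m1 : Measurable (fun w : ℝ × (ℝ × ℝ) => g1 w.2.1 w.1) := h1.comp (by fun_prop : Measurable fun w : ℝ × (ℝ × ℝ) => (w.2.1, w.1))
      have m2 : Measurable (fun w : ℝ × (ℝ × ℝ) => g2 w.2.2 w.1) := h2.comp (by fun_prop : Measurable fun w : ℝ × (ℝ × ℝ) => (w.2.2, w.1))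
      have m3 : Measurable (fun w : ℝ × (ℝ × ℝ) => f w.2.1) := hf.comp (by fun_prop)
      have m4 : Measurable (fun w : ℝ × (ℝ × ℝ) => f w.2.2) := hf.comp (by fun_prop)
      exact (m3.mul m1).mul (Complex.continuous_conj.measurable.comp (m4.mul m2))
    refine Integrable.of_bound hm.aestronglyMeasurable ((Bf*Bg)*(Bf*Bg)) ?_
    have q1 : ∀ᵐ w ∂(ν.prod (μ.prod μ)), ∀ b, ‖g1 w.2.1 b‖ ≤ Bg :=
      (Measure.quasiMeasurePreserving_fst.comp Measure.quasiMeasurePreserving_snd).ae b1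
    have q2 : ∀ᵐ w ∂(ν.prod (μ.prod μ)), ∀ b, ‖g2 w.2.2 b‖ ≤ Bg :=
      (Measure.quasiMeasurePreserving_snd.comp Measure.quasiMeasurePreserving_snd).ae b2
    filter_upwards [q1, q2] with w w1 w2
    have hBg : 0 ≤ Bg := (norm_nonneg _).trans (w1 0)
    simp only [Function.uncurry, norm_mul, RCLike.norm_conj]
    exact mul_le_mul (mul_le_mul (hfB _) (w1 _) (norm_nonneg _) hBf) (mul_le_mul (hfB _) (w2 _) (norm_nonneg _) hBf)
      (by positivity) (by positivity)
  · refine norm_integral_le_of_norm_le ?_ ?_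
    · refine Integrable.of_bound (C := Bf*Bf*BK) ?_ ?_
      · exact (((hf.comp measurable_fst).norm.mul (hf.comp measurable_snd).norm).mul mK).aestronglyMeasurable
      · refine Filter.Eventually.of_forall fun z => ?_
        rw [norm_mul, norm_mul, norm_norm, norm_norm, Real.norm_eq_abs]
        exact mul_le_mul (mul_le_mul (hfB _) (hfB _) (norm_nonneg _) hBf) (hKB _ _) (abs_nonneg _) (by positivity)
    · filter_upwards [hK] with z hz
      have : ∀ b, (f z.1 * g1 z.1 b) * conj (f z.2 * g2 z.2 b) = (f z.1 * conj (f z.2)) * (g1 z.1 b * conj (g2 z.2 b)) := by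
        intro b; rw [map_mul]; ring
      simp only [this]
      rw [integral_const_mul, norm_mul, norm_mul, RCLike.norm_conj]
      gcongr

lemma schur {μ : Measure ℝ} [IsFiniteMeasure μ] {f : ℝ → ℂ} {Bf : ℝ} (hf : Measurable f) (hfB : ∀ a, ‖f a‖ ≤ Bf)
    {K : ℝ → ℝ → ℝ} (mK : Measurable (fun z : ℝ × ℝ => K z.1 z.2)) {BK : ℝ} (hKB : ∀ a a', |K a a'| ≤ BK)
    (K0 : ∀ a a', 0 ≤ K a a') (Ks : ∀ a a', K a a' = K a' a) {B : ℝ} (hB : ∀ᵐ a ∂μ, ∫ a', K a a' ∂μ ≤ B) :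
    ∫ z, ‖f z.1‖ * ‖f z.2‖ * K z.1 z.2 ∂(μ.prod μ) ≤ B * ∫ a, ‖f a‖^2 ∂μ := by
  have hBf : 0 ≤ Bf := (norm_nonneg _).trans (hfB 0)
  have iz : ∀ (g : ℝ × ℝ → ℝ), Measurable g → (∀ z, |g z| ≤ Bf^2*BK) → Integrable g (μ.prod μ) := by
    intro g hg hb
    exact Integrable.of_bound hg.aestronglyMeasurable (Bf^2*BK) (Filter.Eventually.of_forall hb)
  have m1 : Measurable (fun z : ℝ × ℝ => ‖f z.1‖) := (hf.comp measurable_fst).norm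
  have m2 : Measurable (fun z : ℝ × ℝ => ‖f z.2‖) := (hf.comp measurable_snd).norm
  have i1 : Integrable (fun z : ℝ × ℝ => ‖f z.1‖^2 * K z.1 z.2) (μ.prod μ) := by
    refine iz _ ((m1.pow_const 2).mul mK) fun z => ?_
    rw [abs_mul, abs_of_nonneg (by positivity)]
    exact mul_le_mul (pow_le_pow_left₀ (norm_nonneg _) (hfB _) 2) (hKB _ _) (abs_nonneg _) (by positivity)
  have i2 : Integrable (fun z : ℝ × ℝ => ‖f z.2‖^2 * K z.1 z.2) (μ.prod μ) := by
    refine iz _ ((m2.pow_const 2).mul mK) fun z => ?_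
    rw [abs_mul, abs_of_nonneg (by positivity)]
    exact mul_le_mul (pow_le_pow_left₀ (norm_nonneg _) (hfB _) 2) (hKB _ _) (abs_nonneg _) (by positivity)
  have i0 : Integrable (fun z : ℝ × ℝ => ‖f z.1‖ * ‖f z.2‖ * K z.1 z.2) (μ.prod μ) := by
    refine iz _ ((m1.mul m2).mul mK) fun z => ?_
    rw [abs_mul, abs_of_nonneg (by positivity)]
    refine mul_le_mul ?_ (hKB _ _) (abs_nonneg _) (by positivity)
    rw [sq]
    exact mul_le_mul (hfB _) (hfB _) (norm_nonneg _) hBf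
  have hf2 : Integrable (fun a => ‖f a‖^2) μ := by
    refine Integrable.of_bound (hf.norm.pow_const 2).aestronglyMeasurable (Bf^2) (Filter.Eventually.of_forall fun a => ?_)
    rw [norm_pow, norm_norm]
    exact pow_le_pow_left₀ (norm_nonneg _) (hfB _) 2
  have s1 : ∫ z, ‖f z.1‖^2 * K z.1 z.2 ∂(μ.prod μ) ≤ B * ∫ a, ‖f a‖^2 ∂μ := by
    rw [integral_prod _ i1, ← integral_const_mul]
    refine integral_mono_ae i1.integral_prod_left (hf2.const_mul _) ?_
    filter_upwards [hB] with a ha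
    rw [integral_const_mul, mul_comm]
    gcongr
  have s2 : ∫ z, ‖f z.2‖^2 * K z.1 z.2 ∂(μ.prod μ) = ∫ z, ‖f z.1‖^2 * K z.1 z.2 ∂(μ.prod μ) := by
    rw [← integral_prod_swap]
    refine integral_congr_ae (Filter.Eventually.of_forall fun z => ?_)
    simp only [Prod.fst_swap, Prod.snd_swap]
    rw [Ks]
  calc _ ≤ ∫ z, (1/2*(‖f z.1‖^2 * K z.1 z.2) + 1/2*(‖f z.2‖^2 * K z.1 z.2)) ∂(μ.prod μ) := by
        refine integral_mono i0 ((i1.const_mul _).add (i2.const_mul _)) fun z => ?_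
        simp only
        have := mul_nonneg (sq_nonneg (‖f z.1‖ - ‖f z.2‖)) (K0 z.1 z.2)
        nlinarith
    _ = ∫ z, ‖f z.1‖^2 * K z.1 z.2 ∂(μ.prod μ) := by
        rw [integral_add (i1.const_mul _) (i2.const_mul _), integral_const_mul, integral_const_mul, s2]; ring
    _ ≤ _ := s1

lemma int_lin {c p q : ℝ} (hc : 0 < c) (hpq : p ≤ q) : ∫ x in p..q, 1/(1+c*(x-p)) = (1/c)*Real.log (1+c*(q-p)) := by
  have d : ∀ x ∈ Set.uIcc p q, HasDerivAt (fun x => (1/c)*Real.log (1+c*(x-p))) (1/(1+c*(x-p))) x := by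
    intro x hx
    rw [Set.uIcc_of_le hpq] at hx
    have h0 : 0 < 1+c*(x-p) := by nlinarith [hx.1]
    have := (((((hasDerivAt_id x).sub_const p).const_mul c).const_add 1).log h0.ne').const_mul (1/c)
    refine this.congr_deriv ?_
    simp only [id]; field_simp
  rw [intervalIntegral.integral_eq_sub_of_hasDerivAt d]
  · simp
  · apply ContinuousOn.intervalIntegrable
    rw [Set.uIcc_of_le hpq]
    refine ContinuousOn.div (by fun_prop) (by fun_prop) fun x hx => ?_
    have : 0 < 1+c*(x-p) := by nlinarith [hx.1]
    exact this.ne'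

lemma int_K {c p q x0 : ℝ} (hc : 0 < c) (h0 : x0 ∈ Set.Icc p q) : ∫ x in p..q, 1/(1+c*|x0-x|) ≤ (2/c)*Real.log (1+c*(q-p)) := by
  have cK : Continuous (fun x : ℝ => 1/(1+c*|x0-x|)) := by
    refine Continuous.div (by fun_prop) (by fun_prop) fun x => ?_
    positivity
  rw [← intervalIntegral.integral_add_adjacent_intervals (cK.intervalIntegrable p x0) (cK.intervalIntegrable x0 q)]
  have e2 : ∫ x in x0..q, 1/(1+c*|x0-x|) = (1/c)*Real.log (1+c*(q-x0)) := by
    rw [← int_lin hc h0.2]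
    refine intervalIntegral.integral_congr fun x hx => ?_
    rw [Set.uIcc_of_le h0.2] at hx
    rw [abs_sub_comm, abs_of_nonneg (by linarith [hx.1])]
  have e1 : ∫ x in p..x0, 1/(1+c*|x0-x|) = (1/c)*Real.log (1+c*(x0-p)) := by
    rw [← int_lin hc h0.1]
    have := intervalIntegral.integral_comp_sub_left (a := p) (b := x0) (fun x => 1/(1+c*(x-p))) (x0+p)
    rw [show x0 + p - x0 = p by ring, show x0 + p - p = x0 by ring] at this
    rw [← this]
    refine intervalIntegral.integral_congr fun x hx => ?_
    rw [Set.uIcc_of_le h0.1] at hx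
    rw [abs_of_nonneg (by linarith [hx.2])]
    ring
  rw [e1, e2]
  have l1 : Real.log (1+c*(x0-p)) ≤ Real.log (1+c*(q-p)) :=
    Real.log_le_log (by nlinarith [h0.1]) (by nlinarith [h0.2])
  have l2 : Real.log (1+c*(q-x0)) ≤ Real.log (1+c*(q-p)) :=
    Real.log_le_log (by nlinarith [h0.2]) (by nlinarith [h0.1])
  have : (2/c)*Real.log (1+c*(q-p)) = (1/c)*Real.log (1+c*(q-p)) + (1/c)*Real.log (1+c*(q-p)) := by ring
  rw [this]
  gcongr

open ComplexConjugate in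
lemma tf_log {S : Set ℝ} (hS : MeasurableSet S) {p q c c0 : ℝ} (hpq : p ≤ q) (hSpq : S ⊆ Set.Icc p q) (hc : 0 < c) (hc0 : 0 ≤ c0)
    {ν : Measure ℝ} [IsFiniteMeasure ν] {f : ℝ → ℂ} {g : ℝ → ℝ → ℂ} {Bf Bg : ℝ}
    (hf : Measurable f) (hfB : ∀ a, ‖f a‖ ≤ Bf)
    (h1 : Measurable (fun z : ℝ × ℝ => g z.1 z.2)) (b1 : ∀ a ∈ S, ∀ b, ‖g a b‖ ≤ Bg)
    (hK : ∀ a ∈ S, ∀ a' ∈ S, ‖∫ b, g a b * conj (g a' b) ∂ν‖ ≤ c0/(1+c*|a-a'|)) :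
    ‖∫ b, (∫ a in S, f a * g a b) * conj (∫ a in S, f a * g a b) ∂ν‖ ≤ (c0*((2/c)*Real.log (1+c*(q-p)))) * ∫ a in S, ‖f a‖^2 := by
  have : IsFiniteMeasure (volume.restrict S) := by
    refine ⟨?_⟩
    rw [Measure.restrict_apply_univ]
    exact (measure_mono hSpq).trans_lt (by simp)
  have mK : Measurable (fun z : ℝ × ℝ => c0/(1+c*|z.1-z.2|)) := by fun_prop
  have K0 : ∀ a a' : ℝ, 0 ≤ c0/(1+c*|a-a'|) := fun a a' => by positivity
  have KB : ∀ a a' : ℝ, |c0/(1+c*|a-a'|)| ≤ c0 := fun a a' => by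
    rw [abs_of_nonneg (K0 a a')]
    exact div_le_self hc0 (by have : 0 ≤ c*|a-a'| := by positivity
                              linarith)
  have b1' : ∀ᵐ a ∂(volume.restrict S), ∀ b, ‖g a b‖ ≤ Bg := by
    filter_upwards [ae_restrict_mem hS] with a ha using b1 a ha
  refine (tf hf hfB h1 h1 b1' b1' (K := fun a a' => c0/(1+c*|a-a'|)) mK KB ?_).trans ?_
  · have q1 := (Measure.quasiMeasurePreserving_fst (ν := volume.restrict S)).ae (ae_restrict_mem (μ := volume) hS)
    have q2 := (Measure.quasiMeasurePreserving_snd (μ := volume.restrict S)).ae (ae_restrict_mem (μ := volume) hS)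
    filter_upwards [q1, q2] with z z1 z2 using hK _ z1 _ z2
  · refine schur hf hfB mK KB K0 (fun a a' => by rw [abs_sub_comm]) ?_
    filter_upwards [ae_restrict_mem hS] with a ha
    have h2 := int_K hc (hSpq ha)
    have e : ∀ x : ℝ, c0/(1+c*|a-x|) = c0 * (1/(1+c*|a-x|)) := fun x => by ring
    simp only [e]
    rw [integral_const_mul]
    gcongr
    refine le_trans ?_ h2
    rw [intervalIntegral.integral_of_le hpq, ← integral_Icc_eq_integral_Ioc]
    refine setIntegral_mono_set ?_ (Filter.Eventually.of_forall fun x => ?_) (Filter.Eventually.of_forall hSpq)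
    · apply ContinuousOn.integrableOn_Icc
      refine ContinuousOn.div (by fun_prop) (by fun_prop) fun x _ => ?_
      positivity
    · simp only [Pi.zero_apply]; positivity

end TM

namespace TM

lemma psi_diff {Y y z : ℝ} (hY : 1 < Y) (hy : y ∈ Set.Icc Y (4*Y)) (hz : z ∈ Set.Icc Y (4*Y)) :
    |y - z|/(16*Y^2) ≤ |psi y - psi z| := by
  wlog h : y < z generalizing y z with H
  · rcases eq_or_lt_of_le (not_lt.1 h) with rfl | h'
    · simp
    · rw [abs_sub_comm, abs_sub_comm (psi y)]; exact H hz hy h'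
  obtain ⟨c, hc, hd⟩ := exists_hasDerivAt_eq_slope psi (fun y => -1/(y^2-1/4)) h
    (fun x hx => (psi_deriv (by linarith [hx.1, hy.1])).continuousAt.continuousWithinAt) (fun x hx => psi_deriv (by linarith [hx.1, hy.1]))
  have hc1 : 1 ≤ c := by linarith [hc.1, hy.1]
  have hp := p_pos hc1
  have hzy : 0 < z - y := by linarith
  have e : psi y - psi z = (z-y)/(c^2-1/4) := by
    rw [eq_div_iff hzy.ne'] at hd
    rw [← neg_sub, ← hd]; ring
  rw [e, abs_sub_comm, abs_of_pos hzy, abs_of_pos (by positivity)]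
  have : c^2 - 1/4 ≤ 16*Y^2 := by nlinarith [hc.2, hz.2]
  gcongr

lemma psi_meas : Measurable psi := by unfold psi; fun_prop
lemma ph_meas : Measurable (fun z : ℝ × ℝ => ph z.2 z.1) := by
  unfold ph
  have : Measurable (fun z : ℝ × ℝ => psi z.1) := psi_meas.comp measurable_fst
  fun_prop
lemma ph_meas_t (t : ℝ) : Measurable (ph t) := by
  unfold ph
  have := psi_meas
  fun_prop
lemma ph_cont_t (y : ℝ) : Continuous (fun t => ph t y) := by
  unfold ph; fun_prop

open ComplexConjugate in
lemma ph_ker {T Y y z : ℝ} (hT : 0 < T) (hY : 1 < Y) (hy : y ∈ Set.Icc Y (4*Y)) (hz : z ∈ Set.Icc Y (4*Y)) :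
    ‖∫ t in Set.Ioc T (2*T), ph t y * conj (ph t z)‖ ≤ 3*T/(1+T/(16*Y^2)*|y-z|) := by
  have e : ∀ t, ph t y * conj (ph t z) = Complex.exp ((-(Complex.I * (psi y - psi z : ℝ))) * t) := by
    intro t
    unfold ph
    rw [← Complex.exp_conj, ← Complex.exp_add]
    congr 1
    simp only [map_neg, map_mul, Complex.conj_I, Complex.conj_ofReal]
    push_cast; ring
  rw [← intervalIntegral.integral_of_le (by linarith)]
  have k1 : ‖∫ t in T..2*T, ph t y * conj (ph t z)‖ ≤ T := by
    have := intervalIntegral.norm_integral_le_of_norm_le_const (a := T) (b := 2*T) (f := fun t => ph t y * conj (ph t z)) (C := 1) (by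
      intro t _; rw [norm_mul, RCLike.norm_conj, ph_norm, ph_norm, mul_one])
    rw [show 2*T - T = T by ring, abs_of_pos hT, one_mul] at this
    exact this
  have hd := psi_diff hY hy hz
  have k2 : |psi y - psi z| * ‖∫ t in T..2*T, ph t y * conj (ph t z)‖ ≤ 2 := by
    by_cases h0 : psi y - psi z = 0
    · rw [h0]; simp
    simp only [e]
    have hc : (-(Complex.I * ((psi y - psi z : ℝ):ℂ))) ≠ 0 := by
      simp only [ne_eq, neg_eq_zero, mul_eq_zero, Complex.I_ne_zero, false_or]
      exact_mod_cast h0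
    rw [integral_exp_mul_complex hc, norm_div]
    have n1 : ‖(-(Complex.I * ((psi y - psi z : ℝ):ℂ)))‖ = |psi y - psi z| := by
      rw [norm_neg, norm_mul, Complex.norm_I, one_mul, Complex.norm_real, Real.norm_eq_abs]
    rw [n1, mul_div_cancel₀ _ (abs_ne_zero.2 h0)]
    refine (norm_sub_le _ _).trans ?_
    have n2 : ∀ t : ℝ, ‖Complex.exp ((-(Complex.I * ((psi y - psi z : ℝ):ℂ))) * t)‖ = 1 := by
      intro t
      rw [← e, norm_mul, RCLike.norm_conj, ph_norm, ph_norm, mul_one]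
    rw [n2, n2]; norm_num
  rw [le_div_iff₀ (by positivity)]
  set k := ‖∫ t in T..2*T, ph t y * conj (ph t z)‖
  have hk : 0 ≤ k := norm_nonneg _
  calc k * (1+T/(16*Y^2)*|y-z|) = k + T * (k * (|y-z|/(16*Y^2))) := by ring
    _ ≤ T + T * (k * |psi y - psi z|) := by gcongr
    _ ≤ T + T * 2 := by rw [mul_comm k]; gcongr
    _ = _ := by ring

lemma ms_gen {T Y : ℝ} (hT : 0 < T) (hY : 1 < Y) {f : ℝ → ℂ} {B : ℝ} (hf : Measurable f) (hB : ∀ y, ‖f y‖ ≤ B) :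
    ∫ t in T..2*T, ‖∫ y in Set.Icc Y (4*Y), f y * ph t y‖^2 ≤ 96*Y^2*Real.log (1+T) * ∫ y in Set.Icc Y (4*Y), ‖f y‖^2 := by
  have := tf_log (S := Set.Icc Y (4*Y)) measurableSet_Icc (p := Y) (q := 4*Y) (c := T/(16*Y^2)) (c0 := 3*T) (by linarith) le_rfl
    (by positivity) (by positivity) (ν := volume.restrict (Set.Ioc T (2*T))) hf hB (g := fun y t => ph t y) (Bg := 1) ph_meas
    (fun a _ b => (ph_norm b a).le) (fun y hy z hz => ph_ker hT hY hy hz)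
  have e : ∀ t, (∫ y in Set.Icc Y (4*Y), f y * ph t y) * (starRingEnd ℂ) (∫ y in Set.Icc Y (4*Y), f y * ph t y) =
      ((‖∫ y in Set.Icc Y (4*Y), f y * ph t y‖^2 : ℝ):ℂ) := fun t => by
    rw [Complex.mul_conj, Complex.normSq_eq_norm_sq]
  simp only [e] at this
  have e2 := integral_ofReal (𝕜 := ℂ) (μ := volume.restrict (Set.Ioc T (2*T))) (f := fun t => ‖∫ y in Set.Icc Y (4*Y), f y * ph t y‖^2)
  have this := (congrArg norm e2).symm.le.trans this
  rw [RCLike.norm_ofReal] at this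
  rw [intervalIntegral.integral_of_le (by linarith)]
  refine (le_abs_self _).trans (this.trans ?_)
  refine mul_le_mul_of_nonneg_right ?_ (by positivity)
  have l : Real.log (1+T/(16*Y^2)*(4*Y-Y)) ≤ Real.log (1+T) := by
    apply Real.log_le_log (by have : 0 ≤ 4*Y-Y := by linarith
                              positivity)
    have : T/(16*Y^2)*(4*Y-Y) = T*(3/(16*Y)) := by field_simp; ring
    rw [this]
    have : 3/(16*Y) ≤ 1 := by rw [div_le_one (by positivity)]; linarith
    nlinarith
  calc 3*T*(2/(T/(16*Y^2))*Real.log (1+T/(16*Y^2)*(4*Y-Y))) = 96*Y^2*Real.log (1+T/(16*Y^2)*(4*Y-Y)) := by field_simp; ring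
    _ ≤ _ := by gcongr

lemma CC_sq_int {N : ℝ} (hN : 0 < N) (M : ℕ) {Y : ℝ} (hY : 1 < Y) :
    ∫ y in Set.Icc Y (4*Y), (CC N M y)^2 ≤ 5*Y*(4*N*(1+Real.log M)^3) := by
  obtain ⟨B, hB0, hB⟩ := CC_bound hN M
  have ii : ∀ a b, IntegrableOn (fun y => (CC N M y)^2) (Set.Icc a b) := by
    intro a b
    refine Measure.integrableOn_of_bounded (M := B^2) (by simp) ?_ ?_
    · exact ((CC_meas N M).pow_const 2).aestronglyMeasurable
    · refine Filter.Eventually.of_forall fun y => ?_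
      rw [norm_pow]
      exact pow_le_pow_left₀ (abs_nonneg _) (hB y) 2
  have hII : ∀ a b, IntervalIntegrable (fun y => (CC N M y)^2) volume a b := by
    intro a b
    rw [intervalIntegrable_iff]
    exact (ii _ _).mono_set Set.uIoc_subset_uIcc
  set L := ⌈4*Y⌉₊ with hL
  have L1 : 4*Y ≤ L := Nat.le_ceil _
  have L2 : (L:ℝ) < 4*Y+1 := Nat.ceil_lt_add_one (by linarith)
  have e := intervalIntegral.sum_integral_adjacent_intervals (f := fun y => (CC N M y)^2) (μ := volume) (a := fun k : ℕ => (1/2:ℝ) + k) (n := L) (fun k _ => hII _ _)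
  have e1 : ∀ k ∈ Finset.range L, ∫ y in (1/2+(k:ℝ))..(1/2+((k+1:ℕ):ℝ)), (CC N M y)^2 = ∫ y in (1/2:ℝ)..(3/2), (CC N M y)^2 := by
    intro k _
    have := intervalIntegral.integral_comp_add_right (a := 1/2) (b := 3/2) (fun y => (CC N M y)^2) (k:ℝ)
    have h2 : ∀ y, CC N M (y + k) = CC N M y := fun y => by
      have := CC_per N M y k
      simpa using this
    simp only [h2] at this
    rw [this]; congr 1; push_cast; ring
  rw [Finset.sum_congr rfl e1, Finset.sum_const, Finset.card_range, nsmul_eq_mul] at e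
  have hD := CC_L2 hN M
  have : ∫ y in Set.Icc Y (4*Y), (CC N M y)^2 ≤ ∫ y in (1/2+((0:ℕ):ℝ))..(1/2+(L:ℝ)), (CC N M y)^2 := by
    rw [intervalIntegral.integral_of_le (by simp), ← integral_Icc_eq_integral_Ioc]
    refine setIntegral_mono_set (ii _ _) (Filter.Eventually.of_forall fun x => ?_) (Filter.Eventually.of_forall ?_)
    · simp only [Pi.zero_apply]; positivity
    · exact Set.Icc_subset_Icc (by simp; linarith) (by linarith)
  refine this.trans ?_
  rw [← e]
  have : 0 ≤ ∫ y in (1/2:ℝ)..(3/2), (CC N M y)^2 := intervalIntegral.integral_nonneg (by norm_num) fun y _ => sq_nonneg _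
  exact mul_le_mul (by linarith) hD this (by linarith)

noncomputable def g0 (N : ℝ) (M : ℕ) (a a1 : ℝ → ℝ) (y : ℝ) : ℂ := ((a y + a1 y/N : ℝ):ℂ) * (CC N M y:ℂ)
noncomputable def g1 (N : ℝ) (M : ℕ) (a : ℝ → ℝ) (y : ℝ) : ℂ := (Complex.I * (a y/((y^2-1/4)*N) : ℝ)) * (CC N M y:ℂ)

lemma Blk.g_meas {A Y a a1 a2} (h : Blk A Y a a1 a2) (N : ℝ) (M : ℕ) : Measurable (g0 N M a a1) ∧ Measurable (g1 N M a) := by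
  have c0 : Continuous a := continuous_iff_continuousAt.2 fun y => (h.d1 y).continuousAt
  have c1 : Continuous a1 := continuous_iff_continuousAt.2 fun y => (h.d2 y).continuousAt
  have m0 := c0.measurable
  have m1 := c1.measurable
  have := CC_meas N M
  constructor
  · unfold g0; fun_prop
  · unfold g1; fun_prop

lemma Blk.bb_all {A Y a a1 a2} (h : Blk A Y a a1 a2) {T t : ℝ} (hT : Y^2 ≤ T) (ht : t ∈ Set.Icc T (2*T)) (y : ℝ) :
    ‖bb (T/Y^2) t a a1 y‖ ≤ 5*A/Y := by
  have hA := h.toGSym.nonneg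
  have hY := h.hY
  rcases le_total Y y with hy | hy
  · exact h.bb_b hT ht hy
  · rw [h.bb_zl _ _ hy, norm_zero]; positivity

lemma Blk.g_bd {A Y a a1 a2} (h : Blk A Y a a1 a2) {T : ℝ} (hT : Y^2 ≤ T) (M : ℕ) (y : ℝ) :
    ‖g0 (T/Y^2) M a a1 y‖ ≤ 5*A/Y * |CC (T/Y^2) M y| ∧ ‖g1 (T/Y^2) M a y‖ ≤ 5*A/Y/T * |CC (T/Y^2) M y| := by
  have hY := h.hY
  have hT0 : 0 < T := by nlinarith
  have hb := h.bb_all hT (t := T) ⟨le_rfl, by linarith⟩ y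
  have r : |a y + a1 y/(T/Y^2)| ≤ 5*A/Y := by
    have h1 := Complex.abs_re_le_norm (bb (T/Y^2) T a a1 y)
    have e : (bb (T/Y^2) T a a1 y).re = a y + a1 y/(T/Y^2) := by
      unfold bb; rw [Complex.add_re, Complex.ofReal_re, Complex.I_mul_re, Complex.ofReal_im]; simp
    rw [e] at h1; exact h1.trans hb
  have i : |T*(a y/((y^2-1/4)*(T/Y^2)))| ≤ 5*A/Y := by
    have h1 := Complex.abs_im_le_norm (bb (T/Y^2) T a a1 y)
    have e : (bb (T/Y^2) T a a1 y).im = T*(a y/((y^2-1/4)*(T/Y^2))) := by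
      unfold bb; rw [Complex.add_im, Complex.ofReal_im, Complex.I_mul_im, Complex.ofReal_re]; simp
    rw [e] at h1; exact h1.trans hb
  constructor
  · unfold g0
    rw [norm_mul, Complex.norm_real, Complex.norm_real, Real.norm_eq_abs, Real.norm_eq_abs]
    gcongr
  · unfold g1
    rw [norm_mul, norm_mul, Complex.norm_I, one_mul, Complex.norm_real, Complex.norm_real, Real.norm_eq_abs, Real.norm_eq_abs]
    gcongr
    rw [le_div_iff₀ hT0, mul_comm]
    rwa [abs_mul, abs_of_pos hT0] at i

lemma Blk.g_bdd {A Y a a1 a2} (h : Blk A Y a a1 a2) {T : ℝ} (hT : Y^2 ≤ T) (M : ℕ) :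
    ∃ B, ∀ y, ‖g0 (T/Y^2) M a a1 y‖ ≤ B ∧ ‖g1 (T/Y^2) M a y‖ ≤ B := by
  have hY := h.hY
  have hT0 : 0 < T := by nlinarith
  have hA := h.toGSym.nonneg
  obtain ⟨B, hB0, hB⟩ := CC_bound (N := T/Y^2) (by positivity) M
  refine ⟨max (5*A/Y*B) (5*A/Y/T*B), fun y => ⟨?_, ?_⟩⟩
  · refine (h.g_bd hT M y).1.trans (le_trans ?_ (le_max_left _ _))
    have := hB y
    gcongr
  · refine (h.g_bd hT M y).2.trans (le_trans ?_ (le_max_right _ _))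
    have := hB y
    gcongr

lemma gph_int {f : ℝ → ℂ} {B : ℝ} (hf : Measurable f) (hB : ∀ y, ‖f y‖ ≤ B) (p q t : ℝ) :
    IntegrableOn (fun y => f y * ph t y) (Set.Icc p q) := by
  refine Measure.integrableOn_of_bounded (M := B) (by simp) ?_ ?_
  · exact (hf.mul (ph_meas_t t)).aestronglyMeasurable
  · refine Filter.Eventually.of_forall fun y => ?_
    rw [norm_mul, ph_norm, mul_one]; exact hB y

lemma gph_cont {f : ℝ → ℂ} {B : ℝ} (hf : Measurable f) (hB : ∀ y, ‖f y‖ ≤ B) (p q : ℝ) :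
    Continuous (fun t => ∫ y in Set.Icc p q, f y * ph t y) := by
  refine continuous_of_dominated (bound := fun _ => B) ?_ ?_ ?_ ?_
  · intro t; exact (hf.mul (ph_meas_t t)).aestronglyMeasurable
  · intro t
    refine Filter.Eventually.of_forall fun y => ?_
    rw [norm_mul, ph_norm, mul_one]; exact hB y
  · simp
  · refine Filter.Eventually.of_forall fun y => ?_
    exact continuous_const.mul (ph_cont_t y)

lemma Blk.Sb_Icc {A Y a a1 a2} (h : Blk A Y a a1 a2) (N : ℝ) (M : ℕ) (t : ℝ) :
    Sb N M a a1 t = ∫ y in Set.Icc Y (4*Y), GG N t a a1 y * (CC N M y : ℂ) := by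
  have hY := h.hY
  unfold Sb
  rw [int_full (a := Y) (b := 4*Y) (by linarith) (fun y hy => by rw [h.GG_zl _ _ hy, zero_mul]) (fun y hy => by rw [h.GG_zr _ _ hy, zero_mul]),
    intervalIntegral.integral_of_le (by linarith), integral_Icc_eq_integral_Ioc]

lemma Blk.Sb_split {A Y a a1 a2} (h : Blk A Y a a1 a2) {T : ℝ} (hT : Y^2 ≤ T) (M : ℕ) (t : ℝ) :
    Sb (T/Y^2) M a a1 t = (∫ y in Set.Icc Y (4*Y), g0 (T/Y^2) M a a1 y * ph t y) + t * ∫ y in Set.Icc Y (4*Y), g1 (T/Y^2) M a y * ph t y := by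
  obtain ⟨B, hB⟩ := h.g_bdd hT M
  obtain ⟨m0, m1⟩ := h.g_meas (T/Y^2) M
  rw [h.Sb_Icc, ← integral_const_mul, ← integral_add (gph_int m0 (fun y => (hB y).1) _ _ _) ((gph_int m1 (fun y => (hB y).2) _ _ _).const_mul _)]
  refine integral_congr_ae (Filter.Eventually.of_forall fun y => ?_)
  simp only [GG, bb, g0, g1]
  push_cast; ring

lemma Blk.Sb_cont {A Y a a1 a2} (h : Blk A Y a a1 a2) {T : ℝ} (hT : Y^2 ≤ T) (M : ℕ) :
    Continuous (Sb (T/Y^2) M a a1) := by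
  obtain ⟨B, hB⟩ := h.g_bdd hT M
  obtain ⟨m0, m1⟩ := h.g_meas (T/Y^2) M
  have : Sb (T/Y^2) M a a1 = fun t => _ := funext fun t => h.Sb_split hT M t
  rw [this]
  exact (gph_cont m0 (fun y => (hB y).1) _ _).add (Complex.continuous_ofReal.mul (gph_cont m1 (fun y => (hB y).2) _ _))

lemma Blk.ms {A Y a a1 a2} (h : Blk A Y a a1 a2) {T : ℝ} (hT : Y^2 ≤ T) (M : ℕ) :
    ∫ t in T..2*T, ‖Sb (T/Y^2) M a a1 t‖^2 ≤ 120000*A^2*Y*(4*(T/Y^2)*(1+Real.log M)^3)*Real.log (1+T) := by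
  have hY := h.hY
  have hT0 : 0 < T := by nlinarith
  have hA := h.toGSym.nonneg
  have hN : 0 < T/Y^2 := by positivity
  obtain ⟨B, hB⟩ := h.g_bdd hT M
  obtain ⟨m0, m1⟩ := h.g_meas (T/Y^2) M
  have k0 := ms_gen hT0 hY m0 (fun y => (hB y).1)
  have k1 := ms_gen hT0 hY m1 (fun y => (hB y).2)
  obtain ⟨BC, hBC0, hBC⟩ := CC_bound hN M
  have iC : IntegrableOn (fun y => (CC (T/Y^2) M y)^2) (Set.Icc Y (4*Y)) := by
    refine Measure.integrableOn_of_bounded (M := BC^2) (by simp) ?_ ?_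
    · exact ((CC_meas _ M).pow_const 2).aestronglyMeasurable
    · refine Filter.Eventually.of_forall fun y => ?_
      rw [norm_pow]
      exact pow_le_pow_left₀ (abs_nonneg _) (hBC y) 2
  have hC := CC_sq_int hN M hY
  set D := 4*(T/Y^2)*(1+Real.log M)^3 with hD
  have sq : ∀ (f : ℝ → ℂ) (c : ℝ), 0 ≤ c → (∀ y, ‖f y‖ ≤ c * |CC (T/Y^2) M y|) →
      ∫ y in Set.Icc Y (4*Y), ‖f y‖^2 ≤ c^2 * (5*Y*D) := by
    intro f c hc hf
    calc ∫ y in Set.Icc Y (4*Y), ‖f y‖^2 ≤ ∫ y in Set.Icc Y (4*Y), c^2 * (CC (T/Y^2) M y)^2 := by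
          refine integral_mono_of_nonneg (Filter.Eventually.of_forall fun y => sq_nonneg _) (iC.const_mul _) (Filter.Eventually.of_forall fun y => ?_)
          simp only
          calc ‖f y‖^2 ≤ (c * |CC (T/Y^2) M y|)^2 := pow_le_pow_left₀ (norm_nonneg _) (hf y) 2
            _ = _ := by rw [mul_pow, sq_abs]
      _ = c^2 * ∫ y in Set.Icc Y (4*Y), (CC (T/Y^2) M y)^2 := integral_const_mul _ _
      _ ≤ _ := by gcongr
  have s0 := sq _ (5*A/Y) (by positivity) (fun y => (h.g_bd hT M y).1)
  have s1 := sq _ (5*A/Y/T) (by positivity) (fun y => (h.g_bd hT M y).2)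
  have c0 := gph_cont m0 (fun y => (hB y).1) Y (4*Y)
  have c1 := gph_cont m1 (fun y => (hB y).2) Y (4*Y)
  have hle : T ≤ 2*T := by linarith
  have hl : 0 ≤ Real.log (1+T) := Real.log_nonneg (by linarith)
  calc ∫ t in T..2*T, ‖Sb (T/Y^2) M a a1 t‖^2 ≤ ∫ t in T..2*T, (2*‖∫ y in Set.Icc Y (4*Y), g0 (T/Y^2) M a a1 y * ph t y‖^2 +
        8*T^2*‖∫ y in Set.Icc Y (4*Y), g1 (T/Y^2) M a y * ph t y‖^2) := by
        refine intervalIntegral.integral_mono_on hle ?_ ?_ ?_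
        · apply Continuous.intervalIntegrable
          have := h.Sb_cont hT M
          fun_prop
        · apply Continuous.intervalIntegrable
          fun_prop
        · intro t ht
          rw [h.Sb_split hT M t]
          set u := ∫ y in Set.Icc Y (4*Y), g0 (T/Y^2) M a a1 y * ph t y
          set v := ∫ y in Set.Icc Y (4*Y), g1 (T/Y^2) M a y * ph t y
          have n1 : ‖u + t*v‖ ≤ ‖u‖ + 2*T*‖v‖ := by
            refine (norm_add_le _ _).trans ?_
            rw [norm_mul, Complex.norm_real, Real.norm_eq_abs, abs_of_nonneg (by linarith [ht.1])]
            gcongr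
            exact ht.2
          calc ‖u + t*v‖^2 ≤ (‖u‖ + 2*T*‖v‖)^2 := pow_le_pow_left₀ (norm_nonneg _) n1 2
            _ ≤ _ := by nlinarith [sq_nonneg (‖u‖ - 2*T*‖v‖)]
    _ = 2*(∫ t in T..2*T, ‖∫ y in Set.Icc Y (4*Y), g0 (T/Y^2) M a a1 y * ph t y‖^2) +
        8*T^2*∫ t in T..2*T, ‖∫ y in Set.Icc Y (4*Y), g1 (T/Y^2) M a y * ph t y‖^2 := by
        rw [intervalIntegral.integral_add, intervalIntegral.integral_const_mul, intervalIntegral.integral_const_mul]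
        · apply Continuous.intervalIntegrable; fun_prop
        · apply Continuous.intervalIntegrable; fun_prop
    _ ≤ 2*(96*Y^2*Real.log (1+T) * ((5*A/Y)^2 * (5*Y*D))) + 8*T^2*(96*Y^2*Real.log (1+T) * ((5*A/Y/T)^2 * (5*Y*D))) := by
        gcongr
        · exact k0.trans (by gcongr)
        · exact k1.trans (by gcongr)
    _ = _ := by field_simp; ring

end TM

namespace TM
open scoped ComplexConjugate

lemma sum_r (f : ℤ → ℝ) {c : ℝ} (hc : 0 ≤ c) (hf : ∀ r : ℤ, r ≠ 0 → f r ≤ c/√|(r:ℝ)|) (m : ℕ) :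
    ∑ r ∈ Finset.Ioo (-((m+1:ℕ):ℤ)) ((m+1:ℕ):ℤ), f r ≤ f 0 + 4*c*√m := by
  induction m with
  | zero =>
    have : Finset.Ioo (-((0+1:ℕ):ℤ)) ((0+1:ℕ):ℤ) = {0} := by decide
    rw [this]; simp
  | succ m ih =>
    have e : Finset.Ioo (-((m+1+1:ℕ):ℤ)) ((m+1+1:ℕ):ℤ) = insert ((m+1:ℕ):ℤ) (insert (-((m+1:ℕ):ℤ)) (Finset.Ioo (-((m+1:ℕ):ℤ)) ((m+1:ℕ):ℤ))) := by
      ext x; simp only [Finset.mem_Ioo, Finset.mem_insert]; push_cast; omega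
    rw [e, Finset.sum_insert (by simp only [Finset.mem_insert, Finset.mem_Ioo]; push_cast; omega), Finset.sum_insert (by simp)]
    have p1 := hf ((m+1:ℕ):ℤ) (by push_cast; omega)
    have p2 := hf (-((m+1:ℕ):ℤ)) (by push_cast; omega)
    have hm : (0:ℝ) < ((m+1:ℕ):ℝ) := by positivity
    have a1 : |(((m+1:ℕ):ℤ):ℝ)| = ((m+1:ℕ):ℝ) := by rw [Int.cast_natCast, abs_of_pos hm]
    have a2 : |((-((m+1:ℕ):ℤ):ℤ):ℝ)| = ((m+1:ℕ):ℝ) := by rw [Int.cast_neg, abs_neg, a1]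
    rw [a1] at p1
    rw [a2] at p2
    set s := √((m+1:ℕ):ℝ) with hs
    have s0 : 0 < s := Real.sqrt_pos.2 hm
    have ss : s^2 = m+1 := by rw [hs, Real.sq_sqrt hm.le]; push_cast; ring
    have qq : (√(m:ℝ))^2 = m := Real.sq_sqrt (by positivity)
    have : 2*(1/s) ≤ 4*(s - √(m:ℝ)) := by
      rw [← mul_div_assoc, div_le_iff₀ s0]
      nlinarith [sq_nonneg (s - √(m:ℝ))]
    have : c*(2*(1/s)) ≤ c*(4*(s - √(m:ℝ))) := by gcongr
    have e3 : c/s = c*(1/s) := by ring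
    nlinarith

lemma hsum {T Y k0 c : ℝ} (hY : 1 < Y) (hN : 0 < T/Y^2) (M : ℕ) {H : ℝ → ℂ} (hH : Continuous H)
    (hl : ∀ y, y ≤ Y → H y = 0) (hr : ∀ y, 4*Y ≤ y → H y = 0) (hc : 0 ≤ c)
    (h0 : ‖∫ y, H y * conj (H y)‖ ≤ k0) (h1 : ∀ r : ℤ, r ≠ 0 → ‖∫ y, H y * conj (H (y+r))‖ ≤ c/√|(r:ℝ)|) :
    ‖∫ y, H y * (CC (T/Y^2) M y : ℂ)‖^2 ≤ (4*(T/Y^2)*(1+Real.log M)^3) * (k0 + 8*c*√Y) := by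
  have L1 : 4*Y ≤ ⌈4*Y⌉₊ := Nat.le_ceil _
  have L2 : (⌈4*Y⌉₊:ℝ) < 4*Y+1 := Nat.ceil_lt_add_one (by linarith)
  have hLp : 0 < ⌈4*Y⌉₊ := Nat.ceil_pos.2 (by linarith)
  obtain ⟨m, hm⟩ : ∃ m, ⌈4*Y⌉₊ = m+1 := ⟨⌈4*Y⌉₊-1, by omega⟩
  rw [hm] at L1 L2
  have p := periodize hN M hH (m+1) (fun y hy => hl y (by linarith)) (fun y hy => hr y (by linarith))
  refine p.trans ?_
  have hlog : 0 ≤ Real.log M := Real.log_natCast_nonneg M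
  refine mul_le_mul_of_nonneg_left ?_ (by positivity)
  have q := sum_r (fun r => ‖∫ y, H y * conj (H (y + r))‖) hc h1 m
  refine q.trans ?_
  have hmY : √(m:ℝ) ≤ 2*√Y := by
    rw [show 2*√Y = √(4*Y) by rw [Real.sqrt_mul (by norm_num), show (4:ℝ) = 2^2 by norm_num, Real.sqrt_sq (by norm_num)]]
    apply Real.sqrt_le_sqrt
    push_cast at L2; linarith
  simp only [Int.cast_zero, add_zero]
  nlinarith

lemma Blk.GG_all {A Y a a1 a2} (h : Blk A Y a a1 a2) {T t : ℝ} (hT : Y^2 ≤ T) (ht : t ∈ Set.Icc T (2*T)) (y : ℝ) :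
    ‖GG (T/Y^2) t a a1 y‖ ≤ 5*A/Y := by
  unfold GG
  rw [norm_mul, ph_norm, mul_one]
  exact h.bb_all hT ht y

lemma int_Icc {g : ℝ → ℂ} {a b : ℝ} (hab : a ≤ b) (hl : ∀ y, y ≤ a → g y = 0) (hr : ∀ y, b ≤ y → g y = 0) :
    ∫ y, g y = ∫ y in Set.Icc a b, g y := by
  rw [int_full hab hl hr, intervalIntegral.integral_of_le hab, integral_Icc_eq_integral_Ioc]

lemma Blk.ker_r2 {A Y a a1 a2} (h : Blk A Y a a1 a2) {T t s : ℝ} (hT : Y^2 ≤ T) (ht : t ∈ Set.Icc T (2*T))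
    (hs : s ∈ Set.Icc T (2*T)) {r : ℝ} (hr : r ≠ 0) :
    ‖∫ y, GG (T/Y^2) t a a1 y * conj (GG (T/Y^2) s a a1 (y+r))‖ ≤ (8000*A^2/√T)/√|r| := by
  have hY := h.hY
  have hT0 : 0 < T := by nlinarith
  have := h.ker_r hT ht hs hr
  rwa [Real.sqrt_mul hT0.le, ← div_div] at this

lemma Blk.sup {A Y a a1 a2} (h : Blk A Y a a1 a2) {T t : ℝ} (hT : Y^2 ≤ T) (ht : t ∈ Set.Icc T (2*T)) (M : ℕ) :
    ‖Sb (T/Y^2) M a a1 t‖^2 ≤ (4*(T/Y^2)*(1+Real.log M)^3) * (75*A^2/Y + 8*(8000*A^2/√T)*√Y) := by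
  have hY := h.hY
  have hT0 : 0 < T := by nlinarith
  have hA := h.toGSym.nonneg
  unfold Sb
  refine hsum hY (by positivity) M (h.GG_cont _ t) (fun y hy => h.GG_zl _ _ hy) (fun y hy => h.GG_zr _ _ hy) (by positivity) ?_ ?_
  · rw [int_full (a := Y) (b := 4*Y) (by linarith) (fun y hy => by rw [h.GG_zl _ _ hy, zero_mul]) (fun y hy => by rw [h.GG_zr _ _ hy, zero_mul])]
    have := intervalIntegral.norm_integral_le_of_norm_le_const (a := Y) (b := 4*Y) (f := fun y => GG (T/Y^2) t a a1 y * conj (GG (T/Y^2) t a a1 y)) (C := (5*A/Y)^2) (by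
      intro y _
      rw [norm_mul, RCLike.norm_conj, ← pow_two]
      exact pow_le_pow_left₀ (norm_nonneg _) (h.GG_all hT ht y) 2)
    refine this.trans (le_of_eq ?_)
    rw [show 4*Y - Y = 3*Y by ring, abs_of_pos (by linarith)]
    field_simp; ring
  · intro r hr
    exact h.ker_r2 hT ht ht (by exact_mod_cast hr)

lemma Blk.GG_meas {A Y a a1 a2} (h : Blk A Y a a1 a2) (N r : ℝ) : Measurable (fun z : ℝ × ℝ => GG N z.1 a a1 (z.2 + r)) := by
  have c0 : Continuous a := continuous_iff_continuousAt.2 fun y => (h.d1 y).continuousAt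
  have c1 : Continuous a1 := continuous_iff_continuousAt.2 fun y => (h.d2 y).continuousAt
  have m0 := c0.measurable
  have m1 := c1.measurable
  have m3 : Measurable (fun z : ℝ × ℝ => ph z.1 (z.2 + r)) := ph_meas.comp (by fun_prop : Measurable fun z : ℝ × ℝ => (z.2 + r, z.1))
  unfold GG bb
  refine Measurable.mul ?_ m3
  fun_prop

lemma Blk.large {A Y a a1 a2} (h : Blk A Y a a1 a2) {T : ℝ} (hT : Y^2 ≤ T) (M : ℕ) {E : Set ℝ} (hE : MeasurableSet E) (hET : E ⊆ Set.Icc T (2*T)) :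
    (∫ t in E, ‖Sb (T/Y^2) M a a1 t‖^2)^2 ≤ (4*(T/Y^2)*(1+Real.log M)^3) *
      (13000*A^2*Real.log (1+T) * (∫ t in E, ‖Sb (T/Y^2) M a a1 t‖^2) + 8*(8000*A^2/√T*(∫ t in E, ‖Sb (T/Y^2) M a a1 t‖)^2)*√Y) := by
  have hY := h.hY
  have hT0 : 0 < T := by nlinarith
  have hA := h.toGSym.nonneg
  have hN : 0 < T/Y^2 := by positivity
  have fin : IsFiniteMeasure (volume.restrict E) := by
    refine ⟨?_⟩
    rw [Measure.restrict_apply_univ]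
    exact (measure_mono hET).trans_lt (by simp)
  set N := T/Y^2 with hNd
  set S := Sb N M a a1 with hS
  have Sc : Continuous S := h.Sb_cont hT M
  set f : ℝ → ℂ := E.indicator (fun t => conj (S t)) with hf
  have fm : Measurable f := ((Complex.continuous_conj.comp Sc).measurable).indicator hE
  obtain ⟨Bf, hBf⟩ : ∃ B, ∀ t, ‖f t‖ ≤ B := by
    obtain ⟨B, hB⟩ := (isCompact_Icc (a := T) (b := 2*T)).exists_bound_of_continuousOn Sc.continuousOn
    have B0 : 0 ≤ B := (norm_nonneg _).trans (hB T ⟨le_rfl, by linarith⟩)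
    refine ⟨B, fun t => ?_⟩
    by_cases ht : t ∈ E
    · rw [hf, Set.indicator_of_mem ht, RCLike.norm_conj]; exact hB t (hET ht)
    · rw [hf, Set.indicator_of_notMem ht, norm_zero]; exact B0
  have fS : ∀ t ∈ E, f t = conj (S t) := fun t ht => by rw [hf, Set.indicator_of_mem ht]
  have n2 : ∫ t in E, ‖f t‖^2 = ∫ t in E, ‖S t‖^2 := setIntegral_congr_fun hE fun t ht => by
    simp only [fS t ht, RCLike.norm_conj]
  have n1 : ∫ t in E, ‖f t‖ = ∫ t in E, ‖S t‖ := setIntegral_congr_fun hE fun t ht => by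
    simp only [fS t ht, RCLike.norm_conj]
  have aeE : ∀ᵐ t ∂(volume.restrict E), t ∈ E := ae_restrict_mem hE
  set H : ℝ → ℂ := fun y => ∫ t in E, f t * GG N t a a1 y with hH
  have gm0 : Measurable (fun z : ℝ × ℝ => GG N z.1 a a1 z.2) := by simpa using h.GG_meas N 0
  have gmy : ∀ y, Measurable (fun t => GG N t a a1 y) := fun y => gm0.comp (by fun_prop : Measurable fun t : ℝ => (t, y))
  have Hc : Continuous H := by
    refine continuous_of_dominated (bound := fun _ => Bf*(5*A/Y)) ?_ ?_ ?_ ?_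
    · intro y; exact (fm.mul (gmy y)).aestronglyMeasurable
    · intro y
      filter_upwards [aeE] with t ht
      rw [norm_mul]
      exact mul_le_mul (hBf t) (h.GG_all hT (hET ht) y) (norm_nonneg _) ((norm_nonneg _).trans (hBf t))
    · exact integrable_const _
    · refine Filter.Eventually.of_forall fun t => ?_
      exact continuous_const.mul (h.GG_cont N t)
  have Hl : ∀ y, y ≤ Y → H y = 0 := fun y hy => by
    simp only [hH, h.GG_zl N _ hy, mul_zero, integral_zero]
  have Hr : ∀ y, 4*Y ≤ y → H y = 0 := fun y hy => by
    simp only [hH, h.GG_zr N _ hy, mul_zero, integral_zero]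
  have hYY : Y ≤ 4*Y := by linarith
  obtain ⟨BC, hBC0, hBC⟩ := CC_bound hN M
  have eQ : ∫ y, H y * (CC N M y : ℂ) = ((∫ t in E, ‖S t‖^2 : ℝ):ℂ) := by
    rw [int_Icc hYY (fun y hy => by rw [Hl y hy, zero_mul]) (fun y hy => by rw [Hr y hy, zero_mul])]
    have e1 : ∀ y, H y * (CC N M y : ℂ) = ∫ t in E, f t * GG N t a a1 y * (CC N M y : ℂ) := fun y => (integral_mul_const _ _).symm
    simp only [e1]
    rw [integral_integral_swap]
    · rw [← integral_complex_ofReal]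
      refine setIntegral_congr_fun hE fun t ht => ?_
      have : ∫ y in Set.Icc Y (4*Y), f t * GG N t a a1 y * (CC N M y : ℂ) = f t * S t := by
        rw [hS, h.Sb_Icc, ← integral_const_mul]
        simp only [mul_assoc]
      rw [this, fS t ht, mul_comm, Complex.mul_conj, Complex.normSq_eq_norm_sq]
    · refine Integrable.of_bound (C := Bf*(5*A/Y)*BC) ?_ ?_
      · have c1 : Measurable (fun z : ℝ × ℝ => (CC N M z.1 : ℂ)) := Complex.measurable_ofReal.comp ((CC_meas N M).comp measurable_fst)
        have c2 : Measurable (fun z : ℝ × ℝ => f z.2) := fm.comp measurable_snd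
        have c3 : Measurable (fun z : ℝ × ℝ => GG N z.2 a a1 z.1) := gm0.comp measurable_swap
        exact ((c2.mul c3).mul c1).aestronglyMeasurable
      · have : ∀ᵐ z ∂((volume.restrict (Set.Icc Y (4*Y))).prod (volume.restrict E)), z.2 ∈ E :=
          Measure.quasiMeasurePreserving_snd.ae aeE
        filter_upwards [this] with z hz
        simp only [Function.uncurry]
        rw [norm_mul, norm_mul, Complex.norm_real]
        have b0 : 0 ≤ Bf := (norm_nonneg _).trans (hBf 0)
        have b1 := hBf z.2
        have b2 := h.GG_all hT (hET hz) z.1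
        have b3 := hBC z.1
        rw [← Real.norm_eq_abs] at b3
        have : 0 ≤ 5*A/Y := by positivity
        gcongr
  have key := hsum (k0 := 13000*A^2*Real.log (1+T) * (∫ t in E, ‖S t‖^2)) (c := 8000*A^2/√T*(∫ t in E, ‖S t‖)^2) hY hN M Hc Hl Hr (by positivity) ?_ ?_
  · rw [eQ, Complex.norm_real, Real.norm_eq_abs, sq_abs] at key
    exact key
  · rw [int_Icc hYY (fun y hy => by rw [Hl y hy, zero_mul]) (fun y hy => by rw [Hr y hy, zero_mul])]
    have := tf_log hE (p := T) (q := 2*T) (c := 1) (c0 := 6500*A^2) (by linarith) hET one_pos (by positivity)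
      (ν := volume.restrict (Set.Icc Y (4*Y))) fm hBf (g := fun t y => GG N t a a1 y) gm0 (fun t ht b => h.GG_all hT (hET ht) b) (by
        intro t ht s hs
        rw [one_mul, ← int_Icc hYY (fun y hy => by rw [h.GG_zl _ _ hy, zero_mul]) (fun y hy => by rw [h.GG_zr _ _ hy, zero_mul])]
        exact h.ker_0 hT (hET ht) (hET hs))
    refine this.trans (le_of_eq ?_)
    rw [n2]; ring_nf
  · intro r hr
    have hr' : (r:ℝ) ≠ 0 := by exact_mod_cast hr
    rw [int_Icc hYY (fun y hy => by rw [Hl y hy, zero_mul]) (fun y hy => by rw [Hr y hy, zero_mul])]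
    have ae2 : ∀ᵐ z ∂((volume.restrict E).prod (volume.restrict E)), z.1 ∈ E ∧ z.2 ∈ E :=
      (Measure.quasiMeasurePreserving_fst.ae aeE).and (Measure.quasiMeasurePreserving_snd.ae aeE)
    have := tf (μ := volume.restrict E) (ν := volume.restrict (Set.Icc Y (4*Y))) fm hBf (g1 := fun t y => GG N t a a1 y)
      (g2 := fun t y => GG N t a a1 (y+r)) (Bg := 5*A/Y) gm0 (h.GG_meas N r)
      (by filter_upwards [aeE] with t ht b using h.GG_all hT (hET ht) b)
      (by filter_upwards [aeE] with t ht b using h.GG_all hT (hET ht) _)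
      (K := fun _ _ => (8000*A^2/√T)/√|(r:ℝ)|) measurable_const (BK := abs ((8000*A^2/√T)/√|(r:ℝ)|)) (fun _ _ => le_rfl) (by
        filter_upwards [ae2] with z hz
        rw [← int_Icc hYY (fun y hy => by rw [h.GG_zl _ _ hy, zero_mul]) (fun y hy => by rw [h.GG_zr _ _ hy, zero_mul])]
        exact h.ker_r2 hT (hET hz.1) (hET hz.2) hr')
    refine this.trans (le_of_eq ?_)
    rw [integral_mul_const, integral_prod_mul (fun t => ‖f t‖) (fun t => ‖f t‖), n1]
    ring

end TM

namespace TM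

set_option maxHeartbeats 1000000 in
lemma Blk.cube {A Y a a1 a2} (h : Blk A Y a a1 a2) (hA1 : 1 ≤ A) {T : ℝ} (hT : Y^2 ≤ T) (M : ℕ) {Λ : ℝ} (hΛ : Λ = 4*(1+Real.log M)^3)
    (hc : 128000*A^2*Λ*√T ≤ Y^3*√Y) :
    ∫ t in T..2*T, ‖Sb (T/Y^2) M a a1 t‖^3 ≤ 10000000*A^3*Λ^2*Real.log (1+T)*T := by
  have hY := h.hY
  have hT0 : 0 < T := by nlinarith
  have hlog : 0 ≤ Real.log M := Real.log_natCast_nonneg M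
  have hΛ1 : 1 ≤ Λ := by
    have : 1 ≤ (1+Real.log M)^3 := one_le_pow₀ (by linarith)
    linarith
  have hℓ : 0 ≤ Real.log (1+T) := Real.log_nonneg (by linarith)
  have hle : T ≤ 2*T := by linarith
  have Sc := h.Sb_cont hT M
  have ms := h.ms hT M
  have sup := fun t ht => h.sup (t := t) hT ht M
  have eD : 4*(T/Y^2)*(1+Real.log M)^3 = Λ*(T/Y^2) := by rw [hΛ]; ring
  have lg := fun E hE hET => h.large (E := E) hT M hE hET
  simp only [eD] at ms sup lg
  set S := Sb (T/Y^2) M a a1 with hS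
  set ℓ := Real.log (1+T) with hℓd
  set u := √Y with hu
  set v := √T with hv
  have u1 : 1 ≤ u := Real.one_le_sqrt.2 hY.le
  have v0 : 0 < v := Real.sqrt_pos.2 hT0
  have uY : Y = u^2 := (Real.sq_sqrt (by linarith)).symm
  have vT : T = v^2 := (Real.sq_sqrt hT0.le).symm
  have hvu : v ≤ u^7 := by
    have : v ≤ 128000*A^2*Λ*v := by
      have : 1 ≤ A^2 := one_le_pow₀ hA1
      have : 1 ≤ 128000*A^2*Λ := by nlinarith
      nlinarith
    calc v ≤ _ := this
      _ ≤ _ := hc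
      _ = _ := by rw [uY]; ring
  set P := √(Λ*(T/Y^2) * (75*A^2/Y + 8*(8000*A^2/v)*u)) with hP
  have P0 : 0 ≤ P := Real.sqrt_nonneg _
  have SP : ∀ t ∈ Set.Icc T (2*T), ‖S t‖ ≤ P := fun t ht => Real.le_sqrt_of_sq_le (sup t ht)
  have PT : P*(T/Y^2) ≤ 254*A*Λ*T := by
    refine (sq_le_sq₀ (by positivity) (by positivity)).1 ?_
    rw [mul_pow, Real.sq_sqrt (by positivity)]
    have b1 : v^2/u^14 ≤ 1 := by
      rw [div_le_one (by positivity)]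
      calc v^2 ≤ (u^7)^2 := pow_le_pow_left₀ v0.le hvu 2
        _ = _ := by ring
    have b2 : v/u^11 ≤ 1 := by
      rw [div_le_one (by positivity)]
      exact hvu.trans (pow_le_pow_right₀ u1 (by norm_num))
    have e : Λ*(T/Y^2) * (75*A^2/Y + 8*(8000*A^2/v)*u)*(T/Y^2)^2 = Λ*A^2*T^2*(75*(v^2/u^14) + 64000*(v/u^11)) := by
      rw [uY, vT]; field_simp; ring
    rw [e]
    calc Λ*A^2*T^2*(75*(v^2/u^14) + 64000*(v/u^11)) ≤ (Λ*Λ)*A^2*T^2*(75*1+64000*1) := by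
          gcongr
          nlinarith
      _ ≤ _ := by
          have : 0 ≤ (Λ*Λ)*A^2*T^2 := by positivity
          nlinarith
  set E := Set.Icc T (2*T) ∩ {t | Y < ‖S t‖} with hEd
  have hE : MeasurableSet E := measurableSet_Icc.inter (isOpen_lt continuous_const Sc.norm).measurableSet
  have hET : E ⊆ Set.Icc T (2*T) := Set.inter_subset_left
  have iS : ∀ n, IntegrableOn (fun t => ‖S t‖^n) (Set.Icc T (2*T)) := fun n => (Sc.norm.pow n).continuousOn.integrableOn_compact isCompact_Icc
  have L := lg E hE hET
  set Q := ∫ t in E, ‖S t‖^2 with hQ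
  have Q0 : 0 ≤ Q := integral_nonneg fun t => sq_nonneg _
  have R0 : 0 ≤ ∫ t in E, ‖S t‖ := integral_nonneg fun t => norm_nonneg _
  have R : ∫ t in E, ‖S t‖ ≤ Q/Y := by
    rw [hQ, ← integral_div]
    refine setIntegral_mono_on ?_ (((iS 2).mono_set hET).div_const _) hE fun t ht => ?_
    · have := (iS 1).mono_set hET; simpa using this
    · rw [le_div_iff₀ (by linarith)]
      have := ht.2
      change Y < ‖S t‖ at this
      nlinarith [norm_nonneg (S t)]
  have Qb : Q ≤ 26000*A^2*Λ*ℓ*(T/Y^2) := by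
    have R2 : (∫ t in E, ‖S t‖)^2 ≤ (Q/Y)^2 := pow_le_pow_left₀ R0 R 2
    have c1 : Λ*(T/Y^2)*(8*(8000*A^2/v*(Q/Y)^2)*u) ≤ Q^2/2 := by
      have e : Λ*(T/Y^2)*(8*(8000*A^2/v*(Q/Y)^2)*u) = (128000*A^2*Λ*v)*Q^2/(2*u^7) := by
        rw [uY, vT]; field_simp; ring
      rw [e, div_le_div_iff₀ (by positivity) (by norm_num)]
      have : 128000*A^2*Λ*v ≤ u^7 := hc.trans (le_of_eq (by rw [uY]; ring))
      nlinarith [mul_le_mul_of_nonneg_right this (sq_nonneg Q)]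
    have c2 : Λ*(T/Y^2)*(8*(8000*A^2/v*(∫ t in E, ‖S t‖)^2)*u) ≤ Λ*(T/Y^2)*(8*(8000*A^2/v*(Q/Y)^2)*u) := by gcongr
    have c3 : Q*Q ≤ Q*(26000*A^2*Λ*ℓ*(T/Y^2)) := by nlinarith
    rcases eq_or_lt_of_le Q0 with hq | hq
    · rw [← hq]; positivity
    · exact le_of_mul_le_mul_left c3 hq
  have iI : IntegrableOn (E.indicator fun t => ‖S t‖^2) (Set.Icc T (2*T)) := (iS 2).indicator hE
  have eI : ∫ t in Set.Icc T (2*T), E.indicator (fun t => ‖S t‖^2) t = Q := by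
    rw [setIntegral_indicator hE, Set.inter_eq_self_of_subset_right hET]
  rw [intervalIntegral.integral_of_le hle, ← integral_Icc_eq_integral_Ioc] at ms ⊢
  calc ∫ t in Set.Icc T (2*T), ‖S t‖^3 ≤ ∫ t in Set.Icc T (2*T), (Y*‖S t‖^2 + P*E.indicator (fun t => ‖S t‖^2) t) := by
        refine setIntegral_mono_on (iS 3) (((iS 2).const_mul _).add (iI.const_mul _)) measurableSet_Icc fun t ht => ?_
        by_cases hy : Y < ‖S t‖
        · rw [Set.indicator_of_mem (show t ∈ E from ⟨ht, hy⟩)]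
          have := SP t ht
          have : ‖S t‖^3 ≤ P*‖S t‖^2 := by
            calc ‖S t‖^3 = ‖S t‖*‖S t‖^2 := by ring
              _ ≤ _ := by gcongr
          have : 0 ≤ Y*‖S t‖^2 := by positivity
          linarith
        · rw [Set.indicator_of_notMem (show t ∉ E from fun h => hy h.2), mul_zero, add_zero]
          calc ‖S t‖^3 = ‖S t‖*‖S t‖^2 := by ring
            _ ≤ _ := by gcongr; exact not_lt.1 hy
    _ = Y*(∫ t in Set.Icc T (2*T), ‖S t‖^2) + P*Q := by
        rw [integral_add ((iS 2).const_mul _) (iI.const_mul _), integral_const_mul, integral_const_mul, eI]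
    _ ≤ Y*(120000*A^2*Y*(Λ*(T/Y^2))*ℓ) + P*(26000*A^2*Λ*ℓ*(T/Y^2)) := by gcongr
    _ = 120000*A^2*Λ*T*ℓ + (26000*A^2*Λ*ℓ)*(P*(T/Y^2)) := by field_simp
    _ ≤ 120000*A^2*Λ*T*ℓ + (26000*A^2*Λ*ℓ)*(254*A*Λ*T) :=
        add_le_add_right (mul_le_mul_of_nonneg_left PT (by positivity)) _
    _ ≤ 120000*(A^2*A)*(Λ*Λ)*T*ℓ + (26000*A^2*Λ*ℓ)*(254*A*Λ*T) := by
        have : A^2 ≤ A^2*A := by nlinarith [sq_nonneg A]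
        have : Λ ≤ Λ*Λ := by nlinarith
        gcongr
    _ ≤ _ := by
        have : 0 ≤ A^3*Λ^2*ℓ*T := by positivity
        nlinarith

end TM

namespace TM

noncomputable def Lf (X : ℕ) (t : ℝ) (s : Finset ℕ) (f : ℝ → ℝ) : ℂ :=
  ∑ h ∈ s, (-1:ℂ)^h * ∑ n ∈ Finset.Icc 1 (X-h), (1/(h:ℂ)) * ((f (n/h+1/2) : ℂ) * ph t (n/h + 1/2))

lemma Lf_add (X : ℕ) (t : ℝ) (s : Finset ℕ) (f g : ℝ → ℝ) : Lf X t s (fun y => f y + g y) = Lf X t s f + Lf X t s g := by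
  unfold Lf
  rw [← Finset.sum_add_distrib]
  refine Finset.sum_congr rfl fun h _ => ?_
  rw [← mul_add, ← Finset.sum_add_distrib]
  congr 1
  refine Finset.sum_congr rfl fun n _ => ?_
  push_cast; ring

lemma a0_small {G Y : ℝ} (hG : 0 < G) (hY : 1 < Y) {X n h : ℕ} (hn : 1 ≤ n) (hh : 1 ≤ h) (hX : h ≤ X) :
    |a0 G (n/h+1/2) - ss (((n:ℝ)/h+1/2)/Y) * a0 G (n/h+1/2)| ≤ X * Real.exp (-((G/Y)^2/36)) := by
  set y : ℝ := n/h+1/2 with hy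
  have hn' : (1:ℝ) ≤ n := by exact_mod_cast hn
  have hh' : (1:ℝ) ≤ h := by exact_mod_cast hh
  have hX' : (h:ℝ) ≤ X := by exact_mod_cast hX
  have hX1 : (1:ℝ) ≤ X := hh'.trans hX'
  have hy0 : (1:ℝ)/X ≤ y - 1/2 := by
    rw [hy, add_sub_cancel_right]
    gcongr
  have hyp : 0 < y - 1/2 := lt_of_lt_of_le (by positivity) hy0
  rcases le_total (2*Y) y with h2 | h2
  · rw [ss_one (by rw [le_div_iff₀ (by linarith)]; exact h2)]
    simp; positivity
  have a0n : 0 ≤ a0 G y := by unfold a0; positivity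
  have e1 : a0 G y - ss (y/Y) * a0 G y = (1 - ss (y/Y)) * a0 G y := by ring
  rw [e1, abs_mul, abs_of_nonneg a0n, abs_of_nonneg (by linarith [ss_le (y/Y)])]
  have s1 : (1 - ss (y/Y)) * a0 G y ≤ 1 * a0 G y := by
    gcongr; linarith [ss_nonneg (y/Y)]
  refine s1.trans ?_
  rw [one_mul]
  unfold a0
  have sq : (1:ℝ)/X ≤ √(y^2-1/4) := by
    apply Real.le_sqrt_of_sq_le
    have : (1:ℝ)/X ≤ 1 := by rw [div_le_one (by linarith)]; exact hX1
    have x0 : (0:ℝ) < 1/X := by positivity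
    nlinarith
  have h1p : 0 < y + 1/2 := by linarith
  have pl : 1/(3*Y) ≤ psi y := by
    have : 1/(y+1/2) ≤ psi y := by
      unfold psi
      rw [← Real.log_div h1p.ne' hyp.ne']
      have := Real.one_sub_inv_le_log_of_pos (x := (y+1/2)/(y-1/2)) (by positivity)
      have e : 1 - ((y+1/2)/(y-1/2))⁻¹ = 1/(y+1/2) := by rw [inv_div, eq_div_iff h1p.ne', sub_mul, div_mul_cancel₀ _ h1p.ne']; ring
      rw [e] at this; exact this
    refine le_trans ?_ this
    gcongr; linarith
  have x2 : (G/Y)^2/36 ≤ G^2/4*psi y^2 := by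
    calc (G/Y)^2/36 = G^2/4*(1/(3*Y))^2 := by field_simp; ring
      _ ≤ _ := by gcongr
  rw [div_le_iff₀ (lt_of_lt_of_le (by positivity) sq)]
  calc Real.exp (-(G^2/4*psi y^2)) ≤ Real.exp (-((G/Y)^2/36)) := by gcongr
    _ = X * Real.exp (-((G/Y)^2/36)) * (1/X) := by field_simp
    _ ≤ _ := by gcongr

lemma part_a {G Y : ℝ} (hG : 0 < G) (hY : 1 < Y) (X : ℕ) (t : ℝ) :
    ‖Lf X t (Finset.Icc 1 X) (fun y => a0 G y - ss (y/Y) * a0 G y)‖ ≤ (X:ℝ)^3 * Real.exp (-((G/Y)^2/36)) := by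
  unfold Lf
  set e := Real.exp (-((G/Y)^2/36))
  have e0 : 0 < e := Real.exp_pos _
  calc _ ≤ ∑ h ∈ Finset.Icc 1 X, (X:ℝ)*(X*e) := by
        refine norm_sum_le_of_le _ fun h hh => ?_
        rw [Finset.mem_Icc] at hh
        have hh' : (1:ℝ) ≤ h := by exact_mod_cast hh.1
        rw [norm_mul, norm_pow, norm_neg, norm_one, one_pow, one_mul]
        calc _ ≤ ∑ n ∈ Finset.Icc 1 (X-h), (X*e) := by
              refine norm_sum_le_of_le _ fun n hn => ?_
              rw [Finset.mem_Icc] at hn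
              rw [norm_mul, norm_mul, ph_norm, mul_one, Complex.norm_real, Real.norm_eq_abs]
              have n1 : ‖(1:ℂ)/h‖ ≤ 1 := by
                rw [norm_div, norm_one, Complex.norm_natCast]
                rw [div_le_one (by linarith)]; exact hh'
              calc _ ≤ 1 * (X*e) := mul_le_mul n1 (a0_small hG hY hn.1 hh.1 hh.2) (abs_nonneg _) zero_le_one
                _ = _ := one_mul _
          _ = ((X-h:ℕ):ℝ)*(X*e) := by rw [Finset.sum_const, Nat.card_Icc, nsmul_eq_mul]; simp
          _ ≤ _ := by
              have : ((X-h:ℕ):ℝ) ≤ X := by exact_mod_cast Nat.sub_le X h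
              gcongr
    _ = _ := by rw [Finset.sum_const, Nat.card_Icc, nsmul_eq_mul]; simp; ring

lemma sq_tail {H X : ℕ} (hH : 1 ≤ H) : ∑ h ∈ Finset.Ioc H X, 1/(h:ℝ)^2 ≤ 1/(H:ℝ) := by
  rcases le_total H X with h | h
  · have := sum_Ioc_inv_sq_le_sub (α := ℝ) (k := H) (n := X) (by omega) h
    simp only [one_div]
    refine this.trans ?_
    have : (0:ℝ) ≤ (X:ℝ)⁻¹ := by positivity
    linarith
  · rw [Finset.Ioc_eq_empty (by omega)]; simp

lemma sq_head (H : ℕ) : ∑ h ∈ Finset.Ioc 0 H, 1/(h:ℝ)^2 ≤ 2 := by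
  rcases Nat.eq_zero_or_pos H with rfl | h
  · simp
  · have : Finset.Ioc 0 H = insert 1 (Finset.Ioc 1 H) := by ext x; simp only [Finset.mem_Ioc, Finset.mem_insert]; omega
    rw [this, Finset.sum_insert (by simp)]
    have := sq_tail (H := 1) (X := H) le_rfl
    norm_num at this ⊢; linarith

lemma telescope {G Y : ℝ} (X H : ℕ) (t : ℝ) (n : ℕ) :
    Lf X t (Finset.Icc 1 H) (fun y => ss (y/Y) * a0 G y) =
      ∑ j ∈ Finset.range n, Lf X t (Finset.Icc 1 H) (fun y => ss (y/(2^j*Y)) * a0 G y - ss (y/(2*(2^j*Y))) * a0 G y) +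
        Lf X t (Finset.Icc 1 H) (fun y => ss (y/(2^n*Y)) * a0 G y) := by
  induction n with
  | zero => simp
  | succ n ih =>
    rw [ih, Finset.sum_range_succ, add_assoc, ← Lf_add]
    congr 2
    funext y
    rw [show (2:ℝ)^(n+1)*Y = 2*(2^n*Y) by ring]; ring

lemma off_bound {A : ℝ} (hA : 1 ≤ A) (hg : ∀ G Y : ℝ, 1 < Y → ∃ f1 f2, GSym A Y (fun y => ss (y/Y) * a0 G y) f1 f2)
    {G Y T t : ℝ} (hG : 0 < G) (hY : 1 < Y) (hT : 1 ≤ T) (ht : t ∈ Set.Icc T (2*T)) {a1 a2 : ℕ → ℝ → ℝ}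
    {n : ℕ} (hb : ∀ j : ℕ, Blk A (2^j*Y) (fun y => ss (y/(2^j*Y)) * a0 G y - ss (y/(2*(2^j*Y))) * a0 G y) (a1 j) (a2 j))
    (hn : T ≤ (2^n*Y)^2) (hj : ∀ j < n, (2^j*Y)^2 ≤ T) {X H : ℕ} (hTH : T^2 ≤ H) (hX : 5*T*H ≤ X) :
    ‖Off X t G‖ ≤ (X:ℝ)^3 * Real.exp (-((G/Y)^2/36)) + (2*(A*Real.log (2*X)) + 75*A) +
      ∑ j ∈ Finset.range n, (‖Sb (T/(2^j*Y)^2) H (fun y => ss (y/(2^j*Y)) * a0 G y - ss (y/(2*(2^j*Y))) * a0 G y) (a1 j) t‖ + 3*A) := by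
  have hH1 : (1:ℝ) ≤ H := le_trans (by nlinarith) hTH
  have hH1' : 1 ≤ H := by exact_mod_cast hH1
  have hHX' : (H:ℝ) ≤ X := by nlinarith
  have hHX : H ≤ X := by exact_mod_cast hHX'
  have ht0 : 0 ≤ t := by linarith [ht.1]
  have hY2n : 1 < 2^n*Y := by
    have : (1:ℝ) ≤ 2^n := one_le_pow₀ (by norm_num)
    nlinarith
  have t2 : t^2 ≤ 4*T^2 := by nlinarith [ht.1, ht.2]
  have e0 : Off X t G = Lf X t (Finset.Icc 1 X) (a0 G) := rfl
  have e1 : Lf X t (Finset.Icc 1 X) (a0 G) = Lf X t (Finset.Icc 1 X) (fun y => a0 G y - ss (y/Y) * a0 G y) +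
      Lf X t (Finset.Icc 1 X) (fun y => ss (y/Y) * a0 G y) := by
    rw [← Lf_add]; congr 1; funext y; ring
  have e2 : Lf X t (Finset.Icc 1 X) (fun y => ss (y/Y) * a0 G y) = Lf X t (Finset.Icc 1 H) (fun y => ss (y/Y) * a0 G y) +
      Lf X t (Finset.Ioc H X) (fun y => ss (y/Y) * a0 G y) := by
    have : Finset.Icc 1 X = Finset.Icc 1 H ∪ Finset.Ioc H X := by
      ext x; simp only [Finset.mem_union, Finset.mem_Icc, Finset.mem_Ioc]; omega
    unfold Lf
    rw [this, Finset.sum_union]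
    rw [Finset.disjoint_left]; intro x; simp only [Finset.mem_Icc, Finset.mem_Ioc]; omega
  have e3 := telescope (G := G) (Y := Y) X H t n
  rw [e0, e1, e2, e3]
  have p1 := part_a hG hY X t
  have p2 : ‖Lf X t (Finset.Ioc H X) (fun y => ss (y/Y) * a0 G y)‖ ≤ A*Real.log (2*X) + 25*A := by
    obtain ⟨f1, f2, hf⟩ := hg G Y hY
    have := em_bound hY hf ht0 X (hH1'.trans hHX) H X le_rfl
    refine this.trans ?_
    have b1 : 5*A*(1/Y^2 + t^2/Y^4) ≤ 5*A*(1 + 4*T^2) := by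
      gcongr
      · rw [div_le_one (by positivity)]; nlinarith
      · exact (div_le_self (sq_nonneg t) (one_le_pow₀ hY.le)).trans t2
    have b2 : (∑ h ∈ Finset.Ioc H X, 1/(h:ℝ)^2) * (5*A*(1/Y^2 + t^2/Y^4)) ≤ 1/(H:ℝ) * (5*A*(1+4*T^2)) :=
      mul_le_mul (sq_tail hH1') b1 (by positivity) (by positivity)
    have b3 : 1/(H:ℝ) * (5*A*(1+4*T^2)) ≤ 25*A := by
      rw [one_div, inv_mul_le_iff₀ (by positivity)]
      nlinarith
    linarith
  have p3 : ‖Lf X t (Finset.Icc 1 H) (fun y => ss (y/(2^n*Y)) * a0 G y)‖ ≤ A*Real.log (2*X) + 50*A := by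
    obtain ⟨f1, f2, hf⟩ := hg G (2^n*Y) hY2n
    have := em_bound hY2n hf ht0 X (hH1'.trans hHX) 0 H hHX
    refine this.trans ?_
    have b1 : 5*A*(1/(2^n*Y)^2 + t^2/(2^n*Y)^4) ≤ 5*A*(1 + 4) := by
      gcongr
      · rw [div_le_one (by positivity)]; linarith
      · rw [div_le_iff₀ (by positivity)]
        nlinarith
    have b2 : (∑ h ∈ Finset.Ioc 0 H, 1/(h:ℝ)^2) * (5*A*(1/(2^n*Y)^2 + t^2/(2^n*Y)^4)) ≤ 2 * (5*A*(1+4)) :=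
      mul_le_mul (sq_head H) b1 (by positivity) (by positivity)
    linarith
  have p4 : ‖∑ j ∈ Finset.range n, Lf X t (Finset.Icc 1 H) (fun y => ss (y/(2^j*Y)) * a0 G y - ss (y/(2*(2^j*Y))) * a0 G y)‖ ≤
      ∑ j ∈ Finset.range n, (‖Sb (T/(2^j*Y)^2) H (fun y => ss (y/(2^j*Y)) * a0 G y - ss (y/(2*(2^j*Y))) * a0 G y) (a1 j) t‖ + 3*A) := by
    refine norm_sum_le_of_le _ fun j hj' => ?_
    have hY2 := hj j (Finset.mem_range.1 hj')
    refine (hb j).sum_eq (by positivity) X H hHX ?_ t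
    have : 2^j*Y ≤ T := by
      have := (hb j).hY
      nlinarith
    have : 2^j*Y*H ≤ T*H := by gcongr
    nlinarith
  refine (norm_add_le _ _).trans ?_
  have := norm_add_le (∑ j ∈ Finset.range n, Lf X t (Finset.Icc 1 H) (fun y => ss (y/(2^j*Y)) * a0 G y - ss (y/(2*(2^j*Y))) * a0 G y) +
        Lf X t (Finset.Icc 1 H) (fun y => ss (y/(2^n*Y)) * a0 G y)) (Lf X t (Finset.Ioc H X) (fun y => ss (y/Y) * a0 G y))
  have q := norm_add_le (∑ j ∈ Finset.range n, Lf X t (Finset.Icc 1 H) (fun y => ss (y/(2^j*Y)) * a0 G y - ss (y/(2*(2^j*Y))) * a0 G y))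
        (Lf X t (Finset.Icc 1 H) (fun y => ss (y/(2^n*Y)) * a0 G y))
  linarith

end TM

namespace TM

lemma J_nonneg (k : ℕ) (t : ℝ) {G : ℝ} (hG : 0 < G) : 0 ≤ J k t G := by
  unfold J
  refine mul_nonneg (by positivity) (integral_nonneg fun u => ?_)
  simp only [Pi.zero_apply]; positivity

lemma blocks {T Y : ℝ} (hT : 1 ≤ T) (hY : 1 < Y) :
    ∃ n : ℕ, T ≤ (2^n*Y)^2 ∧ (∀ j < n, (2^j*Y)^2 ≤ T) ∧ (n:ℝ) ≤ 1 + Real.log T := by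
  classical
  have ex : ∃ n : ℕ, T ≤ (2^n*Y)^2 := by
    obtain ⟨n, hn⟩ := pow_unbounded_of_one_lt T (by norm_num : (1:ℝ) < 2)
    refine ⟨n, ?_⟩
    have h1 : T ≤ 2^n*Y := by nlinarith
    nlinarith
  refine ⟨Nat.find ex, Nat.find_spec ex, fun j hj => (not_le.1 (Nat.find_min ex hj)).le, ?_⟩
  rcases Nat.eq_zero_or_pos (Nat.find ex) with h0 | h0
  · rw [h0]; simp; linarith [Real.log_nonneg hT]
  · obtain ⟨m, hm⟩ : ∃ m, Nat.find ex = m+1 := ⟨Nat.find ex - 1, by omega⟩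
    have := not_le.1 (Nat.find_min ex (m := m) (by omega))
    rw [hm]
    have p1 : (1:ℝ) ≤ 2^m := one_le_pow₀ (by norm_num)
    have h2 : ((2:ℝ)^m)^2 ≤ T := by
      refine le_trans ?_ this.le
      rw [mul_pow]
      exact le_mul_of_one_le_right (by positivity) (one_le_pow₀ hY.le)
    have h3 := Real.log_le_log (by positivity) h2
    rw [Real.log_pow, Real.log_pow] at h3
    have := Real.log_two_gt_d9
    push_cast at h3 ⊢
    have m0 : (0:ℝ) ≤ m := by positivity
    nlinarith

lemma cube_sum (n : ℕ) (f : ℕ → ℝ) (hf : ∀ j, 0 ≤ f j) : (∑ j ∈ Finset.range n, f j)^3 ≤ (n:ℝ)^2 * ∑ j ∈ Finset.range n, f j^3 := by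
  have := pow_sum_le_card_mul_sum_pow (s := Finset.range n) (f := f) (fun j _ => hf j) 2
  rwa [Finset.card_range] at this

set_option maxHeartbeats 1600000 in
lemma main_big {A : ℝ} (hA : 1 ≤ A) (hg : ∀ G Y : ℝ, 1 < Y → ∃ f1 f2, GSym A Y (fun y => ss (y/Y) * a0 G y) f1 f2)
    (hbl : ∀ G Y : ℝ, 1 < Y → ∃ a1 a2, Blk A Y (fun y => ss (y/Y) * a0 G y - ss (y/(2*Y)) * a0 G y) a1 a2)
    {ε T G : ℝ} (hε : 0 < ε) (hT : 100 ≤ T) (hG1 : T^(1/7+ε) ≤ G) (hG2 : G ≤ T)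
    (c2 : 128000*A^2*(256*(1+Real.log T)^3) ≤ T^(7/4*ε))
    (c3 : (64*T^5)^3*Real.exp (-((T^(ε/2))^2/36)) ≤ 1) :
    ∫ t in T..2*T, J 1 t G^3 ≤ 10^18*A^3*(1+Real.log T)^10*T := by
  have hT0 : 0 < T := by linarith
  set Y := G/T^(ε/2) with hYd
  have hTe : 0 < T^(ε/2) := Real.rpow_pos_of_pos hT0 _
  have hYl : T^(1/7+ε/2) ≤ Y := by
    rw [hYd, le_div_iff₀ hTe, ← Real.rpow_add hT0]
    rw [show 1/7+ε/2+ε/2 = 1/7+ε by ring]; exact hG1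
  have hY : 1 < Y := lt_of_lt_of_le (Real.one_lt_rpow (by linarith) (by positivity)) hYl
  have hG : 0 < G := lt_of_lt_of_le (Real.rpow_pos_of_pos hT0 _) hG1
  have hGY : G/Y = T^(ε/2) := by rw [hYd]; field_simp
  obtain ⟨n, hn1, hn2, hn3⟩ := blocks (by linarith : 1 ≤ T) hY
  have hYj : ∀ j : ℕ, Y ≤ 2^j*Y := fun j => by
    have : (1:ℝ) ≤ 2^j := one_le_pow₀ (by norm_num)
    nlinarith
  choose a1 a2 hb using fun j : ℕ => hbl G (2^j*Y) (lt_of_lt_of_le hY (hYj j))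
  set ℓ := 1+Real.log T with hℓ
  have ℓ1 : 1 ≤ ℓ := by linarith [Real.log_nonneg (by linarith : 1 ≤ T)]
  set m := ⌈T⌉₊ with hm
  have m1 : T ≤ m := Nat.le_ceil _
  have m2 : (m:ℝ) ≤ 2*T := by linarith [Nat.ceil_lt_add_one hT0.le]
  have m3 : (100:ℝ) ≤ m := hT.trans m1
  have m0 : (0:ℝ) < m := by linarith
  have l2 := Real.log_two_lt_d9
  have lm : Real.log m ≤ ℓ := by
    refine (Real.log_le_log m0 m2).trans ?_
    rw [Real.log_mul (by norm_num) hT0.ne', hℓ]; linarith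
  have lm0 : 0 ≤ Real.log m := Real.log_natCast_nonneg m
  set X := 2*m^5 with hX
  have hXc : (X:ℝ) = 2*(m:ℝ)^5 := by rw [hX]; push_cast; ring
  have hXT : (X:ℝ) ≤ 64*T^5 := by
    rw [hXc]
    calc 2*(m:ℝ)^5 ≤ 2*(2*T)^5 := by gcongr
      _ = _ := by ring
  have X0 : (0:ℝ) < X := by rw [hXc]; positivity
  have lX2 : Real.log (2*X) ≤ 5*ℓ := by
    have : Real.log (2*X) ≤ Real.log (2^7*T^5) := Real.log_le_log (by positivity) (by linarith)
    refine this.trans ?_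
    rw [Real.log_mul (by norm_num) (by positivity), Real.log_pow, Real.log_pow]
    push_cast; linarith
  have lX : Real.log X ≤ 5*ℓ := (Real.log_le_log X0 (by linarith)).trans lX2
  set S : ℕ → ℝ → ℝ := fun j t => ‖Sb (T/(2^j*Y)^2) (m^3) (fun y => ss (y/(2^j*Y)) * a0 G y - ss (y/(2*(2^j*Y))) * a0 G y) (a1 j) t‖ with hS
  have hJ : ∀ t ∈ Set.Icc T (2*T), J 1 t G ≤ 3400*A*ℓ + 26*∑ j ∈ Finset.range n, S j t := by
    intro t ht
    have k1 := J_le t G hG (m^5) (Nat.one_le_pow _ _ (by exact_mod_cast m0))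
    rw [← hX] at k1
    have k2 := off_bound hA hg hG hY (by linarith : 1 ≤ T) ht hb hn1 hn2 (X := X) (H := m^3) (by
      push_cast
      nlinarith [mul_le_mul m1 m1 hT0.le m0.le, sq_nonneg (m:ℝ)]) (by
      rw [hXc]; push_cast
      have : T*(m:ℝ)^3 ≤ m*(m:ℝ)^3 := by gcongr
      have : 0 ≤ (m:ℝ)^4 := by positivity
      nlinarith)
    have k3 := harm X
    rw [hGY] at k2
    have k4 : (X:ℝ)^3*Real.exp (-((T^(ε/2))^2/36)) ≤ 1 := le_trans (by gcongr) c3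
    rw [Finset.sum_add_distrib, Finset.sum_const, Finset.card_range, nsmul_eq_mul] at k2
    have k5 : 52*(1/4+2*t^2+8*G^2)/((m^5:ℕ):ℝ) ≤ 884 := by
      rw [div_le_iff₀ (by positivity)]
      push_cast
      have : t^2 ≤ 4*T^2 := (pow_le_pow_left₀ (by linarith [ht.1]) ht.2 2).trans (le_of_eq (by ring))
      have : G^2 ≤ T^2 := pow_le_pow_left₀ hG.le hG2 2
      have : T^2 ≤ (m:ℝ)^2 := pow_le_pow_left₀ hT0.le m1 2
      have : (m:ℝ)^2 ≤ (m:ℝ)^5 := pow_le_pow_right₀ (by linarith) (by norm_num)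
      have : 1 ≤ (m:ℝ)^5 := one_le_pow₀ (by linarith)
      linarith
    have k6 : A*Real.log (2*X) ≤ A*(5*ℓ) := by gcongr
    have k7 : (n:ℝ)*(3*A) ≤ ℓ*(3*A) := by gcongr
    have k8 : 1 ≤ A*ℓ := one_le_mul_of_one_le_of_one_le hA ℓ1
    have k9 : A ≤ A*ℓ := le_mul_of_one_le_right (by linarith) ℓ1
    have k10 : ℓ ≤ A*ℓ := le_mul_of_one_le_left (by linarith) hA
    change _ ≤ _ + (∑ j ∈ Finset.range n, S j t + _) at k2
    linarith
  have Sc : ∀ j < n, Continuous (S j) := fun j hj => ((hb j).Sb_cont (hn2 j hj) (m^3)).norm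
  have S0 : ∀ j t, 0 ≤ S j t := fun j t => norm_nonneg _
  have hle : T ≤ 2*T := by linarith
  have lH : Real.log ((m^3:ℕ):ℝ) ≤ 3*ℓ := by
    push_cast; rw [Real.log_pow]; push_cast; linarith
  have lH0 : 0 ≤ Real.log ((m^3:ℕ):ℝ) := Real.log_natCast_nonneg _
  have hΛ : 4*(1+Real.log ((m^3:ℕ):ℝ))^3 ≤ 256*ℓ^3 := by
    calc 4*(1+Real.log ((m^3:ℕ):ℝ))^3 ≤ 4*(4*ℓ)^3 := by gcongr; linarith
      _ = _ := by ring
  have lT : Real.log (1+T) ≤ ℓ := by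
    have : Real.log (1+T) ≤ Real.log (2*T) := Real.log_le_log (by linarith) (by linarith)
    refine this.trans ?_
    rw [Real.log_mul (by norm_num) hT0.ne', hℓ]; linarith
  have lT0 : 0 ≤ Real.log (1+T) := Real.log_nonneg (by linarith)
  have cube : ∀ j < n, ∫ t in T..2*T, S j t^3 ≤ 10000000*A^3*(256*ℓ^3)^2*ℓ*T := by
    intro j hj
    have := (hb j).cube hA (hn2 j hj) (m^3) rfl ?_
    · refine this.trans ?_
      gcongr
    · have y0 : 0 < 2^j*Y := by linarith [hYj j]
      have e : (2^j*Y)^3*√(2^j*Y) = (2^j*Y)^(7/2:ℝ) := by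
        rw [Real.sqrt_eq_rpow, ← Real.rpow_natCast, ← Real.rpow_add y0]; norm_num
      rw [e]
      calc 128000*A^2*(4*(1+Real.log ((m^3:ℕ):ℝ))^3)*√T ≤ 128000*A^2*(256*ℓ^3)*√T := by gcongr
        _ ≤ T^(7/4*ε)*√T := by gcongr
        _ = (T^(1/7+ε/2))^(7/2:ℝ) := by
            rw [Real.sqrt_eq_rpow, ← Real.rpow_add hT0, ← Real.rpow_mul hT0.le]; congr 1; ring
        _ ≤ Y^(7/2:ℝ) := by gcongr
        _ ≤ _ := by
            have := hYj j
            gcongr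
  calc ∫ t in T..2*T, J 1 t G^3 ≤ ∫ t in T..2*T, (4*(3400*A*ℓ)^3 + 4*26^3*(n:ℝ)^2*∑ j ∈ Finset.range n, S j t^3) := by
        rw [intervalIntegral.integral_of_le hle, intervalIntegral.integral_of_le hle]
        refine integral_mono_of_nonneg (Filter.Eventually.of_forall fun t => ?_) ?_ ?_
        · exact pow_nonneg (J_nonneg 1 t hG) 3
        · rw [← IntegrableOn, ← intervalIntegrable_iff_integrableOn_Ioc_of_le hle]
          apply Continuous.intervalIntegrable
          refine continuous_const.add (continuous_const.mul (continuous_finsetSum _ fun j hj => (Sc j (Finset.mem_range.1 hj)).pow 3))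
        · filter_upwards [ae_restrict_mem measurableSet_Ioc] with t ht
          have h1 := hJ t ⟨ht.1.le, ht.2⟩
          have h2 := cube_sum n (fun j => S j t) (fun j => S0 j t)
          set s := ∑ j ∈ Finset.range n, S j t with hs
          have s0 : 0 ≤ s := Finset.sum_nonneg fun j _ => S0 j t
          have U0 : 0 ≤ 3400*A*ℓ := by positivity
          calc J 1 t G^3 ≤ (3400*A*ℓ + 26*s)^3 := pow_le_pow_left₀ (J_nonneg 1 t hG) h1 3
            _ ≤ 4*((3400*A*ℓ)^3 + (26*s)^3) := by
                have := add_pow_le U0 (by positivity : 0 ≤ 26*s) 3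
                norm_num at this ⊢; linarith
            _ = 4*(3400*A*ℓ)^3 + 4*26^3*s^3 := by ring
            _ ≤ 4*(3400*A*ℓ)^3 + 4*26^3*((n:ℝ)^2*∑ j ∈ Finset.range n, S j t^3) := by gcongr
            _ = _ := by ring
    _ = 4*(3400*A*ℓ)^3*T + 4*26^3*(n:ℝ)^2*∑ j ∈ Finset.range n, ∫ t in T..2*T, S j t^3 := by
        have ci : ∀ j ∈ Finset.range n, IntervalIntegrable (fun t => S j t^3) volume T (2*T) := fun j hj =>
          ((Sc j (Finset.mem_range.1 hj)).pow 3).intervalIntegrable _ _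
        have cs : IntervalIntegrable (fun t => 4*26^3*(n:ℝ)^2*∑ j ∈ Finset.range n, S j t^3) volume T (2*T) :=
          (continuous_const.mul (continuous_finsetSum _ fun j hj => (Sc j (Finset.mem_range.1 hj)).pow 3)).intervalIntegrable _ _
        rw [intervalIntegral.integral_add intervalIntegrable_const cs, intervalIntegral.integral_const, intervalIntegral.integral_const_mul,
          intervalIntegral.integral_finsetSum ci, smul_eq_mul]
        ring
    _ ≤ 4*(3400*A*ℓ)^3*T + 4*26^3*(n:ℝ)^2*∑ j ∈ Finset.range n, 10000000*A^3*(256*ℓ^3)^2*ℓ*T := by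
        gcongr with j hj
        exact cube j (Finset.mem_range.1 hj)
    _ = 4*(3400*A*ℓ)^3*T + 4*26^3*(n:ℝ)^3*(10000000*A^3*(256*ℓ^3)^2*ℓ*T) := by
        rw [Finset.sum_const, Finset.card_range, nsmul_eq_mul]; ring
    _ ≤ 4*(3400*A*ℓ)^3*T + 4*26^3*ℓ^3*(10000000*A^3*(256*ℓ^3)^2*ℓ*T) := by gcongr
    _ = (4*3400^3*ℓ^3 + 4*26^3*10000000*256^2*ℓ^10)*(A^3*T) := by ring
    _ ≤ (4*3400^3*ℓ^10 + 4*26^3*10000000*256^2*ℓ^10)*(A^3*T) := by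
        have : ℓ^3 ≤ ℓ^10 := pow_le_pow_right₀ ℓ1 (by norm_num)
        gcongr
    _ ≤ _ := by
        have : 0 ≤ A^3*ℓ^10*T := by positivity
        nlinarith

lemma J_small {t G B : ℝ} (hG : 0 < G) (ht : 0 ≤ t) (htB : t ≤ B) (hGB : G ≤ B) : J 1 t G ≤ 100 + 600*B^2 := by
  have k := J_le t G hG 1 le_rfl
  have o : ‖Off (2*1) t G‖ ≤ 1 := by
    have : Off (2*1) t G = -FF t G (1/1+1/2) := by
      unfold Off
      rw [show Finset.Icc 1 (2*1) = {1, 2} by decide, Finset.sum_pair (by norm_num)]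
      simp
    rw [this, norm_neg]
    unfold FF
    rw [norm_mul, ph_norm, mul_one, Complex.norm_real, Real.norm_eq_abs]
    unfold a0
    rw [abs_of_nonneg (by positivity), div_le_one (by apply Real.sqrt_pos.2; norm_num)]
    calc Real.exp _ ≤ 1 := Real.exp_le_one_iff.2 (by have : 0 ≤ G^2/4*psi (1/1+1/2)^2 := by positivity
                                                     linarith)
      _ ≤ _ := by apply Real.one_le_sqrt.2; norm_num
  have s : ∑ n ∈ Finset.Icc 1 (2*1), (1/(n:ℕ):ℝ) ≤ 2 := by
    rw [show Finset.Icc 1 (2*1) = {1, 2} by decide, Finset.sum_pair (by norm_num)]; norm_num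
  have h1 : t^2 ≤ B^2 := pow_le_pow_left₀ ht htB 2
  have h2 : G^2 ≤ B^2 := pow_le_pow_left₀ hG.le hGB 2
  rw [Nat.cast_one, div_one] at k
  linarith [sq_nonneg B]

end TM

namespace TM

lemma ev_log (K : ℝ) (k : ℕ) {η : ℝ} (hη : 0 < η) : ∀ᶠ T : ℝ in Filter.atTop, K*(1+Real.log T)^k ≤ T^η := by
  set s := η/(2*(k+1)) with hs
  have s0 : 0 < s := by positivity
  filter_upwards [(tendsto_rpow_atTop (by positivity : 0 < η/2)).eventually_ge_atTop (abs K * (1+1/s)^k), Filter.eventually_ge_atTop 1] with T h1 h2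
  have T0 : 0 < T := by linarith
  have l0 := Real.log_nonneg h2
  have l1 : 1 + Real.log T ≤ (1+1/s)*T^s := by
    have := Real.log_le_rpow_div T0.le s0
    have : 1 ≤ T^s := Real.one_le_rpow h2 s0.le
    calc 1 + Real.log T ≤ T^s + T^s/s := by linarith
      _ = _ := by ring
  have e : (T^s)^k ≤ T^(η/2) := by
    rw [← Real.rpow_natCast, ← Real.rpow_mul T0.le]
    apply Real.rpow_le_rpow_of_exponent_le h2
    rw [hs, div_mul_eq_mul_div, div_le_div_iff₀ (by positivity) (by norm_num)]
    nlinarith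
  calc K*(1+Real.log T)^k ≤ abs K * (1+Real.log T)^k := by gcongr; exact le_abs_self K
    _ ≤ abs K * ((1+1/s)*T^s)^k := by gcongr
    _ = (abs K * (1+1/s)^k)*(T^s)^k := by rw [mul_pow]; ring
    _ ≤ T^(η/2)*T^(η/2) := by gcongr
    _ = _ := by rw [← Real.rpow_add T0]; congr 1; ring

lemma ev_exp {ε : ℝ} (hε : 0 < ε) : ∀ᶠ T : ℝ in Filter.atTop, (64*T^5)^3*Real.exp (-((T^(ε/2))^2/36)) ≤ 1 := by
  have h := (tendsto_rpow_mul_exp_neg_mul_atTop_nhds_zero (15/ε) (1/36) (by norm_num)).comp (tendsto_rpow_atTop hε)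
  filter_upwards [h.eventually_le_const (show (0:ℝ) < 1/64^3 by norm_num), Filter.eventually_gt_atTop 0] with T h1 T0
  simp only [Function.comp_apply] at h1
  have e1 : (T^ε)^(15/ε) = T^15 := by
    rw [← Real.rpow_mul T0.le, mul_div_cancel₀ _ hε.ne']
    exact_mod_cast Real.rpow_natCast T 15
  have e2 : (T^(ε/2))^2 = T^ε := by
    rw [← Real.rpow_natCast, ← Real.rpow_mul T0.le]; congr 1; push_cast; ring
  rw [e1] at h1
  rw [e2, show -(T^ε/36) = -(1/36)*T^ε by ring]
  calc (64*T^5)^3*Real.exp (-(1/36)*T^ε) = 64^3*(T^15*Real.exp (-(1/36)*T^ε)) := by ring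
    _ ≤ 64^3*(1/64^3) := by gcongr
    _ = 1 := by norm_num

end TM

/-- For every `ε > 0`, `∫_T^{2T} J_1(t,G)^3 dt ≪_ε T^{1+ε}` uniformly for
`T^{1/7+ε} ≤ G ≤ T`, `T ≥ 2`. -/
theorem third_moment_J1 :
    ∀ ε : ℝ, 0 < ε → ∃ C : ℝ, 0 < C ∧
      ∀ T G : ℝ, 2 ≤ T → T ^ (1 / 7 + ε) ≤ G → G ≤ T →
        (∫ t in T..(2 * T), J 1 t G ^ 3) ≤ C * T ^ (1 + ε) := by
  intro ε hε
  obtain ⟨A, hA, hg, hb⟩ := TM.blk_exists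
  obtain ⟨T0, hT0⟩ := Filter.eventually_atTop.1 ((TM.ev_log (128000*A^2*256) 3 (by positivity : 0 < 7/4*ε)).and
    ((TM.ev_exp hε).and (TM.ev_log 1 10 hε)))
  set T1 := max T0 100 with hT1
  set B := 100 + 600*(2*T1)^2 with hB
  have B0 : 0 < B := by positivity
  refine ⟨10^18*A^3 + B^3, by positivity, ?_⟩
  intro T G hT hG1 hG2
  have hTp : 0 < T := by linarith
  have hG : 0 < G := lt_of_lt_of_le (Real.rpow_pos_of_pos hTp _) hG1
  have eT : T^(1+ε) = T*T^ε := by rw [Real.rpow_add hTp, Real.rpow_one]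
  have Te : 1 ≤ T^ε := Real.one_le_rpow (by linarith) hε.le
  rcases le_total T1 T with h | h
  · obtain ⟨h1, h2, h3⟩ := hT0 T ((le_max_left _ _).trans h)
    have k := TM.main_big hA hg hb hε ((le_max_right _ _).trans h) hG1 hG2 (by rw [← mul_assoc]; exact h1) h2
    refine k.trans ?_
    rw [one_mul] at h3
    rw [eT]
    calc 10^18*A^3*(1+Real.log T)^10*T ≤ 10^18*A^3*T^ε*T := by gcongr
      _ = 10^18*A^3*(T*T^ε) := by ring
      _ ≤ _ := by gcongr; have : 0 ≤ B^3 := by positivity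
                  linarith
  · have k : ∀ t ∈ Set.Icc T (2*T), J 1 t G ≤ B := fun t ht =>
      TM.J_small hG (by linarith [ht.1]) (by linarith [ht.2]) (by linarith)
    have hle : T ≤ 2*T := by linarith
    have : ∫ t in T..(2*T), (J 1 t G)^3 ≤ ∫ t in T..(2*T), B^3 := by
      rw [intervalIntegral.integral_of_le hle, intervalIntegral.integral_of_le hle]
      refine integral_mono_of_nonneg (Filter.Eventually.of_forall fun t => ?_) (integrable_const _) ?_
      · exact pow_nonneg (TM.J_nonneg 1 t hG) 3
      · filter_upwards [ae_restrict_mem measurableSet_Ioc] with t ht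
        exact pow_le_pow_left₀ (TM.J_nonneg 1 t hG) (k t ⟨ht.1.le, ht.2⟩) 3
    refine this.trans ?_
    rw [intervalIntegral.integral_const, smul_eq_mul, eT]
    calc (2*T-T)*B^3 = B^3*(T*1) := by ring
      _ ≤ B^3*(T*T^ε) := by gcongr
      _ ≤ _ := by gcongr; have : 0 ≤ A^3 := by positivity
                  linarith
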